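/- Weighted First Fundamental Theorem (Theorem 5.1(a)): Let φ ≥ 1 be a random variable on Ω with |g^i| ≤ φ for i = 1,…,e, and let 𝒬_φ := {Q ∈ 𝒬 : E_Q[φ] < ∞}. Then the following are equivalent: (i) NA(𝒫) holds; (ii) for every P ∈ 𝒫 there exists Q ∈ 𝒬_φ such that P ≪ Q. -/

import Mathlib

open MeasureTheory Set Filter Topology
open scoped ENNReal NNReal

noncomputable section

namespace BN

/-- The universal completion of the ambient measurable structure on `α`:
a set is measurable iff it is null-measurable for every probability measure. -/
def univComp (α : Type*) [MeasurableSpace α] : MeasurableSpace α where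
  MeasurableSet' s := ∀ μ : Measure α, IsProbabilityMeasure μ → NullMeasurableSet s μ
  measurableSet_empty := fun _ _ => MeasurableSet.empty.nullMeasurableSet
  measurableSet_compl := fun _ hs μ hμ => (hs μ hμ).compl
  measurableSet_iUnion := fun _ hf μ hμ => NullMeasurableSet.iUnion fun i => hf i μ hμ

/-- `N` is `PP`-polar: it is contained in an `m`-measurable set which is null under
every `P ∈ PP`. -/
def IsPolar {α : Type*} [MeasurableSpace α] (PP : Set (Measure α)) (m : MeasurableSpace α)
    (N : Set α) : Prop :=
  ∃ A : Set α, MeasurableSet[m] A ∧ N ⊆ A ∧ ∀ P ∈ PP, P A = 0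

/-- A property holds `PP`-quasi surely if its complement is `PP`-polar. -/
def QuasiSure {α : Type*} [mα : MeasurableSpace α] (PP : Set (Measure α))
    (m : MeasurableSpace α) (p : α → Prop) : Prop :=
  @IsPolar α mα PP m {ω | ¬ p ω}

/-- Expectation of a real random variable, with the convention
`E[f] = E[f⁺] - E[f⁻]` and `∞ - ∞ = -∞` (which holds in `EReal`). -/
def expec {α : Type*} [MeasurableSpace α] (Q : Measure α) (f : α → ℝ) : EReal :=
  ((∫⁻ x, ENNReal.ofReal (f x) ∂Q : ℝ≥0∞) : EReal)
    - ((∫⁻ x, ENNReal.ofReal (-f x) ∂Q : ℝ≥0∞) : EReal)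

/-- Positive part of an extended real, valued in `ℝ≥0∞`. -/
def posE (x : EReal) : ℝ≥0∞ := if x = ⊤ then ⊤ else ENNReal.ofReal x.toReal

/-- Expectation of an extended-real random variable, with the convention
`E[f] = E[f⁺] - E[f⁻]` and `∞ - ∞ = -∞`. -/
def eexpec {α : Type*} [MeasurableSpace α] (Q : Measure α) (f : α → EReal) : EReal :=
  ((∫⁻ x, posE (f x) ∂Q : ℝ≥0∞) : EReal) - ((∫⁻ x, posE (-(f x)) ∂Q : ℝ≥0∞) : EReal)

/-- A real-valued function is upper semianalytic if all its strict superlevel sets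
are analytic. -/
def UpperSemianalytic {α : Type*} [TopologicalSpace α] (f : α → ℝ) : Prop :=
  ∀ c : ℝ, AnalyticSet {x | c < f x}

/-- An extended-real-valued function is upper semianalytic if all its strict
superlevel sets `{f > c}`, `c ∈ ℝ`, are analytic. -/
def UpperSemianalyticE {α : Type*} [TopologicalSpace α] (f : α → EReal) : Prop :=
  ∀ c : ℝ, AnalyticSet {x | (c : EReal) < f x}

/-- Convexity of a set of probability measures. -/
def ConvexPM {α : Type*} [MeasurableSpace α] (C : Set (ProbabilityMeasure α)) : Prop :=
  ∀ μ ∈ C, ∀ ν ∈ C, ∀ a b : ℝ≥0∞, a + b = 1 →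
    ∀ ξ : ProbabilityMeasure α, (ξ : Measure α) = a • (μ : Measure α) + b • (ν : Measure α) →
      ξ ∈ C

/-! ### The general (non-Polish) setting of Section 2 -/

section General

variable {Ω : Type*} [MeasurableSpace Ω]

/-- Predictability of a trading strategy `H` with respect to a filtration `F`:
the holding `H (u+1)` over the period `(u, u+1]` is `F u`-measurable. -/
def PredictableF (F : ℕ → MeasurableSpace Ω) (T d : ℕ) (H : ℕ → Ω → Fin d → ℝ) : Prop :=
  ∀ u : ℕ, u < T → Measurable[F u] (H (u + 1))

/-- The final gain `(H · S)_T` from trading `H` in the stocks `S`. -/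
def gainF {d : ℕ} (S : ℕ → Ω → Fin d → ℝ) (H : ℕ → Ω → Fin d → ℝ) (T : ℕ) (ω : Ω) : ℝ :=
  ∑ u : Fin T, ∑ i : Fin d, H (u + 1) ω i * (S (u + 1) ω i - S u ω i)

/-- The no-arbitrage condition `NA(PP)` (no options). -/
def NAF (F : ℕ → MeasurableSpace Ω) (T d : ℕ) (S : ℕ → Ω → Fin d → ℝ)
    (PP : Set (Measure Ω)) : Prop :=
  ∀ H : ℕ → Ω → Fin d → ℝ, PredictableF F T d H →
    QuasiSure PP ‹MeasurableSpace Ω› (fun ω => 0 ≤ gainF S H T ω) →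
      QuasiSure PP ‹MeasurableSpace Ω› (fun ω => gainF S H T ω = 0)

/-- The cone `𝒞` of claims superreplicable from zero initial capital. -/
def Cset (F : ℕ → MeasurableSpace Ω) (T d : ℕ) (S : ℕ → Ω → Fin d → ℝ) : Set (Ω → ℝ) :=
  {W | ∃ H : ℕ → Ω → Fin d → ℝ, PredictableF F T d H ∧
    ∃ K : Ω → ℝ, Measurable K ∧ (∀ ω, 0 ≤ K ω) ∧ ∀ ω, W ω = gainF S H T ω - K ω}

/-- The superhedging price (no options), with values in `EReal` (`inf ∅ = +∞`). -/
def superPriceF (F : ℕ → MeasurableSpace Ω) (T d : ℕ) (S : ℕ → Ω → Fin d → ℝ)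
    (PP : Set (Measure Ω)) (f : Ω → ℝ) : EReal :=
  sInf ((fun x : ℝ => (x : EReal)) ''
    {x : ℝ | ∃ H : ℕ → Ω → Fin d → ℝ, PredictableF F T d H ∧
      QuasiSure PP ‹MeasurableSpace Ω› (fun ω => f ω ≤ x + gainF S H T ω)})

end General

/-! ### The one-period setting of Section 3 -/

section OnePeriod

variable {Ω : Type*} [MeasurableSpace Ω] {d : ℕ}

/-- One-period no-arbitrage condition `NA(PP)` for the increment `ΔS`. -/
def NA1 (PP : Set (Measure Ω)) (ΔS : Ω → Fin d → ℝ) : Prop :=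
  ∀ y : Fin d → ℝ,
    QuasiSure PP ‹MeasurableSpace Ω› (fun ω => 0 ≤ ∑ i, y i * ΔS ω i) →
      QuasiSure PP ‹MeasurableSpace Ω› (fun ω => ∑ i, y i * ΔS ω i = 0)

/-- The martingale measures dominated by `PP` in the one-period market:
`𝒬 = {Q : Q ⋘ 𝒫, E_Q[ΔS] = 0}`. -/
def Q1set (PP : Set (Measure Ω)) (ΔS : Ω → Fin d → ℝ) : Set (Measure Ω) :=
  {Q | IsProbabilityMeasure Q ∧ (∃ P ∈ PP, Q ≪ P) ∧
    ∀ i, expec Q (fun ω => ΔS ω i) = 0}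

/-- One-period superhedging price, with values in `EReal` (`inf ∅ = +∞`). -/
def superPrice1 (PP : Set (Measure Ω)) (ΔS : Ω → Fin d → ℝ) (f : Ω → ℝ) : EReal :=
  sInf ((fun x : ℝ => (x : EReal)) ''
    {x : ℝ | ∃ H : Fin d → ℝ,
      QuasiSure PP ‹MeasurableSpace Ω› (fun ω => f ω ≤ x + ∑ i, H i * ΔS ω i)})

end OnePeriod

/-! ### The Polish multi-period setting -/

section Polish

variable (Ω₁ : Type) [MeasurableSpace Ω₁]

/-- Restriction of a path up to time `t`. -/
def restr {T : ℕ} (t : ℕ) (h : t ≤ T) (ω : Fin T → Ω₁) : Fin t → Ω₁ :=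
  fun i => ω (Fin.castLE h i)

/-- Universally measurable predictability: `H u` (the holding over `(u, u+1]`)
is a universally measurable function of the first `u` coordinates. -/
def Pred (d : ℕ) (H : (u : ℕ) → (Fin u → Ω₁) → Fin d → ℝ) : Prop :=
  ∀ u : ℕ, @Measurable _ _ (univComp (Fin u → Ω₁)) _ (H u)

/-- The gain `(H · S)_t = ∑_{u=1}^t H_u (S_u - S_{u-1})` up to time `t ≤ T`. -/
def gain {T d : ℕ} (S : (t : ℕ) → (Fin t → Ω₁) → Fin d → ℝ)
    (H : (u : ℕ) → (Fin u → Ω₁) → Fin d → ℝ) (t : ℕ) (h : t ≤ T) (ω : Fin T → Ω₁) : ℝ :=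
  ∑ u : Fin t, ∑ i : Fin d,
    H u (restr Ω₁ u (u.2.le.trans h) ω) i *
      (S (u + 1) (restr Ω₁ (u + 1) (Nat.succ_le_of_lt (u.2.trans_le h)) ω) i
        - S u (restr Ω₁ u (u.2.le.trans h) ω) i)

variable [TopologicalSpace Ω₁] [OpensMeasurableSpace Ω₁]

/-- The set `PP = {P₀ ⊗ ⋯ ⊗ P_{t-1}}` of measures built from universally
measurable selectors of the one-step collections `𝒫_s(·)`. -/
def MeasFam (Pt : (t : ℕ) → (Fin t → Ω₁) → Set (ProbabilityMeasure Ω₁)) :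
    (t : ℕ) → Set (Measure (Fin t → Ω₁))
  | 0 => {μ | μ = Measure.dirac Fin.elim0}
  | (t + 1) => {μ | ∃ ν ∈ MeasFam Pt t, ∃ κ : (Fin t → Ω₁) → ProbabilityMeasure Ω₁,
      @Measurable _ _ (univComp (Fin t → Ω₁)) (borel (ProbabilityMeasure Ω₁)) κ ∧
      (∀ ω, κ ω ∈ Pt t ω) ∧
      μ = ν.bind (fun ω => Measure.map (Fin.snoc ω) (κ ω : Measure Ω₁))}

/-- The σ-field `ℱ_t` on `Ω = Ω₁^T`: the comap under the restriction map of the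
universal completion of the Borel σ-field of `Ω₁^t`. -/
def filtr (T : ℕ) (t : ℕ) (h : t ≤ T) : MeasurableSpace (Fin T → Ω₁) :=
  MeasurableSpace.comap (restr Ω₁ t h) (univComp (Fin t → Ω₁))

/-- `S` is a `Q`-martingale with respect to the filtration `(ℱ_t)`. -/
def IsMartMeas {T d : ℕ} (S : (t : ℕ) → (Fin t → Ω₁) → Fin d → ℝ)
    (Q : Measure (Fin T → Ω₁)) : Prop :=
  (∀ (t : ℕ) (h : t ≤ T) (i : Fin d), Integrable (fun ω => S t (restr Ω₁ t h ω) i) Q) ∧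
  (∀ (t : ℕ) (h : t + 1 ≤ T) (i : Fin d) (A : Set (Fin T → Ω₁)),
    MeasurableSet[filtr Ω₁ T t ((Nat.le_succ t).trans h)] A →
      ∫ ω in A, S (t + 1) (restr Ω₁ (t + 1) h ω) i ∂Q
        = ∫ ω in A, S t (restr Ω₁ t ((Nat.le_succ t).trans h) ω) i ∂Q)

/-- The martingale measures `Q ⋘ PP` consistent with the option prices:
`𝒬 = {Q ⋘ PP : S is a Q-martingale, E_Q[gⁱ] = 0}`. -/
def QSet {T d e : ℕ} (PP : Set (Measure (Fin T → Ω₁)))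
    (S : (t : ℕ) → (Fin t → Ω₁) → Fin d → ℝ) (g : Fin e → (Fin T → Ω₁) → ℝ) :
    Set (Measure (Fin T → Ω₁)) :=
  {Q | IsProbabilityMeasure Q ∧ (∃ P ∈ PP, Q ≪ P) ∧ IsMartMeas Ω₁ S Q ∧
    ∀ i : Fin e, expec Q (g i) = 0}

/-- The no-arbitrage condition `NA(PP)` with semistatic trading in the stocks `S`
and the options `g`. -/
def NA {T d e : ℕ} (PP : Set (Measure (Fin T → Ω₁)))
    (S : (t : ℕ) → (Fin t → Ω₁) → Fin d → ℝ) (g : Fin e → (Fin T → Ω₁) → ℝ) : Prop :=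
  ∀ H : (u : ℕ) → (Fin u → Ω₁) → Fin d → ℝ, Pred Ω₁ d H → ∀ h : Fin e → ℝ,
    QuasiSure PP (univComp (Fin T → Ω₁))
      (fun ω => 0 ≤ gain Ω₁ S H T le_rfl ω + ∑ i, h i * g i ω) →
    QuasiSure PP (univComp (Fin T → Ω₁))
      (fun ω => gain Ω₁ S H T le_rfl ω + ∑ i, h i * g i ω = 0)

/-- The minimal semistatic superhedging price, valued in `EReal` (`inf ∅ = +∞`). -/
def superPrice {T d e : ℕ} (PP : Set (Measure (Fin T → Ω₁)))
    (S : (t : ℕ) → (Fin t → Ω₁) → Fin d → ℝ) (g : Fin e → (Fin T → Ω₁) → ℝ)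
    (f : (Fin T → Ω₁) → ℝ) : EReal :=
  sInf ((fun x : ℝ => (x : EReal)) ''
    {x : ℝ | ∃ H : (u : ℕ) → (Fin u → Ω₁) → Fin d → ℝ, ∃ h : Fin e → ℝ, Pred Ω₁ d H ∧
      QuasiSure PP (univComp (Fin T → Ω₁))
        (fun ω => f ω ≤ x + gain Ω₁ S H T le_rfl ω + ∑ i, h i * g i ω)})

/-- `f` is replicable by semistatic trading. -/
def Replicable {T d e : ℕ} (PP : Set (Measure (Fin T → Ω₁)))
    (S : (t : ℕ) → (Fin t → Ω₁) → Fin d → ℝ) (g : Fin e → (Fin T → Ω₁) → ℝ)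
    (f : (Fin T → Ω₁) → ℝ) : Prop :=
  ∃ x : ℝ, ∃ H : (u : ℕ) → (Fin u → Ω₁) → Fin d → ℝ, ∃ h : Fin e → ℝ, Pred Ω₁ d H ∧
    QuasiSure PP (univComp (Fin T → Ω₁))
      (fun ω => x + gain Ω₁ S H T le_rfl ω + ∑ i, h i * g i ω = f ω)

/-- The one-period increment `ΔS_{t+1}(ω, ·)` of the stock, given history `ω ∈ Ω_t`. -/
def incr {d : ℕ} (S : (t : ℕ) → (Fin t → Ω₁) → Fin d → ℝ) (t : ℕ) (ω : Fin t → Ω₁)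
    (x : Ω₁) : Fin d → ℝ :=
  fun i => S (t + 1) (Fin.snoc ω x) i - S t ω i

/-- The one-step martingale measures `𝒬_t(ω)` dominated by `𝒫_t(ω)`. -/
def Q1fam {d : ℕ} (Pt : (t : ℕ) → (Fin t → Ω₁) → Set (ProbabilityMeasure Ω₁))
    (S : (t : ℕ) → (Fin t → Ω₁) → Fin d → ℝ) (t : ℕ) (ω : Fin t → Ω₁) :
    Set (ProbabilityMeasure Ω₁) :=
  {Q | (∃ P' ∈ Pt t ω, (Q : Measure Ω₁) ≪ (P' : Measure Ω₁)) ∧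
    ∀ i, expec (Q : Measure Ω₁) (fun x => incr Ω₁ S t ω x i) = 0}

/-- `V` is a `Q`-supermartingale with respect to the filtration `(ℱ_t)`:
each `V_t` is `Q`-integrable and `E_Q[V_{t+1} | ℱ_t] ≤ V_t`. -/
def IsSupermart {T : ℕ} (V : ℕ → (Fin T → Ω₁) → ℝ) (Q : Measure (Fin T → Ω₁)) : Prop :=
  (∀ t : ℕ, t ≤ T → Integrable (V t) Q) ∧
  ∀ (t : ℕ) (h : t + 1 ≤ T) (A : Set (Fin T → Ω₁)),
    MeasurableSet[filtr Ω₁ T t ((Nat.le_succ t).trans h)] A →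
      ∫ ω in A, V (t + 1) ω ∂Q ≤ ∫ ω in A, V t ω ∂Q

end Polish

/-! ### Quasi-sure supports -/

/-- The quasi-sure support of a family of measures on `ℝ^d`. -/
def qsSupp {d : ℕ} (Rs : Set (Measure (Fin d → ℝ))) : Set (Fin d → ℝ) :=
  ⋂₀ {A : Set (Fin d → ℝ) | IsClosed A ∧ ∀ R ∈ Rs, R A = 1}

end BN

namespace BN

open ProbabilityTheory

/-! ### Universal measurability of analytic sets -/

lemma exists_cylinder_subset_of_isOpen (σ : ℕ → ℕ) {V : Set (ℕ → ℕ)} (hV : IsOpen V)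
    (h : {τ : ℕ → ℕ | ∀ i, τ i ≤ σ i} ⊆ V) : ∃ n, {τ : ℕ → ℕ | ∀ i < n, τ i ≤ σ i} ⊆ V := by
  by_contra! hcon
  have hex : ∀ n, ∃ τ : ℕ → ℕ, (∀ i < n, τ i ≤ σ i) ∧ τ ∉ V := fun n => by
    obtain ⟨τ, h1, h2⟩ := Set.not_subset.1 (hcon n)
    exact ⟨τ, h1, h2⟩
  choose τ hτ hτV using hex
  have hK : IsCompact (Set.pi univ fun i => Set.Iic (σ i)) :=
    isCompact_univ_pi fun i => (Set.finite_Iic _).isCompact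
  obtain ⟨t, ht, ψ, hψ, hlim⟩ := hK.tendsto_subseq (x := fun n i => min (τ n i) (σ i))
    (fun n i _ => mem_Iic.2 (min_le_right _ _))
  have hlim2 : Tendsto (τ ∘ ψ) atTop (𝓝 t) := by
    rw [tendsto_pi_nhds] at hlim ⊢
    intro i
    refine (hlim i).congr' ?_
    filter_upwards [hψ.tendsto_atTop.eventually_gt_atTop i] with n hn
    exact min_eq_left (hτ _ i hn)
  have : t ∈ Vᶜ := hV.isClosed_compl.mem_of_tendsto hlim2
    (Eventually.of_forall fun n => hτV _)
  exact this (h fun i => ht i (mem_univ i))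

lemma exists_measurableSet_subset_range {Z : Type*} [TopologicalSpace Z] [PolishSpace Z]
    [MeasurableSpace Z] [BorelSpace Z] (μ : Measure Z) [IsFiniteMeasure μ] {q : (ℕ → ℕ) → Z}
    (hq : Continuous q) {c : ℝ≥0∞} (hc : c < μ (range q)) :
    ∃ K ⊆ range q, MeasurableSet K ∧ c ≤ μ K := by
  have hstep : ∀ n (σ : ℕ → ℕ), c < μ (q '' {τ | ∀ i < n, τ i ≤ σ i}) →
      ∃ k, c < μ (q '' {τ | ∀ i < n + 1, τ i ≤ Function.update σ n k i}) := by
    intro n σ h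
    have hU : (q '' {τ | ∀ i < n, τ i ≤ σ i}) =
        ⋃ k, q '' {τ | ∀ i < n + 1, τ i ≤ Function.update σ n k i} := by
      rw [← image_iUnion]
      congr 1
      ext τ
      simp only [mem_ofPred_eq, mem_iUnion]
      constructor
      · intro h
        refine ⟨τ n, fun i hi => ?_⟩
        rcases Nat.lt_succ_iff_lt_or_eq.1 hi with h1 | rfl
        · rw [Function.update_of_ne h1.ne]; exact h i h1
        · simp
      · rintro ⟨k, hk⟩ i hi
        have := hk i (by omega)
        rwa [Function.update_of_ne hi.ne] at this
    have hmono : Monotone fun k => q '' {τ | ∀ i < n + 1, τ i ≤ Function.update σ n k i} := by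
      intro k l hkl
      apply image_mono
      intro τ hτ i hi
      refine (hτ i hi).trans ?_
      by_cases h : i = n
      · subst h; simpa using hkl
      · simp [Function.update_of_ne h]
    rw [hU, hmono.measure_iUnion] at h
    exact lt_iSup_iff.1 h
  choose! k hk using hstep
  let s : ℕ → ℕ → ℕ := fun n => Nat.rec (fun _ => 0) (fun n σ => Function.update σ n (k n σ)) n
  have hs : ∀ n, s (n + 1) = Function.update (s n) n (k n (s n)) := fun n => rfl
  have hlt : ∀ n, c < μ (q '' {τ | ∀ i < n, τ i ≤ s n i}) := by
    intro n
    induction n with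
    | zero => simpa using hc
    | succ n ih => rw [hs]; exact hk n _ ih
  let σ : ℕ → ℕ := fun i => s (i + 1) i
  have hσ : ∀ n, ∀ i < n, s n i = σ i := by
    intro n
    induction n with
    | zero => intro i hi; omega
    | succ n ih =>
      intro i hi
      rcases Nat.lt_succ_iff_lt_or_eq.1 hi with h1 | rfl
      · rw [hs, Function.update_of_ne h1.ne, ih i h1]
      · rfl
  have hKc : IsCompact (q '' {τ | ∀ i, τ i ≤ σ i}) := by
    refine IsCompact.image ?_ hq
    have hK : IsCompact (Set.pi univ fun i => Set.Iic (σ i)) :=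
      isCompact_univ_pi fun i => (Set.finite_Iic _).isCompact
    convert hK using 1
    ext τ; exact ⟨fun h i _ => h i, fun h i => h i (mem_univ i)⟩
  refine ⟨_, image_subset_range _ _, hKc.measurableSet, ?_⟩
  rw [Set.measure_eq_iInf_isOpen]
  refine le_iInf₂ fun U hU => le_iInf fun hUo => ?_
  obtain ⟨n, hn⟩ := exists_cylinder_subset_of_isOpen σ (hUo.preimage hq) (image_subset_iff.1 hU)
  refine (hlt n).le.trans (measure_mono (image_subset_iff.2 ?_))
  intro τ hτ
  exact hn fun i hi => by rw [← hσ n i hi]; exact hτ i hi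

lemma nullMeasurableSet_range {Z : Type*} [TopologicalSpace Z] [PolishSpace Z]
    [MeasurableSpace Z] [BorelSpace Z] (μ : Measure Z) [IsFiniteMeasure μ] {q : (ℕ → ℕ) → Z}
    (hq : Continuous q) : NullMeasurableSet (range q) μ := by
  rcases eq_or_ne (μ (range q)) 0 with h0 | h0
  · exact NullMeasurableSet.of_null h0
  obtain ⟨u, -, hu, hlim⟩ := exists_seq_strictMono_tendsto' (pos_iff_ne_zero.2 h0)
  choose K hK hKm hKμ using fun n => exists_measurableSet_subset_range μ hq (hu n).2
  have hB : MeasurableSet (⋃ n, K n) := MeasurableSet.iUnion hKm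
  refine hB.nullMeasurableSet.congr (ae_eq_of_subset_of_measure_ge (iUnion_subset hK) ?_
    hB.nullMeasurableSet (measure_ne_top _ _))
  exact le_of_tendsto' hlim fun n => (hKμ n).trans (measure_mono (subset_iUnion K n))

lemma _root_.MeasureTheory.AnalyticSet.univComp {Z : Type*} [TopologicalSpace Z] [PolishSpace Z]
    [MeasurableSpace Z] [BorelSpace Z] {A : Set Z} (hA : AnalyticSet A) :
    MeasurableSet[univComp Z] A := by
  rintro μ hμ
  rw [AnalyticSet] at hA
  rcases hA with rfl | ⟨q, hq, rfl⟩
  · exact nullMeasurableSet_empty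
  · exact nullMeasurableSet_range μ hq

lemma exists_measurable_section {Z : Type*} [TopologicalSpace Z] [PolishSpace Z]
    [MeasurableSpace Z] [BorelSpace Z] {q : (ℕ → ℕ) → Z} (hq : Continuous q) :
    ∃ s : Z → ℕ → ℕ, Measurable[univComp Z] s ∧ ∀ z ∈ range q, q (s z) = z := by
  classical
  let E : List ℕ → Set Z := fun l => q '' {τ | ∀ i (h : i < l.length), τ i = l[i]}
  have hE : ∀ l, MeasurableSet[univComp Z] (E l) := by
    intro l
    refine AnalyticSet.univComp ?_
    refine IsClosed.analyticSet ?_ |>.image_of_continuous hq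
    have : {τ : ℕ → ℕ | ∀ i (h : i < l.length), τ i = l[i]} =
        ⋂ i, ⋂ (h : i < l.length), {τ | τ i = l[i]} := by ext; simp
    rw [this]
    exact isClosed_iInter fun i => isClosed_iInter fun h =>
      isClosed_eq (continuous_apply i) continuous_const
  let step : List ℕ → Z → ℕ := fun l z => sInf {k | z ∈ E (l ++ [k])}
  have hstep : ∀ l, Measurable[univComp Z] (step l) := by
    intro l
    refine @measurable_to_countable' _ _ _ _ (univComp Z) _ fun k => ?_
    have : step l ⁻¹' {k} = ({z | z ∈ E (l ++ [k])} ∩ ⋂ j, ⋂ (_ : j < k), {z | z ∉ E (l ++ [j])}) ∪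
        ({z | k = 0} ∩ ⋂ j, {z | z ∉ E (l ++ [j])}) := by
      ext z
      simp only [mem_preimage, mem_singleton_iff, mem_union, mem_inter_iff, mem_ofPred_eq,
        mem_iInter, step]
      by_cases hne : ∃ j, z ∈ E (l ++ [j])
      · constructor
        · rintro rfl
          exact Or.inl ⟨Nat.sInf_mem hne, fun j hj => Nat.notMem_of_lt_sInf hj⟩
        · rintro (⟨h1, h2⟩ | ⟨-, h2⟩)
          · refine le_antisymm (Nat.sInf_le h1) ?_
            by_contra! hlt
            exact h2 _ hlt (Nat.sInf_mem hne)
          · exact absurd hne (by simpa using h2)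
      · push Not at hne
        have : {k | z ∈ E (l ++ [k])} = ∅ := by ext; simp [hne]
        rw [this]
        simp [hne, eq_comm]
    rw [this]
    have hc : ∀ l, MeasurableSet[univComp Z] {z | z ∉ E l} := fun l => (hE l).compl
    exact @MeasurableSet.union _ (univComp Z) _ _
      (@MeasurableSet.inter _ (univComp Z) _ _ (hE _)
        (.iInter fun j => .iInter fun _ => hc _))
      (@MeasurableSet.inter _ (univComp Z) _ _ (.const _) (.iInter fun j => hc _))
  let _ : MeasurableSpace (List ℕ) := ⊤
  let pre : ℕ → Z → List ℕ := fun n z => Nat.rec [] (fun _ l => l ++ [step l z]) n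
  have hpre : ∀ n z, pre (n + 1) z = pre n z ++ [step (pre n z) z] := fun _ _ => rfl
  have hprem : ∀ n, Measurable[univComp Z] (pre n) := by
    intro n
    induction n with
    | zero => exact @measurable_const _ _ _ (univComp Z) _
    | succ n ih =>
      refine @measurable_to_countable' _ _ _ _ (univComp Z) _ fun l => ?_
      have : pre (n + 1) ⁻¹' {l} = ⋃ l' : List ℕ, ⋃ k : ℕ,
          {_z : Z | l' ++ [k] = l} ∩ (pre n ⁻¹' {l'} ∩ step l' ⁻¹' {k}) := by
        ext z; simp [hpre]
      rw [this]
      exact .iUnion fun l' => .iUnion fun k => @MeasurableSet.inter _ (univComp Z) _ _ (.const _)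
        (@MeasurableSet.inter _ (univComp Z) _ _ (ih (by trivial)) (hstep l' (by trivial)))
  have hlen : ∀ n z, (pre n z).length = n := by
    intro n z
    induction n with
    | zero => rfl
    | succ n ih => simp [hpre, ih]
  let s : Z → ℕ → ℕ := fun z n => step (pre n z) z
  refine ⟨s, ?_, ?_⟩
  · refine @measurable_pi_lambda _ _ _ (univComp Z) _ _ fun n => ?_
    refine @measurable_to_countable' _ _ _ _ (univComp Z) _ fun k => ?_
    have : (fun z => s z n) ⁻¹' {k} = ⋃ l' : List ℕ, (pre n ⁻¹' {l'} ∩ step l' ⁻¹' {k}) := by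
      ext z; simp [s]
    rw [this]
    exact .iUnion fun l' =>
        (@MeasurableSet.inter _ (univComp Z) _ _ (hprem n (by trivial)) (hstep l' (by trivial)))
  · intro z hz
    have hmem : ∀ n, z ∈ E (pre n z) := by
      intro n
      induction n with
      | zero => obtain ⟨τ, rfl⟩ := hz; exact ⟨τ, fun i hi => absurd hi (by simp [pre]), rfl⟩
      | succ n ih =>
        rw [hpre]
        have : {k | z ∈ E (pre n z ++ [k])}.Nonempty := by
          obtain ⟨τ, hτ, h⟩ := ih
          refine ⟨τ n, τ, fun i hi => ?_, h⟩
          rw [List.getElem_append]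
          split_ifs with h'
          · exact hτ i h'
          · rw [List.length_append, hlen] at hi
            rw [hlen] at h'
            have : i = n := by simp at hi; omega
            subst this; simp
        exact Nat.sInf_mem this
    have hget : ∀ n i (hi : i < (pre n z).length), (pre n z)[i] = s z i := by
      intro n
      induction n with
      | zero => intro i hi; simp [pre] at hi
      | succ n ih =>
        intro i hi
        simp only [hpre]
        rw [List.getElem_append]
        split_ifs with h'
        · exact ih i h'
        · have hi' : i < n + 1 := hi.trans_eq (hlen (n + 1) z)
          rw [hlen] at h'
          have : i = n := by omega
          subst this; simp [s]
    choose τ hτ hqτ using hmem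
    have hlim : Tendsto τ atTop (𝓝 (s z)) := by
      rw [tendsto_pi_nhds]
      intro i
      refine tendsto_const_nhds.congr' ?_
      filter_upwards [eventually_gt_atTop i] with n hn
      have hi : i < (pre n z).length := by rw [hlen]; exact hn
      rw [hτ n i hi, hget n i hi]
    exact tendsto_nhds_unique ((hq.tendsto _).comp hlim) (tendsto_const_nhds.congr fun n => (hqτ n).symm)

/-! ### The space of probability measures is standard Borel -/

lemma exists_countable_isPiSystem (Y : Type*) [m : MeasurableSpace Y]
    [MeasurableSpace.CountablyGenerated Y] :
    ∃ s : ℕ → Set Y, m = MeasurableSpace.generateFrom (range s) ∧ IsPiSystem (range s) := by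
  have hA := isSetAlgebra_generateSetAlgebra (𝒜 := MeasurableSpace.countableGeneratingSet Y)
  have hc := countable_generateSetAlgebra
    (MeasurableSpace.countable_countableGeneratingSet (α := Y))
  obtain ⟨s, hs⟩ := hc.exists_eq_range ⟨∅, hA.empty_mem⟩
  refine ⟨s, ?_, ?_⟩
  · rw [← hs, generateFrom_generateSetAlgebra_eq,
      MeasurableSpace.generateFrom_countableGeneratingSet]
  · rw [← hs]
    exact fun a ha b hb _ => hA.inter_mem ha hb

lemma measurable_probabilityMeasure_iff {X Y : Type*} [MeasurableSpace X] [MeasurableSpace Y]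
    {f : X → ProbabilityMeasure Y} : Measurable f ↔ Measurable fun x => (f x : Measure Y) :=
  ⟨fun h => measurable_subtype_coe.comp h, fun h => h.subtype_mk⟩

lemma measurable_coe_probabilityMeasure {Y : Type*} [MeasurableSpace Y] :
    Measurable fun μ : ProbabilityMeasure Y => (μ : Measure Y) := measurable_subtype_coe

lemma measurable_apply_probabilityMeasure {Y : Type*} [MeasurableSpace Y] {s : Set Y}
    (hs : MeasurableSet s) : Measurable fun μ : ProbabilityMeasure Y => (μ : Measure Y) s :=
  (Measure.measurable_coe hs).comp measurable_coe_probabilityMeasure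

instance {Y : Type*} [m : MeasurableSpace Y] [MeasurableSpace.CountablyGenerated Y] :
    MeasurableSpace.CountablySeparated (ProbabilityMeasure Y) := by
  obtain ⟨s, hs, hpi⟩ := exists_countable_isPiSystem Y
  have hsm : ∀ n, MeasurableSet (s n) := fun n => by
    rw [hs]; exact MeasurableSpace.measurableSet_generateFrom (mem_range_self n)
  let f : ProbabilityMeasure Y → ℕ → ℝ≥0∞ := fun μ n => (μ : Measure Y) (s n)
  have hf : Measurable f := measurable_pi_lambda _ fun n =>
    measurable_apply_probabilityMeasure (hsm n)
  have hinj : Function.Injective f := by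
    intro μ ν h
    refine Subtype.ext (@ext_of_generate_finite _ _ (μ : Measure Y) (ν : Measure Y) (range s)
      hs hpi inferInstance ?_ (by simp))
    rintro _ ⟨n, rfl⟩
    exact congrFun h n
  obtain ⟨S, hSc, hSm, hS⟩ := (inferInstance : MeasurableSpace.CountablySeparated (ℕ → ℝ≥0∞))
  refine ⟨(fun t => f ⁻¹' t) '' S, hSc.image _, ?_, ?_⟩
  · rintro _ ⟨t, ht, rfl⟩
    exact hf (hSm t ht)
  · intro μ _ ν _ h
    refine hinj (hS _ (mem_univ _) _ (mem_univ _) fun t ht => ?_)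
    exact h _ (mem_image_of_mem _ ht)

lemma giry_le_borel (Y : Type*) [MeasurableSpace Y] [TopologicalSpace Y] [BorelSpace Y]
    [HasOuterApproxClosed Y] :
    (inferInstance : MeasurableSpace (ProbabilityMeasure Y)) ≤ borel (ProbabilityMeasure Y) := by
  have : @Measurable _ _ (borel (ProbabilityMeasure Y)) _ (id : ProbabilityMeasure Y → _) := by
    let _ : MeasurableSpace (ProbabilityMeasure Y) := borel _
    have : BorelSpace (ProbabilityMeasure Y) := ⟨rfl⟩
    refine Measurable.subtype_mk (f := fun μ : ProbabilityMeasure Y => (μ : Measure Y)) ?_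
    refine Measurable.measure_of_isPiSystem_of_isProbabilityMeasure
      (BorelSpace.measurable_eq (α := Y)) isPiSystem_isOpen ?_
    intro s hs
    refine LowerSemicontinuous.measurable (lowerSemicontinuous_iff_le_liminf.2 fun μ => ?_)
    exact ProbabilityMeasure.le_liminf_measure_open_of_tendsto tendsto_id hs
  exact fun s hs => this hs

lemma giry_eq_borel_unitInterval :
    borel (ProbabilityMeasure unitInterval) =
      (inferInstance : MeasurableSpace (ProbabilityMeasure unitInterval)) := by
  refine le_antisymm ?_ (giry_le_borel _)
  have hP : PolishSpace (ProbabilityMeasure unitInterval) := by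
    let _ := TopologicalSpace.metrizableSpaceMetric (ProbabilityMeasure unitInterval)
    infer_instance
  have hB : @StandardBorelSpace (ProbabilityMeasure unitInterval) (borel _) :=
    @StandardBorelSpace.mk _ (borel _) ⟨inferInstance, @BorelSpace.mk _ _ (borel _) rfl, hP⟩
  have hid : @Measurable _ _ (borel (ProbabilityMeasure unitInterval)) inferInstance
    (id : ProbabilityMeasure unitInterval → _) := fun s hs => giry_le_borel _ s hs
  have hE := @Measurable.measurableEmbedding _ _ _ _ _ (borel _) hB hid Function.injective_id
  intro s hs
  simpa using @MeasurableEmbedding.measurableSet_image' _ _ (borel _) _ _ hE s hs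

lemma standardBorelSpace_of_measurableEmbedding {A B : Type*} [mA : MeasurableSpace A]
    [MeasurableSpace B] [StandardBorelSpace B] {f : A → B} (hf : MeasurableEmbedding f) :
    StandardBorelSpace A := by
  have hr : StandardBorelSpace (range f) := hf.measurableSet_range.standardBorel
  obtain ⟨τ, hb, hp⟩ := hr.polish
  let e := hf.equivRange
  let _ : TopologicalSpace A := TopologicalSpace.induced e inferInstance
  have hind : IsInducing e := ⟨rfl⟩
  have hemb : IsClosedEmbedding e := ⟨⟨hind, e.injective⟩, by
    rw [e.surjective.range_eq]; exact isClosed_univ⟩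
  refine ⟨⟨inferInstance, ⟨?_⟩, hemb.polishSpace⟩⟩
  have h1 := borel_comap (f := fun a => e a) (t := τ)
  rw [← hb.measurable_eq] at h1
  exact e.measurableEmbedding.comap_eq.symm.trans h1.symm

instance {Y : Type*} [MeasurableSpace Y] [StandardBorelSpace Y] :
    StandardBorelSpace (ProbabilityMeasure Y) := by
  have hI : StandardBorelSpace (ProbabilityMeasure unitInterval) := by
    have hP : PolishSpace (ProbabilityMeasure unitInterval) := by
      let _ := TopologicalSpace.metrizableSpaceMetric (ProbabilityMeasure unitInterval)
      infer_instance
    exact ⟨⟨inferInstance, ⟨giry_eq_borel_unitInterval.symm⟩, hP⟩⟩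
  have he := measurableEmbedding_sigmoid_comp_embeddingReal Y
  set e : Y → unitInterval := unitInterval.sigmoid ∘ embeddingReal Y
  let f : ProbabilityMeasure Y → ProbabilityMeasure unitInterval :=
    fun μ => μ.map he.measurable.aemeasurable
  have hfc : ∀ μ, (f μ : Measure unitInterval) = (μ : Measure Y).map e := fun μ => rfl
  have hcomap : ∀ μ : ProbabilityMeasure Y, ((f μ : Measure unitInterval)).comap e = μ := by
    intro μ; rw [hfc, he.comap_map]
  refine standardBorelSpace_of_measurableEmbedding (f := f) ⟨?_, ?_, ?_⟩
  · intro μ ν h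
    apply Subtype.ext
    have := hcomap μ
    rw [h, hcomap ν] at this
    exact this.symm
  · rw [measurable_probabilityMeasure_iff]
    exact (Measure.measurable_map e he.measurable).comp measurable_coe_probabilityMeasure
  · intro A hA
    obtain ⟨A', hA', rfl⟩ := hA
    have : f '' (Subtype.val ⁻¹' A') = {ν : ProbabilityMeasure unitInterval | (ν : Measure unitInterval) (range e) = 1} ∩
        (fun ν : ProbabilityMeasure unitInterval => Measure.comap e (ν : Measure unitInterval)) ⁻¹'
          A' := by
      ext ν
      constructor
      · rintro ⟨μ, hμ, rfl⟩
        refine ⟨?_, ?_⟩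
        · change (μ : Measure Y).map e (range e) = 1
          rw [Measure.map_apply he.measurable he.measurableSet_range]
          simp
        · change Measure.comap e (f μ : Measure unitInterval) ∈ A'
          rw [hcomap]; exact hμ
      · rintro ⟨h1, h2⟩
        have hp : IsProbabilityMeasure ((ν : Measure unitInterval).comap e) := by
          constructor
          rw [he.comap_apply, image_univ]; exact h1
        refine ⟨⟨_, hp⟩, h2, ?_⟩
        apply Subtype.ext
        change ((ν : Measure unitInterval).comap e).map e = ν
        rw [he.map_comap]
        refine Measure.restrict_eq_self_of_ae_mem ?_
        exact (prob_compl_eq_zero_iff he.measurableSet_range).2 h1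
    refine Eq.subst (motive := fun B => MeasurableSet B) this.symm ?_
    refine MeasurableSet.inter (measurable_apply_probabilityMeasure he.measurableSet_range
      (measurableSet_singleton 1)) ?_
    refine Measurable.comp (g := fun ν : Measure unitInterval => ν.comap e) ?_
      measurable_coe_probabilityMeasure hA'
    refine Measure.measurable_of_measurable_coe _ fun s hs => ?_
    simp_rw [he.comap_apply]
    exact Measure.measurable_coe (he.measurableSet_image.2 hs)

/-! ### Universally measurable maps -/

section UnivMeasurable

variable {X Y Z : Type*} [mX : MeasurableSpace X] [MeasurableSpace Y] [MeasurableSpace Z]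

lemma le_univComp : mX ≤ univComp X := fun _ hs _ _ => hs.nullMeasurableSet

lemma _root_.Measurable.univ {f : X → Y} (hf : Measurable f) : Measurable[univComp X] f :=
  hf.mono le_univComp le_rfl

lemma aemeasurable_of_univ [MeasurableSpace.CountablyGenerated Y] {f : X → Y}
    (hf : Measurable[univComp X] f) (μ : Measure X) [IsProbabilityMeasure μ] : AEMeasurable f μ :=
  NullMeasurable.aemeasurable fun _ hs => hf hs μ inferInstance

lemma measurableSet_preimage_univ [MeasurableSpace.CountablyGenerated Y] {f : X → Y}
    (hf : Measurable[univComp X] f) {A : Set Y} (hA : MeasurableSet[univComp Y] A) :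
    MeasurableSet[univComp X] (f ⁻¹' A) := by
  intro μ hμ
  have hae := aemeasurable_of_univ hf μ
  have hp : IsProbabilityMeasure (μ.map f) := Measure.isProbabilityMeasure_map hae
  exact (hA (μ.map f) hp).preimage ⟨hae.measurable_mk, by
    rw [Measure.map_congr hae.ae_eq_mk]⟩ |>.congr
      ((hae.ae_eq_mk.mono fun x hx => by
        change (hae.mk f x ∈ A) = (f x ∈ A); rw [hx]))

lemma measurable_comp_univ [MeasurableSpace.CountablyGenerated Y] {f : X → Y} {g : Y → Z}
    (hg : Measurable[univComp Y] g) (hf : Measurable[univComp X] f) :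
    Measurable[univComp X] fun x => g (f x) :=
  fun _ hs => measurableSet_preimage_univ hf (hg hs)

lemma measurable_prodMk_univ {f : X → Y} {g : X → Z} (hf : Measurable[univComp X] f)
    (hg : Measurable[univComp X] g) : Measurable[univComp X] fun x => (f x, g x) :=
  @Measurable.prodMk X (univComp X) Y Z _ _ f g hf hg

lemma measurable_id_prodMk_univ {f : X → Y} (hf : Measurable[univComp X] f) :
    Measurable[univComp X] fun x => (x, f x) :=
  measurable_prodMk_univ measurable_id.univ hf

lemma ae_map_iff_of_null {μ : Measure X} {f : X → Y} (hf : AEMeasurable f μ) {A : Set Y}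
    (hA : NullMeasurableSet A (μ.map f)) : (∀ᵐ y ∂μ.map f, y ∈ A) ↔ ∀ᵐ x ∂μ, f x ∈ A := by
  rw [ae_iff, ae_iff]
  change μ.map f Aᶜ = 0 ↔ _
  rw [Measure.map_apply₀ hf hA.compl]
  rfl

end UnivMeasurable

/-! ### Projections of Borel sets -/

/-- A set is Suslin if it is the projection of a measurable subset of its product with `ℝ`. -/
def Suslin {Z : Type*} [MeasurableSpace Z] (A : Set Z) : Prop :=
  ∃ B : Set (Z × ℝ), MeasurableSet B ∧ A = {z | ∃ r, (z, r) ∈ B}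

namespace Suslin

variable {Z V : Type*} [MeasurableSpace Z] [MeasurableSpace V]

lemma of_proj [StandardBorelSpace V] {B : Set (Z × V)} (hB : MeasurableSet B) :
    Suslin {z | ∃ v, (z, v) ∈ B} := by
  have he := measurableEmbedding_embeddingReal V
  have hem : MeasurableEmbedding (Prod.map (id : Z → Z) (embeddingReal V)) :=
    MeasurableEmbedding.id.prodMap he
  refine ⟨Prod.map id (embeddingReal V) '' B, hem.measurableSet_image.2 hB, ?_⟩
  ext z
  constructor
  · rintro ⟨v, hv⟩
    exact ⟨embeddingReal V v, (z, v), hv, rfl⟩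
  · rintro ⟨r, ⟨z', v⟩, hv, h⟩
    obtain ⟨rfl, -⟩ := Prod.mk.inj h
    exact ⟨v, hv⟩

lemma _root_.MeasurableSet.suslin {A : Set Z} (hA : MeasurableSet A) : Suslin A :=
  ⟨Prod.fst ⁻¹' A, measurable_fst hA, by ext; simp⟩

lemma preimage {A : Set V} (hA : Suslin A) {f : Z → V} (hf : Measurable f) : Suslin (f ⁻¹' A) := by
  obtain ⟨B, hB, rfl⟩ := hA
  exact ⟨Prod.map f id ⁻¹' B, (hf.prodMap measurable_id) hB, by ext; simp⟩

lemma exists_mem [StandardBorelSpace V] {A : Set (Z × V)} (hA : Suslin A) :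
    Suslin {z | ∃ v, (z, v) ∈ A} := by
  obtain ⟨B, hB, rfl⟩ := hA
  have : MeasurableSet {p : Z × (V × ℝ) | ((p.1, p.2.1), p.2.2) ∈ B} :=
    (by fun_prop : Measurable fun p : Z × (V × ℝ) => ((p.1, p.2.1), p.2.2)) hB
  convert of_proj this using 1
  ext z; simp

lemma inter {A A' : Set Z} (hA : Suslin A) (hA' : Suslin A') : Suslin (A ∩ A') := by
  obtain ⟨B, hB, rfl⟩ := hA
  obtain ⟨B', hB', rfl⟩ := hA'
  have : MeasurableSet {p : Z × (ℝ × ℝ) | (p.1, p.2.1) ∈ B ∧ (p.1, p.2.2) ∈ B'} :=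
    ((by fun_prop : Measurable fun p : Z × (ℝ × ℝ) => (p.1, p.2.1)) hB).inter
      ((by fun_prop : Measurable fun p : Z × (ℝ × ℝ) => (p.1, p.2.2)) hB')
  convert of_proj this using 1
  ext z; simp

variable [StandardBorelSpace Z]

lemma univ {A : Set Z} (hA : Suslin A) : MeasurableSet[univComp Z] A := by
  obtain ⟨B, hB, rfl⟩ := hA
  obtain ⟨τ, hb, hp⟩ := (inferInstance : StandardBorelSpace Z).polish
  have h := (hB.analyticSet).image_of_continuous continuous_fst
  convert h.univComp using 1
  ext z; simp

lemma nullMeasurableSet {A : Set Z} (hA : Suslin A) (μ : Measure Z) [IsProbabilityMeasure μ] :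
    NullMeasurableSet A μ := hA.univ μ inferInstance

lemma exists_selector [StandardBorelSpace V] [Nonempty V] {A : Set (Z × V)} (hA : Suslin A) :
    ∃ s : Z → V, Measurable[univComp Z] s ∧ ∀ z v, (z, v) ∈ A → (z, s z) ∈ A := by
  obtain ⟨B, hB, rfl⟩ := hA
  obtain ⟨τ, hb, hp⟩ := (inferInstance : StandardBorelSpace Z).polish
  obtain ⟨τ', hb', hp'⟩ := (inferInstance : StandardBorelSpace V).polish
  have hBa := hB.analyticSet
  rw [AnalyticSet] at hBa
  rcases hBa with rfl | ⟨p, hp, rfl⟩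
  · exact ⟨fun _ => Classical.arbitrary V, measurable_const.univ, by simp⟩
  · obtain ⟨s, hs, hs'⟩ := exists_measurable_section (q := fun τ => (p τ).1.1) (by fun_prop)
    have hpm : Measurable fun τ => (p τ).1.2 := by
      have : Continuous fun τ => (p τ).1.2 := by fun_prop
      exact this.measurable
    refine ⟨fun z => (p (s z)).1.2, hpm.comp hs, ?_⟩
    rintro z v ⟨r, τ, hτ⟩
    have hz := hs' z ⟨τ, by simp [hτ]⟩
    refine ⟨(p (s z)).2, s z, ?_⟩
    refine Prod.ext (Prod.ext hz rfl) rfl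

lemma exists_selector_comp {X E : Type*} [MeasurableSpace X] [MeasurableSpace E]
    [StandardBorelSpace X] [StandardBorelSpace E] [StandardBorelSpace V] [Nonempty V]
    {A : Set ((X × E) × V)} (hA : Suslin A) {a : X → E} (ha : Measurable[univComp X] a) :
    ∃ s : X → V, Measurable[univComp X] s ∧ ∀ x v, ((x, a x), v) ∈ A → ((x, a x), s x) ∈ A := by
  obtain ⟨s, hs, hsA⟩ := hA.exists_selector
  exact ⟨fun x => s (x, a x), measurable_comp_univ hs (measurable_id_prodMk_univ ha),
    fun x v => hsA _ v⟩

lemma setOf_ae {A : Set Z} (hA : Suslin A) :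
    Suslin {μ : ProbabilityMeasure Z | ∀ᵐ z ∂(μ : Measure Z), z ∈ A} := by
  have hA' := hA
  obtain ⟨B, hB, rfl⟩ := hA
  have hm : MeasurableSet {p : ProbabilityMeasure Z × ProbabilityMeasure (Z × ℝ) |
      (p.2.map measurable_fst.aemeasurable : ProbabilityMeasure Z) = p.1 ∧
        (p.2 : Measure (Z × ℝ)) Bᶜ = 0} := by
    have hmap : Measurable fun ν : ProbabilityMeasure (Z × ℝ) =>
        (ν.map measurable_fst.aemeasurable : ProbabilityMeasure Z) :=
      measurable_probabilityMeasure_iff.2 ((Measure.measurable_map _ measurable_fst).comp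
        measurable_coe_probabilityMeasure)
    exact (measurableSet_eq_fun (hmap.comp measurable_snd) measurable_fst).inter
      (((measurable_apply_probabilityMeasure hB.compl).comp measurable_snd)
        (measurableSet_singleton 0))
  convert of_proj hm using 1
  ext μ
  simp only [mem_ofPred_eq]
  constructor
  · intro h
    have hB' : Suslin B := hB.suslin
    obtain ⟨s, hs, hsB⟩ := hB'.exists_selector
    have hae := aemeasurable_of_univ hs (μ : Measure Z)
    have hf : Measurable fun z => (z, hae.mk s z) := measurable_id.prodMk hae.measurable_mk
    refine ⟨μ.map hf.aemeasurable, ?_, ?_⟩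
    · apply Subtype.ext
      change Measure.map _ (Measure.map _ (μ : Measure Z)) = (μ : Measure Z)
      rw [Measure.map_map measurable_fst hf]
      exact Measure.map_id
    · change Measure.map _ (μ : Measure Z) _ = 0
      rw [Measure.map_apply hf hB.compl]
      change ∀ᵐ z ∂(μ : Measure Z), (z, hae.mk s z) ∈ B
      filter_upwards [h, hae.ae_eq_mk] with z ⟨r, hr⟩ hz
      rw [← hz]
      exact hsB z r hr
  · rintro ⟨ν, hνμ, hν⟩
    rw [← hνμ]
    have hn := hA'.nullMeasurableSet
      ((ν.map measurable_fst.aemeasurable : ProbabilityMeasure Z) : Measure Z)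
    change ∀ᵐ z ∂(Measure.map Prod.fst (ν : Measure (Z × ℝ))), _
    refine (ae_map_iff_of_null measurable_fst.aemeasurable hn).2 ?_
    have : ∀ᵐ p ∂(ν : Measure (Z × ℝ)), p ∈ B := hν
    filter_upwards [this] with p hp
    exact ⟨p.2, hp⟩

lemma setOf_ae_section {X : Type*} [MeasurableSpace X] [StandardBorelSpace X] {A : Set (X × Z)}
    (hA : Suslin A) :
    Suslin {p : X × ProbabilityMeasure Z | ∀ᵐ z ∂(p.2 : Measure Z), (p.1, z) ∈ A} := by
  let f : X × ProbabilityMeasure Z → ProbabilityMeasure (X × Z) := fun p =>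
    p.2.map (f := fun z => (p.1, z)) measurable_prodMk_left.aemeasurable
  have hf : Measurable f := by
    rw [measurable_probabilityMeasure_iff]
    have h1 := ProbabilityMeasure.measurable_fun_prod (α := X) (β := Z)
    have h2 : Measurable fun p : X × ProbabilityMeasure Z =>
        ((⟨Measure.dirac p.1, inferInstance⟩ : ProbabilityMeasure X), p.2) :=
      (measurable_probabilityMeasure_iff.2 (Measure.measurable_dirac.comp measurable_fst)).prodMk
        measurable_snd
    convert h1.comp h2 using 1
    ext1 p
    exact (Measure.dirac_prod p.1).symm
  convert hA.setOf_ae.preimage hf using 1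
  ext p
  have hn := hA.nullMeasurableSet (f p : Measure (X × Z))
  exact (ae_map_iff_of_null measurable_prodMk_left.aemeasurable hn).symm

end Suslin

/-! ### Analytic graphs of measure-valued correspondences -/

section Graph

variable {X Y : Type*} [MeasurableSpace X] [TopologicalSpace X] [BorelSpace X]
  [MeasurableSpace Y] [TopologicalSpace Y] [PolishSpace Y] [BorelSpace Y]

lemma measurable_of_continuous_prod {p : (ℕ → ℕ) → X × ProbabilityMeasure Y} (hp : Continuous p) :
    Measurable p := by
  refine (by fun_prop : Continuous fun τ => (p τ).1).measurable.prodMk ?_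
  have h : @Measurable _ _ _ (borel (ProbabilityMeasure Y)) fun τ => (p τ).2 :=
    (by fun_prop : Continuous fun τ => (p τ).2).borel_measurable.mono
      (BorelSpace.measurable_eq (α := ℕ → ℕ)).ge le_rfl
  exact h.mono le_rfl (giry_le_borel Y)

variable [PolishSpace X]

lemma suslin_of_analyticSet {G : Set (X × ProbabilityMeasure Y)} (hG : AnalyticSet G) :
    Suslin G := by
  rw [AnalyticSet] at hG
  rcases hG with rfl | ⟨p, hp, rfl⟩
  · exact MeasurableSet.empty.suslin
  · have hm : MeasurableSet {q : (X × ProbabilityMeasure Y) × (ℕ → ℕ) | p q.2 = q.1} :=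
      measurableSet_eq_fun ((measurable_of_continuous_prod hp).comp measurable_snd) measurable_fst
    exact Suslin.of_proj hm

lemma measurable_borel_of_mem_analyticSet {G : Set (X × ProbabilityMeasure Y)}
    (hG : AnalyticSet G) {κ : X → ProbabilityMeasure Y} (hκ : Measurable[univComp X] κ)
    (h : ∀ x, (x, κ x) ∈ G) :
    @Measurable _ _ (univComp X) (borel (ProbabilityMeasure Y)) κ := by
  rw [AnalyticSet] at hG
  rcases hG with rfl | ⟨p, hp, rfl⟩
  · have : IsEmpty X := ⟨fun x => h x⟩
    exact fun s _ => by convert MeasurableSet.empty; exact Subsingleton.elim _ _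
  · have hm : MeasurableSet {q : (X × ProbabilityMeasure Y) × (ℕ → ℕ) | p q.2 = q.1} :=
      measurableSet_eq_fun ((measurable_of_continuous_prod hp).comp measurable_snd) measurable_fst
    obtain ⟨s, hs, hsA⟩ := hm.suslin.exists_selector_comp hκ
    have hκs : κ = fun x => (p (s x)).2 := by
      ext1 x
      obtain ⟨τ, hτ⟩ := h x
      have : p (s x) = (x, κ x) := hsA x τ hτ
      rw [this]
    rw [hκs]
    have h : @Measurable _ _ _ (borel (ProbabilityMeasure Y)) fun τ => (p τ).2 :=
      (by fun_prop : Continuous fun τ => (p τ).2).borel_measurable.mono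
        (BorelSpace.measurable_eq (α := ℕ → ℕ)).ge le_rfl
    exact fun u hu => hs (h hu)

end Graph

section KernelVersion

variable {X Y : Type*} [MeasurableSpace X] [MeasurableSpace Y]

lemma exists_kernel_ae_eq [StandardBorelSpace Y] {κ : X → ProbabilityMeasure Y}
    (hκ : Measurable[univComp X] κ) (ν : Measure X) [IsProbabilityMeasure ν] :
    ∃ κ' : Kernel X Y, IsMarkovKernel κ' ∧ ∀ᵐ x ∂ν, κ' x = (κ x : Measure Y) := by
  have hae := aemeasurable_of_univ hκ ν
  refine ⟨⟨fun x => ((hae.mk κ x : ProbabilityMeasure Y) : Measure Y),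
    measurable_probabilityMeasure_iff.1 hae.measurable_mk⟩, ⟨fun x => ?_⟩, ?_⟩
  · change IsProbabilityMeasure ((hae.mk κ x : ProbabilityMeasure Y) : Measure Y)
    infer_instance
  · filter_upwards [hae.ae_eq_mk] with x hx
    rw [hx]; rfl

/-- A Markov kernel as a measurable map to the space of probability measures. -/
def kernelPM (κ : Kernel X Y) [IsMarkovKernel κ] (x : X) : ProbabilityMeasure Y :=
  ⟨κ x, inferInstance⟩

lemma measurable_kernelPM (κ : Kernel X Y) [IsMarkovKernel κ] : Measurable (kernelPM κ) :=
  measurable_probabilityMeasure_iff.2 κ.measurable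

lemma ae_ae_of_ae_compProd_null {μ : Measure X} [IsProbabilityMeasure μ] {κ : Kernel X Y}
    [IsMarkovKernel κ] {A : Set (X × Y)} (hA : NullMeasurableSet A (μ ⊗ₘ κ)) :
    (∀ᵐ p ∂(μ ⊗ₘ κ), p ∈ A) ↔ ∀ᵐ x ∂μ, ∀ᵐ y ∂κ x, (x, y) ∈ A := by
  refine ⟨fun h => Measure.ae_ae_of_ae_compProd h, fun h => ?_⟩
  obtain ⟨t, ht, htm, hta⟩ := hA.exists_measurable_superset_ae_eq
  have h2 : ∀ᵐ p ∂(μ ⊗ₘ κ), p ∈ t :=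
    Measure.ae_compProd_of_ae_ae htm (h.mono fun x hx => hx.mono fun y hy => ht hy)
  filter_upwards [h2, hta] with p hp hpt
  exact hpt.mp hp

end KernelVersion

/-! ### Appending a coordinate -/

section Snoc

variable {Ω₁ : Type} [MeasurableSpace Ω₁]

/-- Appending a last coordinate to a path. -/
def snocE (Ω₁ : Type) [MeasurableSpace Ω₁] (t : ℕ) :
    (Fin t → Ω₁) × Ω₁ ≃ᵐ (Fin (t + 1) → Ω₁) where
  toFun p := Fin.snoc (α := fun _ => Ω₁) p.1 p.2
  invFun ω := (fun i => ω i.castSucc, ω (Fin.last t))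
  left_inv p := by ext <;> simp
  right_inv ω := by
    ext i
    refine Fin.lastCases ?_ (fun j => ?_) i <;> simp
  measurable_toFun := by
    refine measurable_pi_lambda _ fun i => ?_
    refine Fin.lastCases ?_ (fun j => ?_) i
    · simpa using measurable_snd
    · simpa using! (measurable_pi_apply j).comp measurable_fst
  measurable_invFun :=
    (measurable_pi_lambda _ fun i => measurable_pi_apply _).prodMk (measurable_pi_apply _)

lemma snocE_apply {t : ℕ} (p : (Fin t → Ω₁) × Ω₁) :
    snocE Ω₁ t p = Fin.snoc (α := fun _ => Ω₁) p.1 p.2 := rfl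

/-- The product `ν ⊗ κ` on paths of length `t + 1`. -/
def ext {t : ℕ} (ν : Measure (Fin t → Ω₁)) (κ : Kernel (Fin t → Ω₁) Ω₁) :
    Measure (Fin (t + 1) → Ω₁) := (ν ⊗ₘ κ).map (snocE Ω₁ t)

variable {t : ℕ} {ν ν' : Measure (Fin t → Ω₁)} {κ κ' : Kernel (Fin t → Ω₁) Ω₁}

instance [IsProbabilityMeasure ν] [IsMarkovKernel κ] : IsProbabilityMeasure (ext ν κ) :=
  Measure.isProbabilityMeasure_map (snocE Ω₁ t).measurable.aemeasurable

lemma ae_ext_iff {p : (Fin (t + 1) → Ω₁) → Prop} :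
    (∀ᵐ ω ∂ext ν κ, p ω) ↔ ∀ᵐ z ∂(ν ⊗ₘ κ), p (snocE Ω₁ t z) :=
  (snocE Ω₁ t).measurableEmbedding.ae_map_iff

lemma ae_ext_iff_of_null [IsProbabilityMeasure ν] [IsMarkovKernel κ]
    {A : Set (Fin (t + 1) → Ω₁)} (hA : NullMeasurableSet A (ext ν κ)) :
    (∀ᵐ ω ∂ext ν κ, ω ∈ A) ↔ ∀ᵐ x ∂ν, ∀ᵐ y ∂κ x, snocE Ω₁ t (x, y) ∈ A := by
  rw [ae_ext_iff]
  exact ae_ae_of_ae_compProd_null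
    (hA.preimage ((snocE Ω₁ t).measurable.quasiMeasurePreserving _))

lemma ae_ae_of_ae_ext [IsProbabilityMeasure ν] [IsMarkovKernel κ]
    {p : (Fin (t + 1) → Ω₁) → Prop} (h : ∀ᵐ ω ∂ext ν κ, p ω) :
    ∀ᵐ x ∂ν, ∀ᵐ y ∂κ x, p (snocE Ω₁ t (x, y)) :=
  Measure.ae_ae_of_ae_compProd (ae_ext_iff.1 h)

lemma ext_absolutelyContinuous [IsProbabilityMeasure ν] [IsProbabilityMeasure ν']
    [IsMarkovKernel κ] [IsMarkovKernel κ'] (hν : ν ≪ ν') (hκ : ∀ᵐ x ∂ν, κ x ≪ κ' x) :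
    ext ν κ ≪ ext ν' κ' :=
  (Measure.AbsolutelyContinuous.compProd hν hκ).map (snocE Ω₁ t).measurable

lemma map_restr_ext [IsProbabilityMeasure ν] [IsMarkovKernel κ] :
    (ext ν κ).map (restr Ω₁ t t.le_succ) = ν := by
  have hr : Measurable (restr Ω₁ t t.le_succ) :=
    measurable_pi_lambda _ fun i => measurable_pi_apply _
  rw [ext, Measure.map_map hr (snocE Ω₁ t).measurable]
  have : (restr Ω₁ t t.le_succ) ∘ (snocE Ω₁ t) = Prod.fst := by
    ext p i
    simp only [Function.comp, snocE_apply, restr]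
    exact Fin.snoc_castSucc (α := fun _ => Ω₁) p.2 p.1 i
  rw [this]
  exact Measure.fst_compProd ν κ

lemma bind_snoc_eq_ext [IsProbabilityMeasure ν] [IsMarkovKernel κ] {η : (Fin t → Ω₁) → Measure Ω₁}
    (h : ∀ᵐ x ∂ν, κ x = η x) :
    ν.bind (fun ω => Measure.map (Fin.snoc (α := fun _ => Ω₁) ω) (η ω)) = ext ν κ := by
  have hm : ∀ x, Measurable fun y => snocE Ω₁ t (x, y) := fun x =>
    (snocE Ω₁ t).measurable.comp measurable_prodMk_left
  have h1 : ν.bind (fun ω => Measure.map (Fin.snoc (α := fun _ => Ω₁) ω) (η ω)) =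
      ν.bind (fun ω => Measure.map (fun y => snocE Ω₁ t (ω, y)) (κ ω)) := by
    refine Measure.bind_congr_right ?_
    filter_upwards [h] with x hx
    rw [hx]; rfl
  have hmk : Measurable fun ω => Measure.map (fun y => snocE Ω₁ t (ω, y)) (κ ω) := by
    refine Measure.measurable_of_measurable_coe _ fun s hs => ?_
    simp_rw [Measure.map_apply (hm _) hs]
    exact Kernel.measurable_kernel_prodMk_left ((snocE Ω₁ t).measurable hs)
  rw [h1]
  ext s hs
  rw [Measure.bind_apply hs hmk.aemeasurable, ext, Measure.map_apply (snocE Ω₁ t).measurable hs,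
    Measure.compProd_apply ((snocE Ω₁ t).measurable hs)]
  refine lintegral_congr fun x => ?_
  rw [Measure.map_apply (hm _) hs]
  rfl

end Snoc

/-! ### The family of product measures -/

lemma Suslin.exists_selector_extending {X V : Type*} [MeasurableSpace X] [MeasurableSpace V]
    [StandardBorelSpace X] [StandardBorelSpace V] {G : Set (X × V)} (hG : Suslin G)
    (hne : ∀ x, ∃ v, (x, v) ∈ G) {κ : X → V} (hκ : Measurable[univComp X] κ) :
    ∃ κ' : X → V, Measurable[univComp X] κ' ∧ (∀ x, (x, κ' x) ∈ G) ∧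
      ∀ x, (x, κ x) ∈ G → κ' x = κ x := by
  classical
  rcases isEmpty_or_nonempty X with hX | ⟨⟨x₀⟩⟩
  · exact ⟨κ, hκ, fun x => isEmptyElim x, fun x => isEmptyElim x⟩
  have : Nonempty V := ⟨κ x₀⟩
  obtain ⟨s, hs, hsG⟩ := hG.exists_selector
  have hA : MeasurableSet[univComp X] {x | (x, κ x) ∈ G} :=
    measurableSet_preimage_univ (measurable_id_prodMk_univ hκ) hG.univ
  refine ⟨fun x => if (x, κ x) ∈ G then κ x else s x,
    Measurable.ite hA hκ hs, fun x => ?_,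
    fun x hx => if_pos hx⟩
  dsimp only
  split_ifs with h
  · exact h
  · obtain ⟨v, hv⟩ := hne x
    exact hsG x v hv

section MeasFam

variable {Ω₁ : Type} [MeasurableSpace Ω₁] [TopologicalSpace Ω₁] [PolishSpace Ω₁] [BorelSpace Ω₁]
  {Pt : (t : ℕ) → (Fin t → Ω₁) → Set (ProbabilityMeasure Ω₁)}

lemma exists_ext_of_mem_measFam_aux {t : ℕ} {μ : Measure (Fin (t + 1) → Ω₁)}
    (hpr : ∀ ν ∈ MeasFam Ω₁ Pt t, IsProbabilityMeasure ν)
    (hμ : μ ∈ MeasFam Ω₁ Pt (t + 1)) :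
    ∃ ν ∈ MeasFam Ω₁ Pt t, ∃ κ : (Fin t → Ω₁) → ProbabilityMeasure Ω₁,
      Measurable[univComp _] κ ∧ (∀ ω, κ ω ∈ Pt t ω) ∧
      ∃ κ' : Kernel (Fin t → Ω₁) Ω₁, IsMarkovKernel κ' ∧
        (∀ᵐ x ∂ν, κ' x = (κ x : Measure Ω₁)) ∧ μ = ext ν κ' := by
  obtain ⟨ν, hν, κ, hκ, hκP, rfl⟩ := hμ
  have := hpr ν hν
  have hκ' := hκ.mono le_rfl (giry_le_borel Ω₁)
  obtain ⟨κ', hm, hae⟩ := exists_kernel_ae_eq hκ' ν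
  exact ⟨ν, hν, κ, hκ', hκP, κ', hm, hae, bind_snoc_eq_ext hae⟩

lemma isProbabilityMeasure_of_mem_measFam {t : ℕ} :
    ∀ μ ∈ MeasFam Ω₁ Pt t, IsProbabilityMeasure μ := by
  induction t with
  | zero =>
    intro μ hμ
    have : μ = Measure.dirac Fin.elim0 := hμ
    rw [this]; infer_instance
  | succ t ih =>
    intro μ hμ
    obtain ⟨ν, hν, κ, -, -, κ', hm, -, rfl⟩ := exists_ext_of_mem_measFam_aux ih hμ
    have := ih ν hν
    infer_instance

lemma exists_ext_of_mem_measFam {t : ℕ} {μ : Measure (Fin (t + 1) → Ω₁)}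
    (hμ : μ ∈ MeasFam Ω₁ Pt (t + 1)) :
    ∃ ν ∈ MeasFam Ω₁ Pt t, ∃ κ : (Fin t → Ω₁) → ProbabilityMeasure Ω₁,
      Measurable[univComp _] κ ∧ (∀ ω, κ ω ∈ Pt t ω) ∧
      ∃ κ' : Kernel (Fin t → Ω₁) Ω₁, IsMarkovKernel κ' ∧
        (∀ᵐ x ∂ν, κ' x = (κ x : Measure Ω₁)) ∧ μ = ext ν κ' :=
  exists_ext_of_mem_measFam_aux isProbabilityMeasure_of_mem_measFam hμ

lemma ext_mem_measFam {t : ℕ} {ν : Measure (Fin t → Ω₁)} (hν : ν ∈ MeasFam Ω₁ Pt t)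
    (hG : AnalyticSet {p : (Fin t → Ω₁) × ProbabilityMeasure Ω₁ | p.2 ∈ Pt t p.1})
    {κ : (Fin t → Ω₁) → ProbabilityMeasure Ω₁} (hκ : Measurable[univComp _] κ)
    (hκP : ∀ ω, κ ω ∈ Pt t ω) {κ' : Kernel (Fin t → Ω₁) Ω₁} [IsMarkovKernel κ']
    (hae : ∀ᵐ x ∂ν, κ' x = (κ x : Measure Ω₁)) : ext ν κ' ∈ MeasFam Ω₁ Pt (t + 1) := by
  have := isProbabilityMeasure_of_mem_measFam ν hν
  exact ⟨ν, hν, κ, measurable_borel_of_mem_analyticSet hG hκ hκP, hκP, (bind_snoc_eq_ext hae).symm⟩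

end MeasFam

/-! ### Separation in finite dimension -/

lemma convex_cone_of_convex {V : Type*} [AddCommGroup V] [Module ℝ V] {C : Set V}
    (hC : Convex ℝ C) : Convex ℝ {v | ∃ t : ℝ, 0 ≤ t ∧ ∃ c ∈ C, v = t • c} := by
  rintro _ ⟨t, ht, c, hc, rfl⟩ _ ⟨s, hs, c', hc', rfl⟩ a b ha hb -
  rcases (add_nonneg (mul_nonneg ha ht) (mul_nonneg hb hs)).eq_or_lt with h | h
  · refine ⟨0, le_rfl, c, hc, ?_⟩
    have h1 : a * t = 0 := by nlinarith [mul_nonneg ha ht, mul_nonneg hb hs]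
    have h2 : b * s = 0 := by nlinarith [mul_nonneg ha ht, mul_nonneg hb hs]
    simp [smul_smul, h1, h2]
  · refine ⟨a * t + b * s, h.le, (a * t / (a * t + b * s)) • c + (b * s / (a * t + b * s)) • c',
      hC hc hc' (by positivity) (by positivity) (by field_simp), ?_⟩
    rw [smul_add, smul_smul, smul_smul, smul_smul, smul_smul]
    congr 2 <;> field_simp

lemma exists_separating_of_zero_notMem {E : Type*} [NormedAddCommGroup E] [NormedSpace ℝ E]
    [FiniteDimensional ℝ E] {C : Set E} (hC : Convex ℝ C) (hne : C.Nonempty) (h0 : (0 : E) ∉ C) :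
    ∃ f : E →ₗ[ℝ] ℝ, (∀ c ∈ C, 0 ≤ f c) ∧ ∃ c ∈ C, 0 < f c := by
  let V := Submodule.span ℝ C
  let C' : Set V := (↑) ⁻¹' C
  have hC' : Convex ℝ C' := hC.linear_preimage V.subtype
  have hspan : Submodule.span ℝ C' = ⊤ := Submodule.span_span_coe_preimage
  obtain ⟨c₀, hc₀⟩ := hne
  let c₁ : V := ⟨c₀, Submodule.subset_span hc₀⟩
  have hc₁ : c₁ ∈ C' := hc₀
  have h0' : (0 : V) ∉ C' := h0
  let K : Set V := {v | ∃ t : ℝ, 0 ≤ t ∧ ∃ c ∈ C', v = t • c}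
  have hK : Convex ℝ K := convex_cone_of_convex hC'
  have hCK : C' ⊆ K := fun c hc => ⟨1, zero_le_one, c, hc, (one_smul _ _).symm⟩
  have h0K : (0 : V) ∈ K := ⟨0, le_rfl, c₁, hc₁, (zero_smul _ _).symm⟩
  have hinteg : (interior K).Nonempty := by
    rw [hK.interior_nonempty_iff_affineSpan_eq_top]
    have h1 : affineSpan ℝ (insert 0 C') = ⊤ := by
      apply SetLike.coe_injective
      rw [affineSpan_insert_zero, hspan]; rfl
    exact top_le_iff.1 (h1 ▸ affineSpan_mono ℝ (insert_subset h0K hCK))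
  have h0int : (0 : V) ∉ interior K := by
    intro h
    have hcont : Tendsto (fun ε : ℝ => -(ε • c₁)) (𝓝[>] 0) (𝓝 0) := by
      have : Continuous fun ε : ℝ => -(ε • c₁) := by fun_prop
      simpa using (this.tendsto 0).mono_left nhdsWithin_le_nhds
    obtain ⟨ε, hεK, hε⟩ := ((hcont.eventually (mem_interior_iff_mem_nhds.1 h)).and
      self_mem_nhdsWithin).exists
    have hε : 0 < ε := hε
    obtain ⟨t, ht, c, hc, htc⟩ := hεK
    apply h0'
    have := hC' hc₁ hc (a := ε / (ε + t)) (b := t / (ε + t)) (by positivity) (by positivity)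
      (by field_simp)
    convert this using 1
    have h2 : t • c = -(ε • c₁) := htc.symm
    rw [div_eq_inv_mul, div_eq_inv_mul, mul_smul, mul_smul, h2]
    simp
  obtain ⟨f, hf⟩ := geometric_hahn_banach_open_point hK.interior isOpen_interior h0int
  simp only [map_zero] at hf
  have hle : ∀ v ∈ K, f v ≤ 0 := by
    intro v hv
    have hv' : v ∈ closure (interior K) := by
      rw [hK.closure_interior_eq_closure_of_nonempty_interior hinteg]
      exact subset_closure hv
    exact closure_minimal (fun x hx => (hf x hx).le)
      (isClosed_le f.continuous continuous_const) hv'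
  obtain ⟨g, hg⟩ := LinearMap.exists_extend (-(f : V →ₗ[ℝ] ℝ))
  have hgf : ∀ v : V, g v = -f v := fun v => congrArg (fun l : V →ₗ[ℝ] ℝ => l v) hg
  refine ⟨g, fun c hc => ?_, ?_⟩
  · have := hgf ⟨c, Submodule.subset_span hc⟩
    rw [this]
    exact neg_nonneg.2 (hle _ (hCK hc))
  · obtain ⟨v, hv⟩ := hinteg
    obtain ⟨t, ht, c, hc, rfl⟩ := interior_subset hv
    refine ⟨c, hc, ?_⟩
    have h1 := hf _ hv
    rw [map_smul, smul_eq_mul] at h1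
    rw [hgf]
    by_contra hcon
    nlinarith [hle c (hCK hc)]

lemma linearMap_eq_dotProduct {d : ℕ} (f : (Fin d → ℝ) →ₗ[ℝ] ℝ) :
    ∃ h : Fin d → ℝ, ∀ m, f m = h ⬝ᵥ m := by
  refine ⟨fun i => f fun j => if i = j then 1 else 0, fun m => ?_⟩
  rw [LinearMap.pi_apply_eq_sum_univ, dotProduct]
  exact Finset.sum_congr rfl fun i _ => by rw [smul_eq_mul, mul_comm]

lemma abs_dotProduct_le_mul_sum {d : ℕ} {y : Fin d → ℝ} {r : ℝ} (hy : ‖y‖ ≤ r) (m : Fin d → ℝ) :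
    |y ⬝ᵥ m| ≤ r * ∑ i, |m i| := by
  rw [dotProduct, Finset.mul_sum]
  refine (Finset.abs_sum_le_sum_abs _ _).trans (Finset.sum_le_sum fun i _ => ?_)
  rw [abs_mul]
  exact mul_le_mul_of_nonneg_right ((norm_le_pi_norm y i).trans hy) (abs_nonneg _)

/-- The family of affine inequalities `f ≤ y ⬝ᵥ m` indexed by a convex set has a solution in a
given ball iff the pointwise maximum of the right-hand side over the ball satisfies them. -/
lemma exists_mem_closedBall_iff {d : ℕ} {M : Set ((Fin d → ℝ) × ℝ)} (hM : Convex ℝ M)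
    (q : Fin d → ℝ) {r : ℝ} (hr : 0 < r) :
    (∃ y ∈ Metric.closedBall q r, ∀ p ∈ M, p.2 ≤ y ⬝ᵥ p.1) ↔
      ∀ p ∈ M, p.2 ≤ q ⬝ᵥ p.1 + r * ∑ i, |p.1 i| := by
  constructor
  · rintro ⟨y, hy, h⟩ p hp
    have h1 := abs_dotProduct_le_mul_sum (by simpa [dist_eq_norm] using hy : ‖y - q‖ ≤ r) p.1
    have h2 := (le_abs_self _).trans h1
    rw [sub_dotProduct] at h2
    linarith [h p hp]
  · intro h
    rcases M.eq_empty_or_nonempty with rfl | ⟨p₀, hp₀⟩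
    · exact ⟨q, Metric.mem_closedBall_self hr.le, by simp⟩
    let U : Set ((Fin d → ℝ) × ℝ) := {p | q ⬝ᵥ p.1 + r * ∑ i, |p.1 i| < p.2}
    have hUo : IsOpen U := isOpen_lt (by unfold dotProduct; fun_prop) (by fun_prop)
    have hUc : Convex ℝ U := by
      rintro ⟨m, z⟩ h1 ⟨m', z'⟩ h2 a b ha hb hab
      have h1 : q ⬝ᵥ m + r * ∑ i, |m i| < z := h1
      have h2 : q ⬝ᵥ m' + r * ∑ i, |m' i| < z' := h2
      change q ⬝ᵥ (a • m + b • m') + r * ∑ i, |(a • m + b • m') i| < a * z + b * z'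
      have h3 : ∑ i, |(a • m + b • m') i| ≤ a * ∑ i, |m i| + b * ∑ i, |m' i| := by
        rw [Finset.mul_sum, Finset.mul_sum, ← Finset.sum_add_distrib]
        refine Finset.sum_le_sum fun i _ => ?_
        have := abs_add_le (a * m i) (b * m' i)
        rw [abs_mul, abs_mul, abs_of_nonneg ha, abs_of_nonneg hb] at this
        simpa using this
      have h4 := mul_le_mul_of_nonneg_left h3 hr.le
      rw [dotProduct_add, dotProduct_smul, dotProduct_smul, smul_eq_mul, smul_eq_mul]
      rcases ha.eq_or_lt with rfl | ha
      · obtain rfl : b = 1 := by linarith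
        linarith
      · nlinarith [mul_lt_mul_of_pos_left h1 ha, mul_le_mul_of_nonneg_left h2.le hb]
    have hdisj : Disjoint U M := Set.disjoint_left.2 fun p hpU hpM =>
      absurd (h p hpM) (not_le.2 hpU)
    obtain ⟨f, u, hfU, hfM⟩ := geometric_hahn_banach_open hUc hUo hM hdisj
    obtain ⟨w, hw⟩ := linearMap_eq_dotProduct
      ((f : ((Fin d → ℝ) × ℝ) →ₗ[ℝ] ℝ) ∘ₗ LinearMap.inl ℝ (Fin d → ℝ) ℝ)
    let b := f (0, 1)
    have hf : ∀ m z, f (m, z) = w ⬝ᵥ m + z * b := by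
      intro m z
      have h1 : ((m, z) : (Fin d → ℝ) × ℝ) = (m, 0) + z • ((0 : Fin d → ℝ), (1 : ℝ)) := by simp
      rw [h1, map_add, map_smul, smul_eq_mul, ← hw m]; rfl
    have hs0 : ∀ m : Fin d → ℝ, ∀ s : ℝ, 0 < s → ((m, q ⬝ᵥ m + r * ∑ i, |m i| + s) ∈ U) :=
      fun m s hs => by
        change q ⬝ᵥ m + r * ∑ i, |m i| < q ⬝ᵥ m + r * ∑ i, |m i| + s
        linarith
    have hu0 : 0 ≤ u := by
      by_contra hu
      have hlim : Tendsto (fun s : ℝ => s * b) (𝓝[>] 0) (𝓝 0) := by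
        have : Continuous fun s : ℝ => s * b := by fun_prop
        simpa using (this.tendsto 0).mono_left nhdsWithin_le_nhds
      obtain ⟨s, hsu, hs⟩ := ((hlim.eventually (lt_mem_nhds (not_le.1 hu))).and
        self_mem_nhdsWithin).exists
      have h1 := hfU _ (hs0 0 s hs)
      rw [hf] at h1
      simp at h1
      linarith
    have hscale : ∀ p ∈ U, f p ≤ 0 := by
      intro p hp
      by_contra hpos
      push Not at hpos
      obtain ⟨n, hn⟩ := exists_nat_gt (u / f p)
      have hn' : (0 : ℝ) < n := (div_nonneg hu0 hpos.le).trans_lt hn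
      have hmem : (n : ℝ) • p ∈ U := by
        have hp : q ⬝ᵥ p.1 + r * ∑ i, |p.1 i| < p.2 := hp
        change q ⬝ᵥ ((n : ℝ) • p.1) + r * ∑ i, |((n : ℝ) • p.1) i| < (n : ℝ) * p.2
        have : ∑ i, |((n : ℝ) • p.1) i| = n * ∑ i, |p.1 i| := by
          rw [Finset.mul_sum]
          exact Finset.sum_congr rfl fun i _ => by simp [abs_mul]
        rw [this, dotProduct_smul, smul_eq_mul]
        nlinarith
      have h1 := hfU _ hmem
      rw [map_smul, smul_eq_mul] at h1
      rw [div_lt_iff₀ hpos] at hn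
      linarith
    have hb : b < 0 := by
      by_contra hb
      push Not at hb
      have h1 := hscale _ (hs0 0 1 one_pos)
      rw [hf] at h1
      simp at h1
      have hb0 : b = 0 := le_antisymm h1 hb
      have hw0 : ∀ m, w ⬝ᵥ m ≤ 0 := fun m => by
        have := hscale _ (hs0 m 1 one_pos)
        rw [hf, hb0] at this
        simpa using this
      have hw0' : ∀ m, w ⬝ᵥ m = 0 := fun m => le_antisymm (hw0 m) (by
        have := hw0 (-m)
        rw [dotProduct_neg] at this
        linarith)
      have hz : ∀ p, f p = 0 := fun p => by
        rw [show p = (p.1, p.2) from rfl, hf, hw0', hb0]; simp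
      have := hfU _ (hs0 0 1 one_pos)
      rw [hz] at this
      have h2 := hfM p₀ hp₀
      rw [hz] at h2
      linarith
    refine ⟨(-b)⁻¹ • w, ?_, fun p hp => ?_⟩
    · have hkey : ∀ m, w ⬝ᵥ m ≤ (-b) * (q ⬝ᵥ m + r * ∑ i, |m i|) := by
        intro m
        by_contra hcon
        push Not at hcon
        have hpos : 0 < (w ⬝ᵥ m - (-b) * (q ⬝ᵥ m + r * ∑ i, |m i|)) / (2 * -b) :=
          div_pos (by linarith) (by linarith)
        have := hscale _ (hs0 m _ hpos)
        rw [hf] at this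
        have h3 : (w ⬝ᵥ m - (-b) * (q ⬝ᵥ m + r * ∑ i, |m i|)) / (2 * -b) * b =
          -(w ⬝ᵥ m - (-b) * (q ⬝ᵥ m + r * ∑ i, |m i|)) / 2 := by
          have hb0 : b ≠ 0 := hb.ne
          field_simp
        rw [add_mul, h3] at this
        linarith
      rw [mem_closedBall_iff_norm, pi_norm_le_iff_of_nonneg hr.le]
      intro i
      rw [Real.norm_eq_abs, abs_le]
      have e1 := hkey (Pi.single i 1)
      have e2 := hkey (Pi.single i (-1))
      have hsum : ∀ c : ℝ, ∑ j, |(Pi.single i c : Fin d → ℝ) j| = |c| := by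
        intro c
        rw [Finset.sum_eq_single i]
        · simp
        · intro j _ hj; simp [Pi.single_eq_of_ne hj]
        · simp
      rw [hsum, dotProduct_single, dotProduct_single] at e1 e2
      simp only [abs_one, abs_neg, mul_one, mul_neg] at e1 e2
      have hb' : 0 < -b := by linarith
      have h3 : (-b)⁻¹ * w i ≤ q i + r := by
        rw [inv_mul_le_iff₀ hb']; exact e1
      have h4 : q i - r ≤ (-b)⁻¹ * w i := by
        rw [le_inv_mul_iff₀ hb']; nlinarith
      simp only [Pi.sub_apply, Pi.smul_apply, smul_eq_mul]
      constructor <;> linarith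
    · have h1 := hu0.trans (hfM p hp)
      rw [show p = (p.1, p.2) from rfl, hf] at h1
      rw [smul_dotProduct, smul_eq_mul, le_inv_mul_iff₀ (by linarith)]
      linarith

/-! ### The one-period market under a directed solid family of measures -/

/-- A family of probability measures that is directed for absolute continuity and contains every
probability measure dominated by one of its members. -/
structure Solid {Y : Type*} [MeasurableSpace Y] (C : Set (Measure Y)) : Prop where
  prob : ∀ R ∈ C, IsProbabilityMeasure R
  dir : ∀ R ∈ C, ∀ R' ∈ C, ∃ R'' ∈ C, R ≪ R'' ∧ R' ≪ R''
  solid : ∀ R ∈ C, ∀ R', IsProbabilityMeasure R' → R' ≪ R → R' ∈ C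

section OneStep

variable {Y : Type*} [MeasurableSpace Y]

lemma isProbabilityMeasure_mix {R R' : Measure Y} [IsProbabilityMeasure R]
    [IsProbabilityMeasure R'] {a b : ℝ≥0∞} (hab : a + b = 1) :
    IsProbabilityMeasure (a • R + b • R') :=
  ⟨by simp [hab]⟩

lemma Solid.mix_mem {C : Set (Measure Y)} (hC : Solid C) {R R' : Measure Y} (hR : R ∈ C)
    (hR' : R' ∈ C) {a b : ℝ≥0∞} (hab : a + b = 1) : a • R + b • R' ∈ C := by
  obtain ⟨R'', hR'', h1, h2⟩ := hC.dir R hR R' hR'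
  have := hC.prob R hR
  have := hC.prob R' hR'
  refine hC.solid R'' hR'' _ (isProbabilityMeasure_mix hab) ?_
  refine Measure.AbsolutelyContinuous.mk fun s _ hs => ?_
  simp [h1 hs, h2 hs]

lemma exists_equiv_lintegral_lt_top (R : Measure Y) [IsProbabilityMeasure R] {W : Y → ℝ≥0}
    (hW : Measurable W) :
    ∃ R' : Measure Y, IsProbabilityMeasure R' ∧ R' ≪ R ∧ R ≪ R' ∧ ∫⁻ y, W y ∂ R' < ⊤ := by
  let ρ : Y → ℝ≥0∞ := fun y => ((1 + W y)⁻¹ : ℝ≥0)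
  have hρ : Measurable ρ := ((measurable_const.add hW).inv).coe_nnreal_ennreal
  have hρ0 : ∀ y, ρ y ≠ 0 := fun y => by
    simp only [ρ, ne_eq, ENNReal.coe_eq_zero, inv_eq_zero]
    positivity
  have hρ1 : ∀ y, ρ y ≤ 1 := fun y => by
    simp only [ρ]
    exact_mod_cast inv_le_one_of_one_le₀ (le_add_of_nonneg_right zero_le)
  have hρW : ∀ y, ρ y * W y ≤ 1 := fun y => by
    simp only [ρ]
    rw [← ENNReal.coe_mul]
    have : (1 + W y)⁻¹ * W y ≤ 1 := by
      rw [inv_mul_le_iff₀ (by positivity)]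
      simp
    exact_mod_cast this
  let Z := ∫⁻ y, ρ y ∂ R
  have hZ1 : Z ≤ 1 := (lintegral_mono hρ1).trans (by simp)
  have hZ0 : Z ≠ 0 := by
    intro h
    rw [lintegral_eq_zero_iff hρ] at h
    have : ∀ᵐ y ∂ R, False := h.mono fun y hy => hρ0 y hy
    exact IsProbabilityMeasure.ne_zero R (by simpa using this)
  have hZt : Z ≠ ⊤ := (hZ1.trans_lt ENNReal.one_lt_top).ne
  have h1 : R.withDensity ρ ≪ R := withDensity_absolutelyContinuous _ _
  have h2 : R ≪ R.withDensity ρ :=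
    withDensity_absolutelyContinuous' hρ.aemeasurable (ae_of_all _ hρ0)
  refine ⟨Z⁻¹ • R.withDensity ρ, ⟨?_⟩, ?_, ?_, ?_⟩
  · rw [Measure.smul_apply, withDensity_apply _ MeasurableSet.univ, Measure.restrict_univ,
      smul_eq_mul]
    exact ENNReal.inv_mul_cancel hZ0 hZt
  · exact Measure.AbsolutelyContinuous.smul_left h1 _
  · refine h2.trans (Measure.AbsolutelyContinuous.mk fun s _ hs => ?_)
    rw [Measure.smul_apply, smul_eq_mul, mul_eq_zero] at hs
    exact hs.resolve_left (ENNReal.inv_ne_zero.2 hZt)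
  · rw [lintegral_smul_measure, lintegral_withDensity_eq_lintegral_mul _ hρ hW.coe_nnreal_ennreal,
      smul_eq_mul]
    refine ENNReal.mul_lt_top (ENNReal.inv_lt_top.2 (pos_iff_ne_zero.2 hZ0)) ?_
    exact (lintegral_mono hρW).trans_lt (by simp)

lemma integrable_of_abs_le {R : Measure Y} {W : Y → ℝ≥0} (hW : ∫⁻ y, W y ∂ R < ⊤) {G : Y → ℝ}
    (hG : AEStronglyMeasurable G R) (h : ∀ y, |G y| ≤ W y) : Integrable G R := by
  refine ⟨hG, (lintegral_mono fun y => ?_).trans_lt hW⟩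
  rw [← ofReal_norm, Real.norm_eq_abs, ← ENNReal.ofReal_coe_nnreal]
  exact ENNReal.ofReal_le_ofReal (h y)

lemma Solid.ae_nonpos_of_integral_nonpos {C : Set (Measure Y)} (hC : Solid C) {P : Measure Y}
    (hP : P ∈ C) {W : Y → ℝ≥0} (hW : Measurable W) {G : Y → ℝ} (hG : Measurable G)
    (hGW : ∀ R : Measure Y, IsProbabilityMeasure R → ∫⁻ y, W y ∂ R < ⊤ → Integrable G R)
    (h : ∀ R ∈ C, P ≪ R → ∫⁻ y, W y ∂ R < ⊤ → ∫ y, G y ∂ R ≤ 0) :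
    ∀ R ∈ C, ∀ᵐ y ∂ R, G y ≤ 0 := by
  intro R hR
  by_contra hcon
  have := hC.prob R hR
  have := hC.prob P hP
  have hB : MeasurableSet {y | 0 < G y} := measurableSet_lt measurable_const hG
  have hRB : R {y | 0 < G y} ≠ 0 := by
    intro h0
    apply hcon
    rw [ae_iff]
    simpa only [not_le] using h0
  have hcp : IsProbabilityMeasure (R[|{y | 0 < G y}]) := cond_isProbabilityMeasure hRB
  obtain ⟨R₂, hR₂p, hR₂c, hcR₂, hR₂W⟩ :=
    exists_equiv_lintegral_lt_top (R[|{y | 0 < G y}]) hW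
  obtain ⟨R₀, hR₀p, hR₀P, hPR₀, hR₀W⟩ := exists_equiv_lintegral_lt_top P hW
  have hR₂C : R₂ ∈ C := hC.solid R hR _ hR₂p (hR₂c.trans cond_absolutelyContinuous)
  have hR₀C : R₀ ∈ C := hC.solid P hP _ hR₀p hR₀P
  have hpos : 0 < ∫ y, G y ∂ R₂ := by
    have hae : ∀ᵐ y ∂ R₂, 0 < G y := hR₂c.ae_le (ae_cond_mem hB)
    rw [integral_pos_iff_support_of_nonneg_ae (hae.mono fun y hy => hy.le) (hGW _ inferInstance hR₂W)]
    have : R₂ (Function.support G) = 1 := by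
      exact (prob_compl_eq_zero_iff₀ (measurableSet_support hG).nullMeasurableSet).1
        (hae.mono fun y hy => hy.ne')
    rw [this]; exact one_pos
  have hmix : ∀ ε : ℝ, 0 < ε → ε < 1 → (1 - ε) * ∫ y, G y ∂ R₂ + ε * ∫ y, G y ∂ R₀ ≤ 0 := by
    intro ε hε hε1
    have hab : ENNReal.ofReal (1 - ε) + ENNReal.ofReal ε = 1 := by
      rw [← ENNReal.ofReal_add (by linarith) hε.le]; simp
    have h1 := h _ (hC.mix_mem hR₂C hR₀C hab) (by
      refine hPR₀.trans (Measure.AbsolutelyContinuous.mk fun s _ hs => ?_)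
      simp only [Measure.coe_add, Measure.coe_smul, Pi.add_apply, Pi.smul_apply, smul_eq_mul,
        add_eq_zero, mul_eq_zero, ENNReal.ofReal_eq_zero] at hs
      exact hs.2.resolve_left (by linarith)) (by
      rw [lintegral_add_measure, lintegral_smul_measure, lintegral_smul_measure]
      exact ENNReal.add_lt_top.2 ⟨ENNReal.mul_lt_top ENNReal.ofReal_lt_top hR₂W,
        ENNReal.mul_lt_top ENNReal.ofReal_lt_top hR₀W⟩)
    rwa [integral_add_measure ((hGW _ inferInstance hR₂W).smul_measure ENNReal.ofReal_ne_top)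
      ((hGW _ inferInstance hR₀W).smul_measure ENNReal.ofReal_ne_top), integral_smul_measure,
      integral_smul_measure, ENNReal.toReal_ofReal (by linarith), ENNReal.toReal_ofReal hε.le]
      at h1
  have hlim : Tendsto (fun ε : ℝ => (1 - ε) * ∫ y, G y ∂ R₂ + ε * ∫ y, G y ∂ R₀) (𝓝[>] 0)
      (𝓝 (∫ y, G y ∂ R₂)) := by
    have : Continuous fun ε : ℝ => (1 - ε) * ∫ y, G y ∂ R₂ + ε * ∫ y, G y ∂ R₀ := by fun_prop
    simpa using (this.tendsto 0).mono_left nhdsWithin_le_nhds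
  obtain ⟨ε, ⟨hε1, hε⟩, hε0⟩ := ((hlim.eventually (lt_mem_nhds hpos)).and
    (nhdsWithin_le_nhds (gt_mem_nhds one_pos)) |>.and self_mem_nhdsWithin).exists
  exact absurd (hmix ε hε0 hε) (not_le.2 hε1)

variable {d : ℕ}

/-- The vector of means of `D`. -/
def mean (D : Y → Fin d → ℝ) (R : Measure Y) : Fin d → ℝ := fun i => ∫ y, D y i ∂ R

lemma integrable_dotProduct {D : Y → Fin d → ℝ} {R : Measure Y}
    (hD : ∀ i, Integrable (fun y => D y i) R) (h : Fin d → ℝ) :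
    Integrable (fun y => h ⬝ᵥ D y) R :=
  integrable_finsetSum _ fun i _ => (hD i).const_mul (h i)

lemma dotProduct_mean {D : Y → Fin d → ℝ} {R : Measure Y}
    (hD : ∀ i, Integrable (fun y => D y i) R) (h : Fin d → ℝ) :
    ∫ y, h ⬝ᵥ D y ∂ R = h ⬝ᵥ mean D R := by
  simp only [dotProduct, mean]
  rw [integral_finsetSum _ fun i _ => (hD i).const_mul (h i)]
  simp_rw [integral_const_mul]

lemma integral_mix {R R' : Measure Y} {G : Y → ℝ} (h : Integrable G R) (h' : Integrable G R')
    {a b : ℝ} (ha : 0 ≤ a) (hb : 0 ≤ b) :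
    ∫ y, G y ∂(ENNReal.ofReal a • R + ENNReal.ofReal b • R') =
      a * ∫ y, G y ∂ R + b * ∫ y, G y ∂ R' := by
  rw [integral_add_measure (h.smul_measure ENNReal.ofReal_ne_top)
      (h'.smul_measure ENNReal.ofReal_ne_top), integral_smul_measure,
      integral_smul_measure, ENNReal.toReal_ofReal ha, ENNReal.toReal_ofReal hb]
  rfl

lemma integrable_mix {R R' : Measure Y} {G : Y → ℝ} (h : Integrable G R) (h' : Integrable G R')
    {a b : ℝ} : Integrable G (ENNReal.ofReal a • R + ENNReal.ofReal b • R') :=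
  (h.smul_measure ENNReal.ofReal_ne_top).add_measure (h'.smul_measure ENNReal.ofReal_ne_top)

lemma mean_mix {D : Y → Fin d → ℝ} {R R' : Measure Y} (h : ∀ i, Integrable (fun y => D y i) R)
    (h' : ∀ i, Integrable (fun y => D y i) R') {a b : ℝ} (ha : 0 ≤ a) (hb : 0 ≤ b) :
    mean D (ENNReal.ofReal a • R + ENNReal.ofReal b • R') = a • mean D R + b • mean D R' := by
  ext i
  simp only [mean, Pi.add_apply, Pi.smul_apply, smul_eq_mul]
  exact integral_mix (h i) (h' i) ha hb

/-- A common weight for the increment, the claim and a given weight. -/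
def weight (D : Y → Fin d → ℝ) (F : Y → ℝ) (W : Y → ℝ≥0) (y : Y) : ℝ≥0 :=
  ∑ i, ‖D y i‖₊ + ‖F y‖₊ + W y

lemma measurable_weight {D : Y → Fin d → ℝ} {F : Y → ℝ} {W : Y → ℝ≥0} (hD : Measurable D)
    (hF : Measurable F) (hW : Measurable W) : Measurable (weight D F W) :=
  ((Finset.measurable_sum _ fun i _ => ((measurable_pi_apply i).comp hD).nnnorm).add
    hF.nnnorm).add hW

lemma integrable_of_weight {D : Y → Fin d → ℝ} {F : Y → ℝ} {W : Y → ℝ≥0} (hD : Measurable D)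
    (hF : Measurable F) {R : Measure Y} (h : ∫⁻ y, weight D F W y ∂ R < ⊤) :
    (∀ i, Integrable (fun y => D y i) R) ∧ Integrable F R ∧ ∫⁻ y, W y ∂ R < ⊤ := by
  refine ⟨fun i => integrable_of_abs_le h
      (((measurable_pi_apply i).comp hD).aestronglyMeasurable) fun y => ?_,
    integrable_of_abs_le h hF.aestronglyMeasurable fun y => ?_,
    (lintegral_mono fun y => ?_).trans_lt h⟩
  · rw [← Real.norm_eq_abs, ← coe_nnnorm, NNReal.coe_le_coe, weight, add_assoc]
    exact (Finset.single_le_sum (f := fun i => ‖D y i‖₊) (fun _ _ => zero_le)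
      (Finset.mem_univ i)).trans le_self_add
  · rw [← Real.norm_eq_abs, ← coe_nnnorm, NNReal.coe_le_coe, weight, add_assoc, add_left_comm]
    exact le_self_add
  · exact ENNReal.coe_le_coe.2 (le_add_self : W y ≤ weight D F W y)

/-- The quasi-sure one-period no-arbitrage condition. -/
def NAStep (C : Set (Measure Y)) (D : Y → Fin d → ℝ) : Prop :=
  ∀ y : Fin d → ℝ, (∀ R ∈ C, ∀ᵐ z ∂ R, 0 ≤ y ⬝ᵥ D z) → ∀ R ∈ C, ∀ᵐ z ∂ R, y ⬝ᵥ D z = 0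

lemma Solid.exists_mart_or_exists_hedge {C : Set (Measure Y)} (hC : Solid C)
    {D : Y → Fin d → ℝ} {F : Y → ℝ} {W : Y → ℝ≥0} (hD : Measurable D) (hF : Measurable F)
    (hW : Measurable W) (hNA : NAStep C D) {P : Measure Y} (hP : P ∈ C) (v : ℝ) :
    (∃ Q ∈ C, P ≪ Q ∧ ∫⁻ y, W y ∂Q < ⊤ ∧ (∀ i, Integrable (fun y => D y i) Q) ∧ Integrable F Q ∧
      mean D Q = 0 ∧ v < ∫ y, F y ∂Q) ∨
    ∃ y : Fin d → ℝ, ∀ R ∈ C, ∀ᵐ z ∂ R, F z ≤ v + y ⬝ᵥ D z := by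
  have hWm := measurable_weight hD hF hW
  let Θ : Set (Measure Y) := {R | R ∈ C ∧ P ≪ R ∧ ∫⁻ y, weight D F W y ∂ R < ⊤}
  let K : Set ((Fin d → ℝ) × ℝ) :=
    {p | ∃ R ∈ Θ, ∃ z : ℝ, 0 < z ∧ p = (mean D R, ∫ y, F y ∂ R - v - z)}
  have hdotm : ∀ y : Fin d → ℝ, Measurable fun z => y ⬝ᵥ D z := fun y =>
    Finset.measurable_sum _ fun i _ => ((measurable_pi_apply i).comp hD).const_mul (y i)
  have hKc : Convex ℝ K := by
    rintro _ ⟨R, ⟨hR, hPR, hRW⟩, z, hz, rfl⟩ _ ⟨R', ⟨hR', hPR', hRW'⟩, z', hz', rfl⟩ a b ha hb hab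
    have i1 := integrable_of_weight hD hF hRW
    have i2 := integrable_of_weight hD hF hRW'
    have := hC.prob R hR
    have := hC.prob R' hR'
    have hab' : ENNReal.ofReal a + ENNReal.ofReal b = 1 := by
      rw [← ENNReal.ofReal_add ha hb, hab]; simp
    refine ⟨_, ⟨hC.mix_mem hR hR' hab', ?_, ?_⟩, a * z + b * z', ?_, ?_⟩
    · refine Measure.AbsolutelyContinuous.mk fun s _ hs => ?_
      simp only [Measure.coe_add, Measure.coe_smul, Pi.add_apply, Pi.smul_apply, smul_eq_mul,
        add_eq_zero, mul_eq_zero, ENNReal.ofReal_eq_zero] at hs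
      rcases hs.1 with h | h
      · exact hPR' (hs.2.resolve_left (by linarith))
      · exact hPR h
    · rw [lintegral_add_measure, lintegral_smul_measure, lintegral_smul_measure]
      exact ENNReal.add_lt_top.2 ⟨ENNReal.mul_lt_top ENNReal.ofReal_lt_top hRW,
        ENNReal.mul_lt_top ENNReal.ofReal_lt_top hRW'⟩
    · rcases ha.eq_or_lt with rfl | ha
      · have : b = 1 := by linarith
        subst this; simpa using hz'
      · positivity
    · rw [mean_mix i1.1 i2.1 ha hb, integral_mix i1.2.1 i2.2.1 ha hb]
      refine Prod.ext rfl ?_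
      simp only [Prod.smul_mk, Prod.mk_add_mk, smul_eq_mul]
      have : v = (a + b) * v := by rw [hab, one_mul]
      linear_combination this
  have hPp := hC.prob P hP
  obtain ⟨R₀, hR₀p, hR₀P, hPR₀, hR₀W⟩ := exists_equiv_lintegral_lt_top P hWm
  have hR₀ : R₀ ∈ Θ := ⟨hC.solid P hP _ hR₀p hR₀P, hPR₀, hR₀W⟩
  by_cases h0 : (0 : (Fin d → ℝ) × ℝ) ∈ K
  · left
    obtain ⟨R, ⟨hR, hPR, hRW⟩, z, hz, h⟩ := h0
    obtain ⟨h1, h2⟩ := Prod.mk.inj h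
    obtain ⟨i1, i2, i3⟩ := integrable_of_weight hD hF hRW
    exact ⟨R, hR, hPR, i3, i1, i2, h1.symm, by linarith⟩
  right
  obtain ⟨f, hfK, p, ⟨R₁, hR₁, z₁, hz₁, rfl⟩, hfp⟩ :=
    exists_separating_of_zero_notMem hKc ⟨_, R₀, hR₀, 1, one_pos, rfl⟩ h0
  obtain ⟨w, hw⟩ := linearMap_eq_dotProduct (f ∘ₗ LinearMap.inl ℝ (Fin d → ℝ) ℝ)
  let b := f (0, 1)
  have hf : ∀ m z, f (m, z) = w ⬝ᵥ m + z * b := by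
    intro m z
    have h1 : ((m, z) : (Fin d → ℝ) × ℝ) = (m, 0) + z • ((0 : Fin d → ℝ), (1 : ℝ)) := by simp
    rw [h1, map_add, map_smul, smul_eq_mul, ← hw m]; rfl
  have hKR : ∀ R ∈ Θ, ∀ z : ℝ, 0 < z → 0 ≤ w ⬝ᵥ mean D R + (∫ y, F y ∂ R - v - z) * b := by
    intro R hR z hz
    rw [← hf]
    exact hfK _ ⟨R, hR, z, hz, rfl⟩
  have hKR0 : ∀ R ∈ Θ, 0 ≤ w ⬝ᵥ mean D R + (∫ y, F y ∂ R - v) * b := by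
    intro R hR
    have hlim : Tendsto (fun z : ℝ => w ⬝ᵥ mean D R + (∫ y, F y ∂ R - v - z) * b) (𝓝[>] 0)
        (𝓝 (w ⬝ᵥ mean D R + (∫ y, F y ∂ R - v) * b)) := by
      have : Continuous fun z : ℝ => w ⬝ᵥ mean D R + (∫ y, F y ∂ R - v - z) * b := by fun_prop
      simpa using (this.tendsto 0).mono_left nhdsWithin_le_nhds
    exact ge_of_tendsto hlim (eventually_nhdsWithin_of_forall fun z hz => hKR R hR z hz)
  have hb : b ≤ 0 := by
    by_contra hb
    push Not at hb
    have h1 := hKR R₀ hR₀ ((|w ⬝ᵥ mean D R₀ + (∫ y, F y ∂ R₀ - v) * b| + 1) / b) (by positivity)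
    rw [sub_mul, div_mul_cancel₀ _ hb.ne'] at h1
    linarith [le_abs_self (w ⬝ᵥ mean D R₀ + (∫ y, F y ∂ R₀ - v) * b)]
  have hinteg : ∀ R : Measure Y, IsProbabilityMeasure R → ∫⁻ y, weight D F W y ∂ R < ⊤ →
      ∀ y : Fin d → ℝ, Integrable (fun z => F z - (v + y ⬝ᵥ D z)) R := fun R _ hRW y =>
    (integrable_of_weight hD hF hRW).2.1.sub
      ((integrable_const v).add (integrable_dotProduct (integrable_of_weight hD hF hRW).1 _))
  rcases hb.lt_or_eq with hb | hb
  · refine ⟨(-b)⁻¹ • w, fun R hR => ?_⟩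
    have key := hC.ae_nonpos_of_integral_nonpos hP hWm
      (G := fun z => F z - (v + ((-b)⁻¹ • w) ⬝ᵥ D z)) (hF.sub ((hdotm _).const_add v))
      (fun R _ hRW => hinteg R inferInstance hRW _) (fun R hR hPR hRW => ?_) R hR
    · exact key.mono fun z hz => by linarith
    · have := hC.prob R hR
      obtain ⟨i1, i2, -⟩ := integrable_of_weight hD hF hRW
      have i3 : Integrable (fun y => v + ((-b)⁻¹ • w) ⬝ᵥ D y) R :=
        (integrable_const v).add (integrable_dotProduct i1 _)
      rw [integral_sub i2 i3, integral_add (integrable_const v) (integrable_dotProduct i1 _), dotProduct_mean i1,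
        smul_dotProduct, smul_eq_mul, integral_const]
      have h1 := hKR0 R ⟨hR, hPR, hRW⟩
      have h2 : ∫ y, F y ∂ R - v ≤ (-b)⁻¹ * (w ⬝ᵥ mean D R) := by
        rw [le_inv_mul_iff₀ (by linarith)]
        linarith
      simp only [probReal_univ, one_smul]
      linarith
  · exfalso
    have hnn : ∀ R ∈ C, ∀ᵐ z ∂ R, 0 ≤ w ⬝ᵥ D z := fun R hR => by
      have key := hC.ae_nonpos_of_integral_nonpos hP hWm (G := fun z => -(w ⬝ᵥ D z))
        (hdotm _).neg
        (fun R _ hRW => (integrable_dotProduct (integrable_of_weight hD hF hRW).1 _).neg)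
        (fun R hR hPR hRW => ?_) R hR
      · exact key.mono fun z hz => by linarith
      · obtain ⟨i1, -, -⟩ := integrable_of_weight hD hF hRW
        have h1 := hKR0 R ⟨hR, hPR, hRW⟩
        rw [integral_neg, dotProduct_mean i1]
        rw [hb] at h1
        linarith
    have hz := hNA w hnn R₁ hR₁.1
    have h1 := dotProduct_mean (integrable_of_weight hD hF hR₁.2.2).1 w
    rw [integral_congr_ae hz] at h1
    rw [hf, hb, ← h1] at hfp
    simp at hfp

end OneStep

/-! ### Hitting sets of hedging correspondences and measurable selectors of closed sets -/

section Hitting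

variable {Y : Type*} [MeasurableSpace Y] {d : ℕ}

lemma Solid.exists_mem_closedBall_hedge_iff {C : Set (Measure Y)} (hC : Solid C)
    {D : Y → Fin d → ℝ} {F : Y → ℝ} (hD : Measurable D) (hF : Measurable F) (a : ℝ)
    (q : Fin d → ℝ) {r : ℝ} (hr : 0 < r) :
    (∃ y ∈ Metric.closedBall q r, ∀ R ∈ C, ∀ᵐ z ∂ R, F z ≤ a + y ⬝ᵥ D z) ↔
      ∀ R ∈ C, (∀ i, Integrable (fun z => D z i) R) → Integrable F R →
        ∫ z, F z ∂ R - a ≤ q ⬝ᵥ mean D R + r * ∑ i, |mean D R i| := by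
  let M : Set ((Fin d → ℝ) × ℝ) := {p | ∃ R ∈ C, (∀ i, Integrable (fun z => D z i) R) ∧
    Integrable F R ∧ p = (mean D R, ∫ z, F z ∂ R - a)}
  have hM : Convex ℝ M := by
    rintro _ ⟨R, hR, i1, i2, rfl⟩ _ ⟨R', hR', j1, j2, rfl⟩ s t hs ht hst
    have hab : ENNReal.ofReal s + ENNReal.ofReal t = 1 := by
      rw [← ENNReal.ofReal_add hs ht, hst]; simp
    refine ⟨_, hC.mix_mem hR hR' hab, fun i => integrable_mix (i1 i) (j1 i),
      integrable_mix i2 j2, ?_⟩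
    rw [mean_mix i1 j1 hs ht, integral_mix i2 j2 hs ht]
    refine Prod.ext rfl ?_
    simp only [Prod.smul_mk, Prod.mk_add_mk, smul_eq_mul]
    have : a = (s + t) * a := by rw [hst, one_mul]
    linear_combination this
  have key := exists_mem_closedBall_iff hM q hr
  have hinteg : ∀ y : Fin d → ℝ, ∀ R ∈ C, (∀ i, Integrable (fun z => D z i) R) → Integrable F R →
      ∫ z, (F z - (a + y ⬝ᵥ D z)) ∂ R = (∫ z, F z ∂ R - a) - y ⬝ᵥ mean D R := by
    intro y R hR i1 i2
    have := hC.prob R hR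
    have i3 : Integrable (fun z => a + y ⬝ᵥ D z) R :=
      (integrable_const a).add (integrable_dotProduct i1 _)
    rw [integral_sub i2 i3, integral_add (integrable_const a) (integrable_dotProduct i1 _),
      dotProduct_mean i1, integral_const]
    simp only [probReal_univ, one_smul]
    ring
  constructor
  · rintro ⟨y, hy, h⟩ R hR i1 i2
    refine key.1 ⟨y, hy, ?_⟩ (_, _) ⟨R, hR, i1, i2, rfl⟩
    rintro _ ⟨R, hR, i1, i2, rfl⟩
    have h1 := hinteg y R hR i1 i2
    have h2 : ∫ z, (F z - (a + y ⬝ᵥ D z)) ∂ R ≤ 0 :=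
      integral_nonpos_of_ae ((h R hR).mono fun z hz => by simpa using hz)
    simp only
    linarith
  · intro h
    obtain ⟨y, hy, hyM⟩ := key.2 (by
      rintro _ ⟨R, hR, i1, i2, rfl⟩
      exact h R hR i1 i2)
    refine ⟨y, hy, fun R hR => ?_⟩
    have hWm := measurable_weight hD hF (measurable_const (a := (0 : ℝ≥0)))
    have hGm : Measurable fun z => F z - (a + y ⬝ᵥ D z) := hF.sub (Measurable.const_add
      (Finset.measurable_sum _ fun i _ => ((measurable_pi_apply i).comp hD).const_mul (y i)) a)
    have := hC.ae_nonpos_of_integral_nonpos hR hWm hGm (fun R' _ hW => ?_)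
      (fun R' hR' _ hW => ?_) R hR
    · exact this.mono fun z hz => by linarith
    · obtain ⟨i1, i2, -⟩ := integrable_of_weight hD hF hW
      exact i2.sub ((integrable_const a).add (integrable_dotProduct i1 _))
    · obtain ⟨i1, i2, -⟩ := integrable_of_weight hD hF hW
      rw [hinteg y R' hR' i1 i2]
      have := hyM _ ⟨R', hR', i1, i2, rfl⟩
      simp only at this
      linarith

lemma isClosed_hedge (C : Set (Measure Y)) (D : Y → Fin d → ℝ) (F : Y → ℝ) (a : ℝ) :
    IsClosed {y : Fin d → ℝ | ∀ R ∈ C, ∀ᵐ z ∂ R, F z ≤ a + y ⬝ᵥ D z} := by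
  refine isClosed_of_closure_subset fun y hy R hR => ?_
  obtain ⟨u, hu, hul⟩ := mem_closure_iff_seq_limit.1 hy
  have h1 : ∀ᵐ z ∂ R, ∀ n, F z ≤ a + u n ⬝ᵥ D z := ae_all_iff.2 fun n => hu n R hR
  refine h1.mono fun z hz => ?_
  have hc : Continuous fun w : Fin d → ℝ => a + w ⬝ᵥ D z := by
    simp only [dotProduct]; fun_prop
  exact ge_of_tendsto' ((hc.tendsto y).comp hul) hz

end Hitting

section Selectors

variable {X : Type*} {m : MeasurableSpace X} {E : Type*} [MetricSpace E]
  [SecondCountableTopology E] [Nonempty E]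

lemma exists_dist_denseSeq_lt (z : E) (r : ℝ) (hr : 0 < r) :
    ∃ k, dist z (TopologicalSpace.denseSeq E k) < r := by
  obtain ⟨k, hk⟩ := (TopologicalSpace.denseRange_denseSeq E).exists_mem_open
    Metric.isOpen_ball (⟨z, Metric.mem_ball_self hr⟩ : (Metric.ball z r).Nonempty)
  exact ⟨k, by rw [dist_comm]; exact hk⟩

lemma measurableSet_setOf_nonempty {V : X → Set E}
    (hm : ∀ (q : E) (r : ℝ), 0 < r →
      MeasurableSet {x | (V x ∩ Metric.closedBall q r).Nonempty}) :
    MeasurableSet {x | (V x).Nonempty} := by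
  have : {x | (V x).Nonempty} = ⋃ k,
      {x | (V x ∩ Metric.closedBall (TopologicalSpace.denseSeq E k) 1).Nonempty} := by
    ext x
    simp only [mem_ofPred_eq, mem_iUnion]
    constructor
    · rintro ⟨z, hz⟩
      obtain ⟨k, hk⟩ := exists_dist_denseSeq_lt z 1 one_pos
      exact ⟨k, z, hz, hk.le⟩
    · rintro ⟨k, z, hz, -⟩
      exact ⟨z, hz⟩
  rw [this]
  exact MeasurableSet.iUnion fun k => hm _ _ one_pos

variable [CompleteSpace E] [MeasurableSpace E] [BorelSpace E]

lemma exists_measurable_selector_near {V : X → Set E} (hV : ∀ x, IsClosed (V x))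
    (hm : ∀ (q : E) (r : ℝ), 0 < r →
      MeasurableSet {x | (V x ∩ Metric.closedBall q r).Nonempty})
    {c : ℝ} (hc : 0 < c) {k₀ : X → ℕ} (hk₀ : Measurable k₀)
    (hk : ∀ x, (V x).Nonempty → (V x ∩ Metric.closedBall (TopologicalSpace.denseSeq E (k₀ x)) c).Nonempty) :
    ∃ y : X → E, Measurable y ∧ ∀ x, (V x).Nonempty →
      y x ∈ V x ∧ dist (TopologicalSpace.denseSeq E (k₀ x)) (y x) ≤ 4 * c := by
  classical
  let q := TopologicalSpace.denseSeq E
  let ρ : ℕ → ℝ := fun n => c * (1 / 2) ^ n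
  have hρ : ∀ n, 0 < ρ n := fun n => by positivity
  have hqd := exists_dist_denseSeq_lt (E := E)
  have hne := measurableSet_setOf_nonempty hm
  let G : ℕ → (X → ℕ) → Prop := fun n k => Measurable k ∧
    ∀ x, (V x).Nonempty → (V x ∩ Metric.closedBall (q (k x)) (ρ n)).Nonempty
  have step : ∀ n (k : {k : X → ℕ // G n k}), ∃ k' : {k : X → ℕ // G (n + 1) k},
      ∀ x, dist (q (k.1 x)) (q (k'.1 x)) ≤ 2 * c * (1 / 2) ^ n := by
    rintro n ⟨k, hkm, hkV⟩
    let p : X → ℕ → Prop := fun x j =>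
      ((V x).Nonempty → (V x ∩ Metric.closedBall (q j) (ρ (n + 1))).Nonempty) ∧
        dist (q (k x)) (q j) ≤ 2 * c * (1 / 2) ^ n
    have hp : ∀ x, ∃ j, p x j := by
      intro x
      by_cases hx : (V x).Nonempty
      · obtain ⟨z, hz, hzk⟩ := hkV x hx
        obtain ⟨j, hj⟩ := hqd z _ (hρ (n + 1))
        refine ⟨j, fun _ => ⟨z, hz, hj.le⟩, ?_⟩
        have h1 := dist_triangle (q (k x)) z (q j)
        rw [dist_comm (q (k x)) z] at h1
        have h2 : dist z (q (k x)) ≤ ρ n := hzk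
        have h3 : ρ (n + 1) ≤ ρ n := by
          simp only [ρ, pow_succ]
          have : 0 < c * (1 / 2 : ℝ) ^ n := hρ n
          linarith
        have h4 : 2 * c * (1 / 2) ^ n = ρ n + ρ n := by simp only [ρ]; ring
        linarith
      · exact ⟨k x, fun h => absurd h hx, by simp; positivity⟩
    have hpm : ∀ j, MeasurableSet {x | p x j} := fun j => by
      have e : {x | p x j} = ({x | (V x).Nonempty}ᶜ ∪
          {x | (V x ∩ Metric.closedBall (q j) (ρ (n + 1))).Nonempty}) ∩
          {x | dist (q (k x)) (q j) ≤ 2 * c * (1 / 2) ^ n} := by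
        ext x
        simp only [p, mem_ofPred_eq, mem_inter_iff, mem_union, mem_compl_iff, imp_iff_not_or]
      rw [e]
      refine (hne.compl.union (hm _ _ (hρ _))).inter (measurableSet_le ?_ measurable_const)
      exact (measurable_of_countable fun i => dist (q i) (q j)).comp hkm
    refine ⟨⟨fun x => Nat.find (hp x), measurable_find hp hpm, fun x hx =>
      (Nat.find_spec (hp x)).1 hx⟩, fun x => (Nat.find_spec (hp x)).2⟩
  choose nxt hnxt using step
  let K : ∀ n, {k : X → ℕ // G n k} := fun n =>
    Nat.rec ⟨k₀, hk₀, fun x hx => by simpa [ρ] using! hk x hx⟩ (fun n k => nxt n k) n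
  have hd : ∀ x n, dist (q ((K n).1 x)) (q ((K (n + 1)).1 x)) ≤ 2 * c * (1 / 2) ^ n :=
    fun x n => hnxt n (K n) x
  have hcau : ∀ x, CauchySeq fun n => q ((K n).1 x) := fun x =>
    cauchySeq_of_le_geometric (1 / 2) (2 * c) (by norm_num) (hd x)
  choose y hy using fun x => cauchySeq_tendsto_of_complete (hcau x)
  refine ⟨y, measurable_of_tendsto_metrizable
    (fun n => (measurable_of_countable q).comp (K n).2.1) (tendsto_pi_nhds.2 hy), fun x hx => ⟨?_, ?_⟩⟩
  · have hz : ∀ n, ∃ z ∈ V x, dist z (q ((K n).1 x)) ≤ ρ n := fun n => by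
      obtain ⟨z, hz, hz'⟩ := (K n).2.2 x hx
      exact ⟨z, hz, hz'⟩
    choose z hzV hzd using hz
    have hρ0 : Tendsto ρ atTop (𝓝 0) := by
      simpa [ρ] using (tendsto_pow_atTop_nhds_zero_of_lt_one (by norm_num : (0:ℝ) ≤ 1 / 2)
        (by norm_num)).const_mul c
    have : Tendsto z atTop (𝓝 (y x)) := by
      refine (tendsto_iff_of_dist ?_).2 (hy x)
      exact squeeze_zero (fun _ => dist_nonneg) hzd hρ0
    exact (hV x).mem_of_tendsto this (Eventually.of_forall hzV)
  · have := dist_le_of_le_geometric_of_tendsto₀ (1 / 2) (2 * c) (by norm_num) (hd x) (hy x)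
    calc _ ≤ _ := this
      _ = 4 * c := by ring

lemma exists_dense_measurable_selectors {V : X → Set E} (hV : ∀ x, IsClosed (V x))
    (hm : ∀ (q : E) (r : ℝ), 0 < r →
      MeasurableSet {x | (V x ∩ Metric.closedBall q r).Nonempty}) :
    ∃ y : ℕ → X → E, (∀ j, Measurable (y j)) ∧ ∀ x, (V x).Nonempty →
      (∀ j, y j x ∈ V x) ∧ ∀ z ∈ V x, ∀ ε > 0, ∃ j, dist z (y j x) < ε := by
  classical
  let q := TopologicalSpace.denseSeq E
  have hqd := exists_dist_denseSeq_lt (E := E)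
  have hne := measurableSet_setOf_nonempty hm
  have main : ∀ (k n : ℕ), ∃ y : X → E, Measurable y ∧ ∀ x, (V x).Nonempty → y x ∈ V x ∧
      ((V x ∩ Metric.closedBall (q k) ((1 / 2) ^ n)).Nonempty → dist (q k) (y x) ≤ 4 * (1 / 2) ^ n) := by
    intro k n
    have hc : (0 : ℝ) < (1 / 2) ^ n := by positivity
    let p : X → ℕ → Prop := fun x j =>
      ((V x).Nonempty → (V x ∩ Metric.closedBall (q j) ((1 / 2) ^ n)).Nonempty)
    have hp : ∀ x, ∃ j, p x j := by
      intro x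
      by_cases hx : (V x).Nonempty
      · obtain ⟨z, hz⟩ := hx
        obtain ⟨j, hj⟩ := hqd z _ hc
        exact ⟨j, fun _ => ⟨z, hz, hj.le⟩⟩
      · exact ⟨0, fun h => absurd h hx⟩
    have hpm : ∀ j, MeasurableSet {x | p x j} := fun j => by
      have e : {x | p x j} = ({x | (V x).Nonempty}ᶜ ∪
          {x | (V x ∩ Metric.closedBall (q j) ((1 / 2) ^ n)).Nonempty}) := by
        ext x
        simp only [p, mem_ofPred_eq, mem_union, mem_compl_iff, imp_iff_not_or]
      rw [e]
      exact hne.compl.union (hm _ _ hc)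
    let A : Set X := {x | (V x ∩ Metric.closedBall (q k) ((1 / 2) ^ n)).Nonempty}
    let k₀ : X → ℕ := fun x => if x ∈ A then k else Nat.find (hp x)
    have hk₀ : Measurable k₀ := Measurable.ite (hm _ _ hc) measurable_const (measurable_find hp hpm)
    obtain ⟨y, hy, hyV⟩ := exists_measurable_selector_near hV hm hc hk₀ (fun x hx => by
      by_cases hA : x ∈ A
      · simpa only [k₀, if_pos hA] using! hA
      · simpa only [k₀, if_neg hA] using! Nat.find_spec (hp x) hx)
    refine ⟨y, hy, fun x hx => ⟨(hyV x hx).1, fun hA => ?_⟩⟩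
    have := (hyV x hx).2
    rwa [show k₀ x = k from if_pos hA] at this
  choose y hy hyV using main
  refine ⟨fun j => y (Nat.unpair j).1 (Nat.unpair j).2, fun j => hy _ _, fun x hx =>
    ⟨fun j => (hyV _ _ x hx).1, fun z hz ε hε => ?_⟩⟩
  obtain ⟨n, hn⟩ := exists_pow_lt_of_lt_one (show 0 < ε / 5 by positivity)
    (by norm_num : (1 / 2 : ℝ) < 1)
  obtain ⟨k, hk⟩ := hqd z ((1 / 2) ^ n) (by positivity)
  refine ⟨Nat.pair k n, ?_⟩
  simp only [Nat.unpair_pair]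
  have h1 := (hyV k n x hx).2 ⟨z, hz, hk.le⟩
  have h2 := dist_triangle z (q k) (y k n x)
  linarith

end Selectors

/-! ### Measurability of parametrised integrals -/

section Param

variable {Z X W : Type*} [MeasurableSpace Z] [MeasurableSpace X] [MeasurableSpace W]

/-- A measurable family of probability measures as a Markov kernel. -/
def pmKernel {ν : Z → ProbabilityMeasure W} (hν : Measurable ν) : Kernel Z W :=
  ⟨fun z => (ν z : Measure W), measurable_probabilityMeasure_iff.1 hν⟩

instance {ν : Z → ProbabilityMeasure W} (hν : Measurable ν) : IsMarkovKernel (pmKernel hν) :=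
  ⟨fun z => by change IsProbabilityMeasure (ν z : Measure W); infer_instance⟩

lemma measurable_integral_param {ν : Z → ProbabilityMeasure W} (hν : Measurable ν) {g : Z → X}
    (hg : Measurable g) {f : X × W → ℝ} (hf : Measurable f) :
    Measurable fun z => ∫ w, f (g z, w) ∂(ν z : Measure W) :=
  ((hf.comp ((hg.comp measurable_fst).prodMk measurable_snd)).stronglyMeasurable.integral_kernel_prod_right'
    (κ := pmKernel hν)).measurable

lemma measurable_lintegral_param {ν : Z → ProbabilityMeasure W} (hν : Measurable ν) {g : Z → X}
    (hg : Measurable g) {f : X × W → ℝ≥0∞} (hf : Measurable f) :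
    Measurable fun z => ∫⁻ w, f (g z, w) ∂(ν z : Measure W) :=
  (hf.comp ((hg.comp measurable_fst).prodMk measurable_snd)).lintegral_kernel_prod_right'
    (κ := pmKernel hν)

lemma measurableSet_integrable_param {ν : Z → ProbabilityMeasure W} (hν : Measurable ν) {g : Z → X}
    (hg : Measurable g) {f : X × W → ℝ} (hf : Measurable f) :
    MeasurableSet {z | Integrable (fun w => f (g z, w)) (ν z : Measure W)} :=
  measurableSet_kernel_integrable (κ := pmKernel hν) (f := fun z w => f (g z, w))
    (hf.comp ((hg.comp measurable_fst).prodMk measurable_snd)).stronglyMeasurable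

lemma measurableSet_absolutelyContinuous_param [MeasurableSpace.CountablyGenerated W]
    {ν ν' : Z → ProbabilityMeasure W}
    (hν : Measurable ν) (hν' : Measurable ν') :
    MeasurableSet {z | (ν z : Measure W) ≪ (ν' z : Measure W)} :=
  Kernel.measurableSet_absolutelyContinuous (pmKernel hν) (pmKernel hν')

lemma measurable_mean_param {d : ℕ} {ν : Z → ProbabilityMeasure W} (hν : Measurable ν) {g : Z → X}
    (hg : Measurable g) {D : X × W → Fin d → ℝ} (hD : Measurable D) :
    Measurable fun z => mean (fun w => D (g z, w)) (ν z : Measure W) :=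
  measurable_pi_lambda _ fun i => measurable_integral_param hν hg
    (f := fun p => D p i) ((measurable_pi_apply i).comp hD)

lemma measurableSet_forall_integrable_param {d : ℕ} {ν : Z → ProbabilityMeasure W}
    (hν : Measurable ν) {g : Z → X} (hg : Measurable g) {D : X × W → Fin d → ℝ}
    (hD : Measurable D) :
    MeasurableSet {z | ∀ i, Integrable (fun w => D (g z, w) i) (ν z : Measure W)} := by
  have : {z | ∀ i, Integrable (fun w => D (g z, w) i) (ν z : Measure W)} =
      ⋂ i, {z | Integrable (fun w => D (g z, w) i) (ν z : Measure W)} := by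
    ext; simp
  rw [this]
  exact MeasurableSet.iInter fun i => measurableSet_integrable_param hν hg
    (f := fun p => D p i) ((measurable_pi_apply i).comp hD)

lemma measurable_dotProduct_comp {d : ℕ} {f g : Z → Fin d → ℝ} (hf : Measurable f)
    (hg : Measurable g) : Measurable fun z => f z ⬝ᵥ g z :=
  Finset.measurable_sum _ fun i _ =>
    ((measurable_pi_apply i).comp hf).mul ((measurable_pi_apply i).comp hg)

end Param

/-! ### Measurable selection of one-period hedges -/

section Hedges

variable {X W : Type*} [MeasurableSpace X] [MeasurableSpace W] [StandardBorelSpace X]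
  [StandardBorelSpace W] {d : ℕ}

/-- The measures in the section of a graph of probability measures. -/
def sectionM (C : Set (X × ProbabilityMeasure W)) (x : X) : Set (Measure W) :=
  {R | ∃ ν : ProbabilityMeasure W, (x, ν) ∈ C ∧ R = ν}

lemma exists_dense_hedges {C : Set (X × ProbabilityMeasure W)} (hC : Suslin C)
    (hCs : ∀ x, Solid (sectionM C x)) {D : X × W → Fin d → ℝ} (hD : Measurable D)
    {F : X × W → ℝ} (hF : Measurable F) {a : X → ℝ} (ha : Measurable[univComp X] a) :
    ∃ y : ℕ → X → Fin d → ℝ, (∀ j, Measurable[univComp X] (y j)) ∧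
      ∀ x, ∀ y₀ : Fin d → ℝ,
        (∀ R ∈ sectionM C x, ∀ᵐ w ∂ R, F (x, w) ≤ a x + y₀ ⬝ᵥ D (x, w)) →
        (∀ j, ∀ R ∈ sectionM C x, ∀ᵐ w ∂ R, F (x, w) ≤ a x + y j x ⬝ᵥ D (x, w)) ∧
          ∀ ε > 0, ∃ j, dist y₀ (y j x) < ε := by
  let V : X → Set (Fin d → ℝ) := fun x =>
    {y | ∀ R ∈ sectionM C x, ∀ᵐ w ∂ R, F (x, w) ≤ a x + y ⬝ᵥ D (x, w)}
  have hV : ∀ x, IsClosed (V x) := fun x => isClosed_hedge _ _ _ _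
  have hm : ∀ (q : Fin d → ℝ) (r : ℝ), 0 < r →
      MeasurableSet[univComp X] {x | (V x ∩ Metric.closedBall q r).Nonempty} := by
    intro q r hr
    let A : Set ((X × ℝ) × ProbabilityMeasure W) := {p | (p.1.1, p.2) ∈ C ∧
      (∀ i, Integrable (fun w => D (p.1.1, w) i) (p.2 : Measure W)) ∧
      Integrable (fun w => F (p.1.1, w)) (p.2 : Measure W) ∧
      q ⬝ᵥ mean (fun w => D (p.1.1, w)) (p.2 : Measure W) +
        r * ∑ i, |mean (fun w => D (p.1.1, w)) (p.2 : Measure W) i| <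
        ∫ w, F (p.1.1, w) ∂(p.2 : Measure W) - p.1.2}
    have h1 : Measurable fun p : (X × ℝ) × ProbabilityMeasure W => p.1.1 := by fun_prop
    have h2 : Measurable fun p : (X × ℝ) × ProbabilityMeasure W => p.2 := by fun_prop
    have h3 := measurable_mean_param h2 h1 hD
    have hA : Suslin A := by
      have h4 : Measurable fun p : (X × ℝ) × ProbabilityMeasure W =>
          q ⬝ᵥ mean (fun w => D (p.1.1, w)) (p.2 : Measure W) +
            r * ∑ i, |mean (fun w => D (p.1.1, w)) (p.2 : Measure W) i| :=
        (measurable_dotProduct_comp measurable_const h3).add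
          (Measurable.const_mul (Finset.measurable_sum _ fun i _ =>
            measurable_norm.comp ((measurable_pi_apply i).comp h3)) r)
      have h5 : Measurable fun p : (X × ℝ) × ProbabilityMeasure W =>
          ∫ w, F (p.1.1, w) ∂(p.2 : Measure W) - p.1.2 :=
        (measurable_integral_param h2 h1 hF).sub (measurable_snd.comp measurable_fst)
      exact (hC.preimage (h1.prodMk h2)).inter (MeasurableSet.suslin
        ((measurableSet_forall_integrable_param h2 h1 hD).inter
          ((measurableSet_integrable_param h2 h1 hF).inter (measurableSet_lt h4 h5))))
    have hE : {x | (V x ∩ Metric.closedBall q r).Nonempty} =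
        ((fun x => (x, a x)) ⁻¹' {z | ∃ ν, (z, ν) ∈ A})ᶜ := by
      ext x
      have key := (hCs x).exists_mem_closedBall_hedge_iff (D := fun w => D (x, w))
        (F := fun w => F (x, w)) (hD.comp measurable_prodMk_left) (hF.comp measurable_prodMk_left)
        (a x) q hr
      have e : (V x ∩ Metric.closedBall q r).Nonempty ↔ ∃ y ∈ Metric.closedBall q r,
          ∀ R ∈ sectionM C x, ∀ᵐ w ∂ R, F (x, w) ≤ a x + y ⬝ᵥ D (x, w) :=
        ⟨fun ⟨y, h, h'⟩ => ⟨y, h', h⟩, fun ⟨y, h, h'⟩ => ⟨y, h', h⟩⟩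
      change _ ↔ ¬ _
      refine e.trans (key.trans ?_)
      constructor
      · rintro h ⟨ν, hν, i1, i2, hlt⟩
        exact absurd (h _ ⟨ν, hν, rfl⟩ i1 i2) (not_le.2 hlt)
      · rintro h _ ⟨ν, hν, rfl⟩ i1 i2
        by_contra hlt
        exact h ⟨ν, hν, i1, i2, not_le.1 hlt⟩
    rw [hE]
    exact MeasurableSet.compl (measurableSet_preimage_univ (measurable_id_prodMk_univ ha)
      hA.exists_mem.univ)
  obtain ⟨y, hy, hyV⟩ := exists_dense_measurable_selectors (m := univComp X) hV hm
  exact ⟨y, hy, fun x y₀ hy₀ => ⟨(hyV x ⟨y₀, hy₀⟩).1, (hyV x ⟨y₀, hy₀⟩).2 y₀ hy₀⟩⟩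

end Hedges

/-! ### Equivalent martingale kernels with integrability -/

section Reweight

variable {X Y : Type*} [MeasurableSpace X] [MeasurableSpace Y] [StandardBorelSpace X]
  [StandardBorelSpace Y] {d : ℕ}

lemma solid_dominated {Y : Type*} [MeasurableSpace Y] (Q : Measure Y) [IsProbabilityMeasure Q] :
    Solid {R : Measure Y | IsProbabilityMeasure R ∧ R ≪ Q} :=
  ⟨fun _ h => h.1, fun _ h _ h' => ⟨Q, ⟨inferInstance, Measure.AbsolutelyContinuous.rfl⟩, h.2, h'.2⟩,
    fun _ h _ hp hR => ⟨hp, hR.trans h.2⟩⟩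

lemma exists_equiv_mart {Y : Type*} [MeasurableSpace Y] {Q : Measure Y} [IsProbabilityMeasure Q]
    {D : Y → Fin d → ℝ} (hD : Measurable D) {F : Y → ℝ} (hF : Measurable F) {W : Y → ℝ≥0}
    (hW : Measurable W) (hDi : ∀ i, Integrable (fun y => D y i) Q) (hD0 : mean D Q = 0)
    (hFi : Integrable F Q) {v : ℝ} (hv : v < ∫ y, F y ∂Q) :
    ∃ Q' : Measure Y, IsProbabilityMeasure Q' ∧ Q ≪ Q' ∧ Q' ≪ Q ∧ ∫⁻ y, W y ∂Q' < ⊤ ∧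
      (∀ i, Integrable (fun y => D y i) Q') ∧ Integrable F Q' ∧ mean D Q' = 0 ∧
      v < ∫ y, F y ∂Q' := by
  have hNA : NAStep {R : Measure Y | IsProbabilityMeasure R ∧ R ≪ Q} D := by
    intro y hy R hR
    have h1 := hy Q ⟨inferInstance, Measure.AbsolutelyContinuous.rfl⟩
    have h2 : ∫ z, y ⬝ᵥ D z ∂Q = 0 := by rw [dotProduct_mean hDi, hD0, dotProduct_zero]
    exact hR.2.ae_le ((integral_eq_zero_iff_of_nonneg_ae h1 (integrable_dotProduct hDi y)).1 h2)
  rcases (solid_dominated Q).exists_mart_or_exists_hedge hD hF hW hNA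
    ⟨inferInstance, Measure.AbsolutelyContinuous.rfl⟩ v with h | ⟨y, hy⟩
  · obtain ⟨Q', ⟨h1, h2⟩, h3, h4, h5, h6, h7, h8⟩ := h
    exact ⟨Q', h1, h3, h2, h4, h5, h6, h7, h8⟩
  · exfalso
    have h1 := hy Q ⟨inferInstance, Measure.AbsolutelyContinuous.rfl⟩
    have h2 := integral_mono_ae hFi ((integrable_const v).add (integrable_dotProduct hDi y)) h1
    rw [integral_add' (integrable_const v) (integrable_dotProduct hDi y), dotProduct_mean hDi, hD0,
      dotProduct_zero, integral_const] at h2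
    simp only [probReal_univ, one_smul, add_zero] at h2
    linarith

lemma exists_equiv_mart_kernel [Nonempty Y] {μ : Measure X} [IsProbabilityMeasure μ]
    (Q : Kernel X Y) [IsMarkovKernel Q] {D : X × Y → Fin d → ℝ} (hD : Measurable D)
    {F : X × Y → ℝ} (hF : Measurable F) {W : X × Y → ℝ≥0} (hW : Measurable W)
    {v : X → ℝ} (hv : Measurable v)
    (h : ∀ᵐ x ∂μ, (∀ i, Integrable (fun y => D (x, y) i) (Q x)) ∧
      mean (fun y => D (x, y)) (Q x) = 0 ∧ Integrable (fun y => F (x, y)) (Q x) ∧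
      v x < ∫ y, F (x, y) ∂Q x) :
    ∃ Q' : Kernel X Y, IsMarkovKernel Q' ∧ ∀ᵐ x ∂μ, Q x ≪ Q' x ∧ Q' x ≪ Q x ∧
      ∫⁻ y, W (x, y) ∂Q' x < ⊤ ∧ (∀ i, Integrable (fun y => D (x, y) i) (Q' x)) ∧
      Integrable (fun y => F (x, y)) (Q' x) ∧ mean (fun y => D (x, y)) (Q' x) = 0 ∧
      v x < ∫ y, F (x, y) ∂Q' x := by
  let A : Set (X × ProbabilityMeasure Y) := {p |
      (kernelPM Q p.1 : Measure Y) ≪ (p.2 : Measure Y) ∧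
      (p.2 : Measure Y) ≪ (kernelPM Q p.1 : Measure Y) ∧
      ∫⁻ y, W (p.1, y) ∂(p.2 : Measure Y) < ⊤ ∧
      (∀ i, Integrable (fun y => D (p.1, y) i) (p.2 : Measure Y)) ∧
      Integrable (fun y => F (p.1, y)) (p.2 : Measure Y) ∧
      mean (fun y => D (p.1, y)) (p.2 : Measure Y) = 0 ∧
      v p.1 < ∫ y, F (p.1, y) ∂(p.2 : Measure Y)}
  have hA : MeasurableSet A := by
    have h1 : Measurable fun p : X × ProbabilityMeasure Y => p.1 := measurable_fst
    have h2 : Measurable fun p : X × ProbabilityMeasure Y => p.2 := measurable_snd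
    have h3 := (measurable_kernelPM Q).comp h1
    refine (measurableSet_absolutelyContinuous_param h3 h2).inter
      ((measurableSet_absolutelyContinuous_param h2 h3).inter
      ((measurableSet_lt (measurable_lintegral_param h2 h1 hW.coe_nnreal_ennreal)
        measurable_const).inter ((measurableSet_forall_integrable_param h2 h1 hD).inter
      ((measurableSet_integrable_param h2 h1 hF).inter
      (((measurable_mean_param h2 h1 hD) (measurableSet_singleton 0)).inter
      (measurableSet_lt (hv.comp h1) (measurable_integral_param h2 h1 hF)))))))
  have : Nonempty (ProbabilityMeasure Y) := ⟨⟨Measure.dirac (Classical.arbitrary Y), inferInstance⟩⟩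
  obtain ⟨s, hs, hsA⟩ := hA.suslin.exists_selector
  obtain ⟨Q', hQ', hQ's⟩ := exists_kernel_ae_eq hs μ
  refine ⟨Q', hQ', ?_⟩
  filter_upwards [h, hQ's] with x ⟨i1, i2, i3, i4⟩ hx
  obtain ⟨R, hRp, hR⟩ := exists_equiv_mart (D := fun y => D (x, y)) (F := fun y => F (x, y))
    (W := fun y => W (x, y)) (hD.comp measurable_prodMk_left) (hF.comp measurable_prodMk_left)
    (hW.comp measurable_prodMk_left) i1 i2 i3 i4
  rw [hx]
  exact hsA x ⟨R, hRp⟩ hR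

end Reweight

/-! ### One period with a Suslin set of claims -/

section ClaimStep

variable {X Y : Type*} [MeasurableSpace X] [MeasurableSpace Y] {d : ℕ}

/-- Joint laws of the next state and of an attainable claim value. -/
def claimGraph (Gr : Set (X × ProbabilityMeasure Y)) (Γ : Set ((X × Y) × ℝ)) :
    Set (X × ProbabilityMeasure (Y × ℝ)) :=
  {p | (∀ᵐ z ∂(p.2 : Measure (Y × ℝ)), ((p.1, z.1), z.2) ∈ Γ) ∧
    ∃ P : ProbabilityMeasure Y, (p.1, P) ∈ Gr ∧
      (p.2 : Measure (Y × ℝ)).map Prod.fst ≪ (P : Measure Y)}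

/-- The first marginal of a probability measure. -/
def pmFst (ν : ProbabilityMeasure (Y × ℝ)) : ProbabilityMeasure Y :=
  ν.map measurable_fst.aemeasurable

lemma coe_pmFst (ν : ProbabilityMeasure (Y × ℝ)) :
    (pmFst ν : Measure Y) = (ν : Measure (Y × ℝ)).map Prod.fst := rfl

lemma measurable_pmFst : Measurable (pmFst (Y := Y)) :=
  measurable_probabilityMeasure_iff.2 ((Measure.measurable_map _ measurable_fst).comp
    measurable_coe_probabilityMeasure)

/-- The values whose strict superreplication is excluded by a martingale law. -/
def prevClaim (Gr : Set (X × ProbabilityMeasure Y)) (Γ : Set ((X × Y) × ℝ))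
    (D : X × Y → Fin d → ℝ) : Set (X × ℝ) :=
  {p | ∃ ν : ProbabilityMeasure (Y × ℝ), (p.1, ν) ∈ claimGraph Gr Γ ∧
    (∀ i, Integrable (fun z : Y × ℝ => D (p.1, z.1) i) (ν : Measure (Y × ℝ))) ∧
    Integrable (fun z : Y × ℝ => z.2) (ν : Measure (Y × ℝ)) ∧
    mean (fun z : Y × ℝ => D (p.1, z.1)) (ν : Measure (Y × ℝ)) = 0 ∧
    p.2 < ∫ z : Y × ℝ, z.2 ∂(ν : Measure (Y × ℝ))}

/-- The one-period no-arbitrage condition at a state. -/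
def NAAt (Gr : Set (X × ProbabilityMeasure Y)) (Γ : Set ((X × Y) × ℝ))
    (D : X × Y → Fin d → ℝ) (x : X) : Prop :=
  NAStep (sectionM (claimGraph Gr Γ) x) fun z : Y × ℝ => D (x, z.1)

variable {Gr : Set (X × ProbabilityMeasure Y)} {Γ : Set ((X × Y) × ℝ)} {D : X × Y → Fin d → ℝ}

lemma prevClaim_mono {x : X} {c c' : ℝ} (h : (x, c) ∈ prevClaim Gr Γ D) (hc : c' ≤ c) :
    (x, c') ∈ prevClaim Gr Γ D := by
  obtain ⟨ν, h1, h2, h3, h4, h5⟩ := h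
  exact ⟨ν, h1, h2, h3, h4, hc.trans_lt h5⟩

lemma solid_claimGraph (hconv : ∀ x, ConvexPM {P | (x, P) ∈ Gr}) (x : X) :
    Solid (sectionM (claimGraph Gr Γ) x) := by
  refine ⟨?_, ?_, ?_⟩
  · rintro _ ⟨ν, -, rfl⟩
    infer_instance
  · rintro _ ⟨ν, ⟨h1, P, hP, hνP⟩, rfl⟩ _ ⟨ν', ⟨h1', P', hP', hνP'⟩, rfl⟩
    have hab : (2⁻¹ : ℝ≥0∞) + 2⁻¹ = 1 := ENNReal.inv_two_add_inv_two
    have i1 := isProbabilityMeasure_mix (R := (ν : Measure (Y × ℝ))) (R' := (ν' : Measure (Y × ℝ)))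
      hab
    have i2 := isProbabilityMeasure_mix (R := (P : Measure Y)) (R' := (P' : Measure Y)) hab
    refine ⟨_, ⟨⟨_, i1⟩, ⟨?_, ⟨_, i2⟩, hconv x P hP P' hP' _ _ hab _ rfl, ?_⟩, rfl⟩, ?_, ?_⟩
    · change ∀ᵐ z ∂((2⁻¹ : ℝ≥0∞) • (ν : Measure (Y × ℝ)) + (2⁻¹ : ℝ≥0∞) • (ν' : Measure (Y × ℝ))), _
      rw [ae_add_measure_iff]
      exact ⟨Measure.ae_smul_measure h1 _, Measure.ae_smul_measure h1' _⟩
    · change ((2⁻¹ : ℝ≥0∞) • (ν : Measure (Y × ℝ)) + (2⁻¹ : ℝ≥0∞) • (ν' : Measure (Y × ℝ))).map _ ≪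
        (2⁻¹ : ℝ≥0∞) • (P : Measure Y) + (2⁻¹ : ℝ≥0∞) • (P' : Measure Y)
      rw [Measure.map_add _ _ measurable_fst, Measure.map_smul, Measure.map_smul]
      refine Measure.AbsolutelyContinuous.mk fun s _ hs => ?_
      simp only [Measure.coe_add, Measure.coe_smul, Pi.add_apply, Pi.smul_apply, smul_eq_mul,
        add_eq_zero, mul_eq_zero, ENNReal.inv_eq_zero, ENNReal.ofNat_ne_top, false_or] at hs ⊢
      exact ⟨hνP hs.1, hνP' hs.2⟩
    · change _ ≪ (2⁻¹ : ℝ≥0∞) • (ν : Measure (Y × ℝ)) + (2⁻¹ : ℝ≥0∞) • (ν' : Measure (Y × ℝ))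
      refine Measure.AbsolutelyContinuous.mk fun s _ hs => ?_
      simp only [Measure.coe_add, Measure.coe_smul, Pi.add_apply, Pi.smul_apply, smul_eq_mul,
        add_eq_zero, mul_eq_zero, ENNReal.inv_eq_zero, ENNReal.ofNat_ne_top, false_or] at hs ⊢
      exact hs.1
    · change _ ≪ (2⁻¹ : ℝ≥0∞) • (ν : Measure (Y × ℝ)) + (2⁻¹ : ℝ≥0∞) • (ν' : Measure (Y × ℝ))
      refine Measure.AbsolutelyContinuous.mk fun s _ hs => ?_
      simp only [Measure.coe_add, Measure.coe_smul, Pi.add_apply, Pi.smul_apply, smul_eq_mul,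
        add_eq_zero, mul_eq_zero, ENNReal.inv_eq_zero, ENNReal.ofNat_ne_top, false_or] at hs ⊢
      exact hs.2
  · rintro _ ⟨ν, ⟨h1, P, hP, hνP⟩, rfl⟩ R' hp hR'
    exact ⟨⟨R', hp⟩, ⟨hR'.ae_le h1, P, hP, (hR'.map measurable_fst).trans hνP⟩, rfl⟩

variable [StandardBorelSpace X] [StandardBorelSpace Y]

lemma suslin_setOf_ae_claim (hΓ : Suslin Γ) : Suslin {p : X × ProbabilityMeasure (Y × ℝ) |
    ∀ᵐ z ∂(p.2 : Measure (Y × ℝ)), ((p.1, z.1), z.2) ∈ Γ} :=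
  Suslin.setOf_ae_section (A := {q : X × (Y × ℝ) | ((q.1, q.2.1), q.2.2) ∈ Γ})
    (hΓ.preimage (f := fun q : X × (Y × ℝ) => ((q.1, q.2.1), q.2.2)) (by fun_prop))

lemma suslin_claimGraph (hGr : Suslin Gr) (hΓ : Suslin Γ) : Suslin (claimGraph Gr Γ) := by
  refine (suslin_setOf_ae_claim hΓ).inter (Suslin.exists_mem (V := ProbabilityMeasure Y)
    (A := {q : (X × ProbabilityMeasure (Y × ℝ)) × ProbabilityMeasure Y |
      (q.1.1, q.2) ∈ Gr ∧ (pmFst q.1.2 : Measure Y) ≪ (q.2 : Measure Y)}) ?_)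
  have h1 : Measurable fun q : (X × ProbabilityMeasure (Y × ℝ)) × ProbabilityMeasure Y =>
    (q.1.1, q.2) := by fun_prop
  exact (hGr.preimage h1).inter (measurableSet_absolutelyContinuous_param
    (measurable_pmFst.comp (measurable_snd.comp measurable_fst)) measurable_snd).suslin

lemma suslin_prevClaim (hGr : Suslin Gr) (hΓ : Suslin Γ) (hD : Measurable D) :
    Suslin (prevClaim Gr Γ D) := by
  refine Suslin.exists_mem (V := ProbabilityMeasure (Y × ℝ))
    (A := {q : (X × ℝ) × ProbabilityMeasure (Y × ℝ) | (q.1.1, q.2) ∈ claimGraph Gr Γ ∧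
      (∀ i, Integrable (fun z : Y × ℝ => D (q.1.1, z.1) i) (q.2 : Measure (Y × ℝ))) ∧
      Integrable (fun z : Y × ℝ => z.2) (q.2 : Measure (Y × ℝ)) ∧
      mean (fun z : Y × ℝ => D (q.1.1, z.1)) (q.2 : Measure (Y × ℝ)) = 0 ∧
      q.1.2 < ∫ z : Y × ℝ, z.2 ∂(q.2 : Measure (Y × ℝ))}) ?_
  have h1 : Measurable fun q : (X × ℝ) × ProbabilityMeasure (Y × ℝ) => q.1.1 := by fun_prop
  have h2 : Measurable fun q : (X × ℝ) × ProbabilityMeasure (Y × ℝ) => q.2 := by fun_prop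
  have hD' : Measurable fun p : X × (Y × ℝ) => D (p.1, p.2.1) := hD.comp (by fun_prop)
  have hF' : Measurable fun p : X × (Y × ℝ) => p.2.2 := by fun_prop
  exact ((suslin_claimGraph hGr hΓ).preimage (h1.prodMk h2)).inter
    ((measurableSet_forall_integrable_param h2 h1 hD').inter
      ((measurableSet_integrable_param h2 h1 hF').inter
        ((measurable_mean_param h2 h1 hD' (measurableSet_singleton 0)).inter
          (measurableSet_lt (measurable_snd.comp measurable_fst)
            (measurable_integral_param h2 h1 hF'))))).suslin

lemma exists_claimGraph_of_proj {A : Set (Y × ℝ)} (hA : Suslin A)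
    {R : Measure Y} [IsProbabilityMeasure R] (hR : ∀ᵐ y ∂ R, ∃ c, (y, c) ∈ A) :
    ∃ ν : ProbabilityMeasure (Y × ℝ), (∀ᵐ z ∂(ν : Measure (Y × ℝ)), z ∈ A) ∧
      (ν : Measure (Y × ℝ)).map Prod.fst = R := by
  obtain ⟨s, hs, hsA⟩ := hA.exists_selector
  have hae := aemeasurable_of_univ hs R
  have hf : Measurable fun y => (y, hae.mk s y) := measurable_id.prodMk hae.measurable_mk
  have hp : IsProbabilityMeasure (R.map fun y => (y, hae.mk s y)) :=
    Measure.isProbabilityMeasure_map hf.aemeasurable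
  refine ⟨⟨_, hp⟩, ?_, ?_⟩
  · refine (ae_map_iff_of_null hf.aemeasurable (hA.nullMeasurableSet _)).2 ?_
    filter_upwards [hR, hae.ae_eq_mk] with y ⟨c, hc⟩ hy
    rw [← hy]
    exact hsA y c hc
  · change (R.map fun y => (y, hae.mk s y)).map Prod.fst = R
    rw [Measure.map_map measurable_fst hf]
    exact Measure.map_id

lemma suslin_claim_section (hΓ : Suslin Γ) (x : X) : Suslin {z : Y × ℝ | ((x, z.1), z.2) ∈ Γ} :=
  hΓ.preimage (f := fun z : Y × ℝ => ((x, z.1), z.2)) (by fun_prop)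

lemma exists_mem_sectionM_of_proj (hΓ : Suslin Γ) {x : X} {P : ProbabilityMeasure Y}
    (hP : (x, P) ∈ Gr) (h : ∀ᵐ y ∂(P : Measure Y), ∃ c, ((x, y), c) ∈ Γ) :
    ∃ R ∈ sectionM (claimGraph Gr Γ) x, R.map Prod.fst = (P : Measure Y) := by
  obtain ⟨ν, hν, hνP⟩ := exists_claimGraph_of_proj (suslin_claim_section hΓ x) h
  exact ⟨_, ⟨ν, ⟨hν, P, hP, hνP ▸ Measure.AbsolutelyContinuous.rfl⟩, rfl⟩, hνP⟩

lemma measurable_dotProduct_section (hD : Measurable D) (x : X) (y : Fin d → ℝ) :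
    Measurable fun z : Y => y ⬝ᵥ D (x, z) :=
  measurable_dotProduct_comp measurable_const (hD.comp measurable_prodMk_left)

/-- Countably many test portfolios detect the failure of the no-arbitrage condition. -/
lemma exists_test_portfolios (hGr : Suslin Gr) (hne : ∀ x, ∃ P, (x, P) ∈ Gr)
    (hconv : ∀ x, ConvexPM {P | (x, P) ∈ Gr}) (hΓ : Suslin Γ) (hD : Measurable D) :
    ∃ (y : ℕ → X → Fin d → ℝ) (P' : ℕ → X → ProbabilityMeasure Y),
      (∀ j, Measurable[univComp X] (y j)) ∧ (∀ j, Measurable[univComp X] (P' j)) ∧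
      (∀ j x, (x, P' j x) ∈ Gr) ∧
      (∀ j x P, (x, P) ∈ Gr → (∀ᵐ z ∂(P : Measure Y), ∃ c, ((x, z), c) ∈ Γ) →
        ∀ᵐ z ∂(P : Measure Y), 0 ≤ y j x ⬝ᵥ D (x, z)) ∧
      ∀ x, (∀ j, ∀ᵐ z ∂(P' j x : Measure Y), y j x ⬝ᵥ D (x, z) = 0) → NAAt Gr Γ D x := by
  have hD' : Measurable fun p : X × (Y × ℝ) => D (p.1, p.2.1) := hD.comp (by fun_prop)
  obtain ⟨y, hy, hyV⟩ := exists_dense_hedges (suslin_claimGraph hGr hΓ)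
    (fun x => solid_claimGraph hconv x) hD' (F := fun _ => 0) measurable_const
    (a := fun _ => 0) measurable_const
  have hy0 : ∀ x j, ∀ R ∈ sectionM (claimGraph Gr Γ) x, ∀ᵐ w ∂ R, 0 ≤ y j x ⬝ᵥ D (x, w.1) := by
    intro x j R hR
    simpa using (hyV x 0 (fun R hR => by simp)).1 j R hR
  rcases isEmpty_or_nonempty X with hX | ⟨⟨x₀⟩⟩
  · exact ⟨y, fun _ x => isEmptyElim x, hy, fun j s hs => by
      rw [Set.eq_empty_of_isEmpty (_ ⁻¹' s)]; exact @MeasurableSet.empty _ (univComp X), fun _ x => isEmptyElim x, fun _ x => isEmptyElim x,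
      fun x => isEmptyElim x⟩
  have hPne : Nonempty (ProbabilityMeasure Y) := ⟨(hne x₀).choose⟩
  have hsel : ∀ j, ∃ P' : X → ProbabilityMeasure Y, Measurable[univComp X] P' ∧
      (∀ x, (x, P' x) ∈ Gr) ∧ ∀ x, (∃ P : ProbabilityMeasure Y, (x, P) ∈ Gr ∧
        ¬ ∀ᵐ z ∂(P : Measure Y), y j x ⬝ᵥ D (x, z) = 0) →
        ¬ ∀ᵐ z ∂(P' x : Measure Y), y j x ⬝ᵥ D (x, z) = 0 := by
    intro j
    let A : Set ((X × (Fin d → ℝ)) × ProbabilityMeasure Y) := {q | (q.1.1, q.2) ∈ Gr ∧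
      ¬ ∀ᵐ z ∂(q.2 : Measure Y), q.1.2 ⬝ᵥ D (q.1.1, z) = 0}
    have hA : Suslin A := by
      have h1 : Measurable fun q : (X × (Fin d → ℝ)) × ProbabilityMeasure Y => (q.1.1, q.2) := by
        fun_prop
      refine (hGr.preimage h1).inter (MeasurableSet.suslin (MeasurableSet.compl ?_))
      have h2 : Measurable fun q : (X × (Fin d → ℝ)) × ProbabilityMeasure Y => q.2 := by fun_prop
      have h3 : Measurable fun q : (X × (Fin d → ℝ)) × ProbabilityMeasure Y => q.1 := by fun_prop
      have h4 : Measurable fun q : (X × (Fin d → ℝ)) × Y => ‖q.1.2 ⬝ᵥ D (q.1.1, q.2)‖ₑ :=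
        (measurable_dotProduct_comp (measurable_snd.comp measurable_fst)
          (hD.comp ((measurable_fst.comp measurable_fst).prodMk measurable_snd))).enorm
      have e : {q : (X × (Fin d → ℝ)) × ProbabilityMeasure Y |
          ∀ᵐ z ∂(q.2 : Measure Y), q.1.2 ⬝ᵥ D (q.1.1, z) = 0} =
          (fun q => ∫⁻ z, ‖q.1.2 ⬝ᵥ D (q.1.1, z)‖ₑ ∂(q.2 : Measure Y)) ⁻¹' {0} := by
        ext q
        change _ ↔ ∫⁻ z, ‖q.1.2 ⬝ᵥ D (q.1.1, z)‖ₑ ∂(q.2 : Measure Y) = 0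
        rw [lintegral_eq_zero_iff (measurable_dotProduct_section hD _ _).enorm]
        simp [Filter.EventuallyEq]
      change MeasurableSet {q : (X × (Fin d → ℝ)) × ProbabilityMeasure Y |
          ∀ᵐ z ∂(q.2 : Measure Y), q.1.2 ⬝ᵥ D (q.1.1, z) = 0}
      rw [e]
      exact measurable_lintegral_param h2 h3 h4 (measurableSet_singleton 0)
    obtain ⟨s, hs, hsA⟩ := hA.exists_selector_comp (hy j)
    obtain ⟨P', hP', hP'G, hP's⟩ := hGr.exists_selector_extending hne hs
    refine ⟨P', hP', hP'G, fun x ⟨P, hP, hPn⟩ => ?_⟩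
    have h1 := hsA x P ⟨hP, hPn⟩
    rw [hP's x h1.1]
    exact h1.2
  choose P' hP' hP'G hP's using hsel
  refine ⟨y, P', hy, hP', hP'G, ?_, ?_⟩
  · intro j x P hP hPΓ
    obtain ⟨R, hR, hRP⟩ := exists_mem_sectionM_of_proj hΓ hP hPΓ
    rw [← hRP, ae_map_iff measurable_fst.aemeasurable
      (measurableSet_le measurable_const (measurable_dotProduct_section hD _ _))]
    exact hy0 x j R hR
  · intro x hx y₀ hy₀ R hR
    have hzero : ∀ j, ∀ᵐ w ∂ R, y j x ⬝ᵥ D (x, w.1) = 0 := by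
      intro j
      obtain ⟨ν, ⟨-, P, hP, hνP⟩, rfl⟩ := hR
      have h1 : ∀ᵐ z ∂(P : Measure Y), y j x ⬝ᵥ D (x, z) = 0 := by
        by_contra hcon
        exact hP's j x ⟨P, hP, hcon⟩ (hx j)
      exact ae_of_ae_map measurable_fst.aemeasurable (hνP.ae_le h1)
    have hd := (hyV x y₀ (fun R hR => by simpa using hy₀ R hR)).2
    filter_upwards [ae_all_iff.2 hzero] with w hw
    choose u hu using fun n : ℕ => hd (1 / (n + 1)) (by positivity)
    have hlim : Tendsto (fun n => y (u n) x) atTop (𝓝 y₀) := by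
      rw [tendsto_iff_dist_tendsto_zero]
      refine squeeze_zero (fun _ => dist_nonneg) (fun n => ?_) tendsto_one_div_add_atTop_nhds_zero_nat
      rw [dist_comm]; exact (hu n).le
    have hc : Continuous fun v : Fin d → ℝ => v ⬝ᵥ D (x, w.1) := by
      simp only [dotProduct]; fun_prop
    have h2 := (hc.tendsto y₀).comp hlim
    refine tendsto_nhds_unique h2 ?_
    refine tendsto_const_nhds.congr fun n => (hw (u n)).symm

lemma exists_mem_prevClaim (hconv : ∀ x, ConvexPM {P | (x, P) ∈ Gr}) (hΓ : Suslin Γ)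
    (hD : Measurable D) {x : X} (hNA : NAAt Gr Γ D x) {P : ProbabilityMeasure Y}
    (hP : (x, P) ∈ Gr) (h : ∀ᵐ y ∂(P : Measure Y), ∃ c, ((x, y), c) ∈ Γ) :
    ∃ c, (x, c) ∈ prevClaim Gr Γ D := by
  obtain ⟨R, hR, -⟩ := exists_mem_sectionM_of_proj hΓ hP h
  have hD' : Measurable fun z : Y × ℝ => D (x, z.1) := hD.comp (by fun_prop)
  rcases (solid_claimGraph hconv x).exists_mart_or_exists_hedge hD' (F := fun _ => 0)
    measurable_const (W := fun z => ‖z.2‖₊) measurable_snd.nnnorm hNA hR (-1) with h | ⟨y, hy⟩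
  · obtain ⟨_, ⟨ν, hν, rfl⟩, -, h1, h2, -, h3, -⟩ := h
    have h4 : Integrable (fun z : Y × ℝ => z.2) (ν : Measure (Y × ℝ)) :=
      ⟨measurable_snd.aestronglyMeasurable, h1⟩
    exact ⟨∫ z : Y × ℝ, z.2 ∂(ν : Measure (Y × ℝ)) - 1, ν, hν, h2, h4, h3, by simp⟩
  · exfalso
    have h1 := hNA y (fun R hR => (hy R hR).mono fun z hz => by linarith) R hR
    have := (solid_claimGraph hconv x).prob R hR
    obtain ⟨z, hz, hz'⟩ := ((hy R hR).and h1).exists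
    rw [hz'] at hz
    norm_num at hz

lemma exists_hedge_step (hGr : Suslin Gr) 
    (hconv : ∀ x, ConvexPM {P | (x, P) ∈ Gr}) (hΓ : Suslin Γ) (hD : Measurable D)
    {a : X → ℝ} (ha : Measurable[univComp X] a) :
    ∃ y : X → Fin d → ℝ, Measurable[univComp X] y ∧ ∀ x, NAAt Gr Γ D x →
      (∀ c, (x, c) ∈ prevClaim Gr Γ D → c ≤ a x) → ∀ P, (x, P) ∈ Gr →
      ∀ᵐ z ∂(P : Measure Y), ∀ c, ((x, z), c) ∈ Γ → c ≤ a x + y x ⬝ᵥ D (x, z) := by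
  have hD' : Measurable fun p : X × (Y × ℝ) => D (p.1, p.2.1) := hD.comp (by fun_prop)
  have hF' : Measurable fun p : X × (Y × ℝ) => p.2.2 := by fun_prop
  obtain ⟨y, hy, hyV⟩ := exists_dense_hedges (suslin_claimGraph hGr hΓ)
    (fun x => solid_claimGraph hconv x) hD' hF' ha
  refine ⟨y 0, hy 0, fun x hNA hax P hP => ?_⟩
  have hhedge : ∀ R ∈ sectionM (claimGraph Gr Γ) x, ∀ᵐ w ∂ R, w.2 ≤ a x + y 0 x ⬝ᵥ D (x, w.1) := by
    by_cases hne : ∃ R, R ∈ sectionM (claimGraph Gr Γ) x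
    · obtain ⟨R, hR⟩ := hne
      rcases (solid_claimGraph hconv x).exists_mart_or_exists_hedge
        (D := fun z : Y × ℝ => D (x, z.1)) (hD.comp (by fun_prop))
        (F := fun z : Y × ℝ => z.2) measurable_snd (W := fun z => 0) measurable_const hNA hR (a x)
        with h | ⟨y₀, hy₀⟩
      · exfalso
        obtain ⟨_, ⟨ν, hν, rfl⟩, -, -, h2, h3, h4, h5⟩ := h
        have := hax ((a x + ∫ z : Y × ℝ, z.2 ∂(ν : Measure (Y × ℝ))) / 2)
          ⟨ν, hν, h2, h3, h4, by simp only; linarith⟩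
        linarith
      · exact (hyV x y₀ hy₀).1 0
    · exact fun R hR => absurd ⟨R, hR⟩ hne
  let A : Set (Y × ℝ) := {z | ((x, z.1), z.2) ∈ Γ ∧ a x + y 0 x ⬝ᵥ D (x, z.1) < z.2}
  have hA : Suslin A := (suslin_claim_section hΓ x).inter (MeasurableSet.suslin
    (measurableSet_lt (((measurable_dotProduct_section hD x (y 0 x)).comp measurable_fst).const_add
      (a x)) measurable_snd))
  have hB : Suslin {z | ∃ c, (z, c) ∈ A} := hA.exists_mem
  by_contra hcon
  have hPB : (P : Measure Y) {z | ∃ c, (z, c) ∈ A} ≠ 0 := by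
    intro h0
    apply hcon
    rw [ae_iff]
    convert h0 using 2
    ext z
    simp only [mem_ofPred_eq, not_forall, not_le, A, exists_prop]
  have hp : IsProbabilityMeasure ((P : Measure Y)[|{z | ∃ c, (z, c) ∈ A}]) :=
    cond_isProbabilityMeasure hPB
  obtain ⟨ν, hν, hνP⟩ := exists_claimGraph_of_proj
    (R := (P : Measure Y)[|{z | ∃ c, (z, c) ∈ A}]) hA
    (ae_cond_mem₀ (hB.nullMeasurableSet (P : Measure Y)))
  have h1 := hhedge ν ⟨ν, ⟨hν.mono fun z hz => hz.1, P, hP, by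
    rw [hνP]; exact cond_absolutelyContinuous⟩, rfl⟩
  obtain ⟨z, hz, hz'⟩ := (h1.and hν).exists
  exact absurd hz (not_le.2 hz'.2)

end ClaimStep

/-! ### Measurable selection of one-period martingale laws -/

section ClaimSelection

variable {X Y : Type*} [MeasurableSpace X] [MeasurableSpace Y] {d : ℕ}
  {Gr : Set (X × ProbabilityMeasure Y)} {Γ : Set ((X × Y) × ℝ)} {D : X × Y → Fin d → ℝ}
  [StandardBorelSpace X] [StandardBorelSpace Y]

lemma exists_mart_claim (hconv : ∀ x, ConvexPM {P | (x, P) ∈ Gr}) (hΓ : Suslin Γ)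
    (hD : Measurable D) {x : X} (hNA : NAAt Gr Γ D x) {P : ProbabilityMeasure Y}
    (hP : (x, P) ∈ Gr) (h : ∀ᵐ y ∂(P : Measure Y), ∃ c, ((x, y), c) ∈ Γ) {v : ℝ}
    (hv : (x, v) ∈ prevClaim Gr Γ D) :
    ∃ (ν : ProbabilityMeasure (Y × ℝ)) (P₀ : ProbabilityMeasure Y), (x, P₀) ∈ Gr ∧
      (∀ᵐ z ∂(ν : Measure (Y × ℝ)), ((x, z.1), z.2) ∈ Γ) ∧
      (P : Measure Y) ≪ (pmFst ν : Measure Y) ∧ (pmFst ν : Measure Y) ≪ (P₀ : Measure Y) ∧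
      (∀ i, Integrable (fun z : Y × ℝ => D (x, z.1) i) (ν : Measure (Y × ℝ))) ∧
      Integrable (fun z : Y × ℝ => z.2) (ν : Measure (Y × ℝ)) ∧
      mean (fun z : Y × ℝ => D (x, z.1)) (ν : Measure (Y × ℝ)) = 0 ∧
      v < ∫ z : Y × ℝ, z.2 ∂(ν : Measure (Y × ℝ)) := by
  obtain ⟨R, hR, hRP⟩ := exists_mem_sectionM_of_proj hΓ hP h
  rcases (solid_claimGraph hconv x).exists_mart_or_exists_hedge
    (D := fun z : Y × ℝ => D (x, z.1)) (hD.comp (by fun_prop))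
    (F := fun z : Y × ℝ => z.2) measurable_snd (W := fun z => 0) measurable_const hNA hR v
    with h | ⟨y, hy⟩
  · obtain ⟨_, ⟨ν, ⟨h0, P₀, hP₀, hνP₀⟩, rfl⟩, h1, -, h2, h3, h4, h5⟩ := h
    refine ⟨ν, P₀, hP₀, h0, ?_, hνP₀, h2, h3, h4, h5⟩
    rw [← hRP]
    exact h1.map measurable_fst
  · exfalso
    obtain ⟨ν, hν, h2, h3, h4, h5⟩ := hv
    have h6 := hy ν ⟨ν, hν, rfl⟩
    have h7 : Integrable (fun z : Y × ℝ => y ⬝ᵥ D (x, z.1)) (ν : Measure (Y × ℝ)) :=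
      integrable_dotProduct h2 y
    have h8 := integral_mono_ae h3 ((integrable_const v).add h7) h6
    simp only [Pi.add_apply] at h8
    rw [integral_add (integrable_const v) h7, dotProduct_mean h2, h4] at h8
    simp at h8
    exact absurd h5 (not_lt.2 h8)

variable [Nonempty Y]

lemma exists_mart_claim_kernel (hGr : Suslin Gr) (hne : ∀ x, ∃ P, (x, P) ∈ Gr)
    (hconv : ∀ x, ConvexPM {P | (x, P) ∈ Gr}) (hΓ : Suslin Γ)
    (hdown : ∀ p c c', (p, c) ∈ Γ → c' ≤ c → (p, c') ∈ Γ) (hD : Measurable D)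
    {μ : Measure X} [IsProbabilityMeasure μ] {κ : X → ProbabilityMeasure Y}
    (hκ : Measurable[univComp X] κ) (hκG : ∀ x, (x, κ x) ∈ Gr) {v : X → ℝ} (hv : Measurable v)
    (hNA : ∀ᵐ x ∂μ, NAAt Gr Γ D x)
    (hproj : ∀ᵐ x ∂μ, ∀ᵐ y ∂(κ x : Measure Y), ∃ c, ((x, y), c) ∈ Γ)
    (hvΓ : ∀ᵐ x ∂μ, (x, v x) ∈ prevClaim Gr Γ D) :
    ∃ (Q : Kernel X Y) (P' : X → ProbabilityMeasure Y) (w : X × Y → ℝ), IsMarkovKernel Q ∧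
      Measurable[univComp X] P' ∧ (∀ x, (x, P' x) ∈ Gr) ∧ Measurable w ∧
      ∀ᵐ x ∂μ, (κ x : Measure Y) ≪ Q x ∧ Q x ≪ (P' x : Measure Y) ∧
        (∀ i, Integrable (fun y => D (x, y) i) (Q x)) ∧ mean (fun y => D (x, y)) (Q x) = 0 ∧
        Integrable (fun y => w (x, y)) (Q x) ∧ v x < ∫ y, w (x, y) ∂(Q x) ∧
        ∀ᵐ y ∂(Q x), ((x, y), w (x, y)) ∈ Γ := by
  have hD' : Measurable fun p : X × (Y × ℝ) => D (p.1, p.2.1) := hD.comp (by fun_prop)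
  have hF' : Measurable fun p : X × (Y × ℝ) => p.2.2 := by fun_prop
  let Z := (X × (ProbabilityMeasure Y × ℝ)) × (ProbabilityMeasure (Y × ℝ) × ProbabilityMeasure Y)
  let A : Set Z := {q | (q.1.1, q.2.2) ∈ Gr ∧
      (∀ᵐ z ∂(q.2.1 : Measure (Y × ℝ)), ((q.1.1, z.1), z.2) ∈ Γ) ∧
      (q.1.2.1 : Measure Y) ≪ (pmFst q.2.1 : Measure Y) ∧
      (pmFst q.2.1 : Measure Y) ≪ (q.2.2 : Measure Y) ∧
      (∀ i, Integrable (fun z : Y × ℝ => D (q.1.1, z.1) i) (q.2.1 : Measure (Y × ℝ))) ∧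
      Integrable (fun z : Y × ℝ => z.2) (q.2.1 : Measure (Y × ℝ)) ∧
      mean (fun z : Y × ℝ => D (q.1.1, z.1)) (q.2.1 : Measure (Y × ℝ)) = 0 ∧
      q.1.2.2 < ∫ z : Y × ℝ, z.2 ∂(q.2.1 : Measure (Y × ℝ))}
  have m1 : Measurable fun q : Z => q.1.1 := by fun_prop
  have m2 : Measurable fun q : Z => q.1.2.1 := by fun_prop
  have m3 : Measurable fun q : Z => q.1.2.2 := by fun_prop
  have m4 : Measurable fun q : Z => q.2.1 := by fun_prop
  have m5 : Measurable fun q : Z => q.2.2 := by fun_prop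
  have hA : Suslin A :=
    (hGr.preimage (m1.prodMk m5)).inter (((suslin_setOf_ae_claim hΓ).preimage (m1.prodMk m4)).inter
      ((measurableSet_absolutelyContinuous_param m2 (measurable_pmFst.comp m4)).inter
        ((measurableSet_absolutelyContinuous_param (measurable_pmFst.comp m4) m5).inter
          ((measurableSet_forall_integrable_param m4 m1 hD').inter
            ((measurableSet_integrable_param m4 m1 hF').inter
              ((measurable_mean_param m4 m1 hD' (measurableSet_singleton 0)).inter
                (measurableSet_lt m3 (measurable_integral_param m4 m1 hF'))))))).suslin)
  have hn1 : Nonempty (ProbabilityMeasure Y) := ⟨⟨Measure.dirac (Classical.arbitrary Y), inferInstance⟩⟩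
  have hn2 : Nonempty (ProbabilityMeasure (Y × ℝ)) :=
    ⟨⟨Measure.dirac (Classical.arbitrary Y, 0), inferInstance⟩⟩
  obtain ⟨s, hs, hsA⟩ := hA.exists_selector_comp (measurable_prodMk_univ hκ hv.univ)
  have hs1 : Measurable[univComp X] fun x => (s x).1 := measurable_fst.comp hs
  have hs2 : Measurable[univComp X] fun x => (s x).2 := measurable_snd.comp hs
  obtain ⟨P', hP', hP'G, hP's⟩ := hGr.exists_selector_extending hne hs2
  obtain ⟨K, hK, hKs⟩ := exists_kernel_ae_eq hs1 μ
  let w : X × Y → ℝ := fun p => ∫ r, r ∂(K.condKernel p)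
  have hw : Measurable w :=
    (StronglyMeasurable.integral_kernel (κ := K.condKernel) stronglyMeasurable_id).measurable
  refine ⟨K.fst, P', w, inferInstance, hP', hP'G, hw, ?_⟩
  filter_upwards [hNA, hproj, hvΓ, hKs] with x hx1 hx2 hx3 hx4
  obtain ⟨ν, P₀, hνP⟩ := exists_mart_claim hconv hΓ hD hx1 (hκG x) hx2 hx3
  obtain ⟨a1, a2, a3, a4, a5, a6, a7, a8⟩ := hsA x (ν, P₀) hνP
  simp only at a1 a2 a3 a4 a5 a6 a7 a8
  rw [coe_pmFst, ← hx4, ← Kernel.fst_apply] at a3 a4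
  rw [← hx4] at a2 a5 a6 a7 a8
  have hdis : (K.fst ⊗ₖ K.condKernel) x = K x := by rw [Kernel.disintegrate]
  have b6 : Integrable (fun z : Y × ℝ => z.2) ((K.fst ⊗ₖ K.condKernel) x) := by rwa [hdis]
  have hmD : ∀ i, Measurable fun y => D (x, y) i := fun i =>
    (measurable_pi_apply i).comp (hD.comp measurable_prodMk_left)
  refine ⟨a3, ?_, fun i => ?_, ?_, b6.integral_compProd, ?_, ?_⟩
  · rw [hP's x a1]
    exact a4
  · rw [Kernel.fst_apply, integrable_map_measure (hmD i).aestronglyMeasurable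
      measurable_fst.aemeasurable]
    exact a5 i
  · rw [← a7]
    funext i
    simp only [mean]
    rw [Kernel.fst_apply, integral_map measurable_fst.aemeasurable (hmD i).aestronglyMeasurable]
  · have h := integral_compProd b6
    rw [hdis] at h
    exact a8.trans_eq h
  · have b2 : ∀ᵐ z ∂((K.fst ⊗ₖ K.condKernel) x), ((x, z.1), z.2) ∈ Γ := by rwa [hdis]
    filter_upwards [Kernel.ae_ae_of_ae_compProd b2, b6.ae_of_compProd] with y hy1 hy2
    obtain ⟨c, hc, hc'⟩ := exists_notMem_null_integral_le hy2 hy1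
    exact hdown _ c _ (not_not.1 hc) hc'

end ClaimSelection

/-! ### Gains from trading -/

section Gain

variable {Ω₁ : Type} {d : ℕ} {S : (t : ℕ) → (Fin t → Ω₁) → Fin d → ℝ}

lemma restr_self {T : ℕ} (ω : Fin T → Ω₁) : restr Ω₁ T le_rfl ω = ω := rfl

lemma gain_congr {T t : ℕ} (h : t ≤ T) {H H' : (u : ℕ) → (Fin u → Ω₁) → Fin d → ℝ}
    (hH : ∀ u < t, H u = H' u) (ω : Fin T → Ω₁) : gain Ω₁ S H t h ω = gain Ω₁ S H' t h ω :=
  Finset.sum_congr rfl fun u _ => by rw [hH u u.2]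

lemma gain_update {T : ℕ} (H : (u : ℕ) → (Fin u → Ω₁) → Fin d → ℝ)
    (y : (Fin T → Ω₁) → Fin d → ℝ) (ω : Fin T → Ω₁) :
    gain Ω₁ S (Function.update H T y) T le_rfl ω = gain Ω₁ S H T le_rfl ω :=
  gain_congr le_rfl (fun _ hu => Function.update_of_ne hu.ne _ _) ω

lemma gain_zero {T t : ℕ} (h : t ≤ T) (ω : Fin T → Ω₁) :
    gain Ω₁ S (fun _ _ => 0) t h ω = 0 := by
  simp [gain]

variable [MeasurableSpace Ω₁]

lemma measurable_restr {T t : ℕ} (h : t ≤ T) : Measurable (restr Ω₁ t h) :=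
  measurable_pi_lambda _ fun _ => measurable_pi_apply _

lemma restr_snocE {T t : ℕ} (h : t ≤ T) (p : (Fin T → Ω₁) × Ω₁) :
    restr Ω₁ t (h.trans T.le_succ) (snocE Ω₁ T p) = restr Ω₁ t h p.1 := by
  ext i
  simp only [snocE_apply, restr]
  exact Fin.snoc_castSucc (α := fun _ => Ω₁) p.2 p.1 (Fin.castLE h i)

lemma gain_snocE {T : ℕ} (H : (u : ℕ) → (Fin u → Ω₁) → Fin d → ℝ) (p : (Fin T → Ω₁) × Ω₁) :
    gain Ω₁ S H (T + 1) le_rfl (snocE Ω₁ T p) =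
      gain Ω₁ S H T le_rfl p.1 + H T p.1 ⬝ᵥ incr Ω₁ S T p.1 p.2 := by
  simp only [gain]
  rw [Fin.sum_univ_castSucc]
  congr 1
  · refine Finset.sum_congr rfl fun u _ => Finset.sum_congr rfl fun i _ => ?_
    have h1 := restr_snocE (Ω₁ := Ω₁) (T := T) u.2.le p
    have h2 := restr_snocE (Ω₁ := Ω₁) (T := T) (Nat.succ_le_of_lt u.2) p
    simp only [Fin.val_castSucc]
    rw [h1, h2]
  · simp only [Fin.val_last, dotProduct, incr]
    have h1 := restr_snocE (Ω₁ := Ω₁) (T := T) le_rfl p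
    rw [h1, restr_self, restr_self]
    rfl

lemma gain_eq_of_update_zero {T : ℕ} (H : (u : ℕ) → (Fin u → Ω₁) → Fin d → ℝ)
    (ω : Fin (T + 1) → Ω₁) :
    gain Ω₁ S (Function.update H T 0) (T + 1) le_rfl ω =
      gain Ω₁ S H T le_rfl (restr Ω₁ T T.le_succ ω) := by
  obtain ⟨p, rfl⟩ := (snocE Ω₁ T).surjective ω
  rw [gain_snocE, gain_update, restr_snocE le_rfl, restr_self]
  simp

lemma Pred.update {H : (u : ℕ) → (Fin u → Ω₁) → Fin d → ℝ} (hH : Pred Ω₁ d H) {T : ℕ}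
    {y : (Fin T → Ω₁) → Fin d → ℝ} (hy : Measurable[univComp _] y) :
    Pred Ω₁ d (Function.update H T y) := by
  intro u
  by_cases hu : u = T
  · subst hu; simpa using hy
  · rw [Function.update_of_ne hu]; exact hH u

lemma pred_zero : Pred Ω₁ d (fun _ _ => 0) := fun _ => @measurable_const _ _ _ (univComp _) _

lemma measurable_incr {t : ℕ} (h0 : Measurable (S t)) (h1 : Measurable (S (t + 1))) :
    Measurable fun p : (Fin t → Ω₁) × Ω₁ => incr Ω₁ S t p.1 p.2 :=
  measurable_pi_lambda _ fun i =>
    ((measurable_pi_apply i).comp (h1.comp (snocE Ω₁ t).measurable)).sub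
      ((measurable_pi_apply i).comp (h0.comp measurable_fst))

lemma measurable_gain [StandardBorelSpace Ω₁] {T : ℕ} (hS : ∀ t ≤ T, Measurable (S t))
    {H : (u : ℕ) → (Fin u → Ω₁) → Fin d → ℝ} (hH : Pred Ω₁ d H) :
    Measurable[univComp (Fin T → Ω₁)] (gain Ω₁ S H T le_rfl) := by
  refine @Finset.measurable_fun_sum _ _ _ _ _ _ (univComp _) _ _ fun u _ => ?_
  refine @Finset.measurable_fun_sum _ _ _ _ _ _ (univComp _) _ _ fun i _ => ?_
  have h1 : Measurable[univComp (Fin T → Ω₁)] fun ω =>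
      H u (restr Ω₁ u (u.2.le) ω) i :=
    (measurable_pi_apply i).comp
      (measurable_comp_univ (hH u) (measurable_restr u.2.le).univ)
  have h2 : Measurable fun ω : Fin T → Ω₁ => S (u + 1) (restr Ω₁ (u + 1) u.2 ω) i -
      S u (restr Ω₁ u u.2.le ω) i :=
    ((measurable_pi_apply i).comp ((hS _ u.2).comp (measurable_restr _))).sub
      ((measurable_pi_apply i).comp ((hS _ u.2.le).comp (measurable_restr _)))
  exact h1.mul h2.univ

end Gain

/-! ### Martingale measures through kernels -/

section Mart

variable {Ω₁ : Type} [MeasurableSpace Ω₁] {d : ℕ}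

/-- Martingale measures built step by step from martingale kernels. -/
def MartK (S : (t : ℕ) → (Fin t → Ω₁) → Fin d → ℝ) : (T : ℕ) → Measure (Fin T → Ω₁) → Prop
  | 0, Q => IsProbabilityMeasure Q
  | T + 1, Q => ∃ (Q₀ : Measure (Fin T → Ω₁)) (κ : Kernel (Fin T → Ω₁) Ω₁),
      MartK S T Q₀ ∧ IsMarkovKernel κ ∧ Q = ext Q₀ κ ∧
      (∀ i, Integrable (fun p : (Fin T → Ω₁) × Ω₁ => incr Ω₁ S T p.1 p.2 i) (Q₀ ⊗ₘ κ)) ∧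
      ∀ᵐ x ∂Q₀, mean (incr Ω₁ S T x) (κ x) = 0

variable {S : (t : ℕ) → (Fin t → Ω₁) → Fin d → ℝ}

lemma MartK.isProbabilityMeasure {T : ℕ} {Q : Measure (Fin T → Ω₁)} (h : MartK S T Q) :
    IsProbabilityMeasure Q := by
  induction T with
  | zero => exact h
  | succ T ih =>
    obtain ⟨Q₀, κ, h0, hκ, rfl, -⟩ := h
    have := ih h0
    infer_instance

/-- A gain process bounded below by an integrable variable is a true martingale. -/
lemma MartK.integrable_gain [StandardBorelSpace Ω₁] {T : ℕ} (hS : ∀ t ≤ T, Measurable (S t))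
    {Q : Measure (Fin T → Ω₁)} (hQ : MartK S T Q) {H : (u : ℕ) → (Fin u → Ω₁) → Fin d → ℝ}
    (hH : Pred Ω₁ d H) {Z : (Fin T → Ω₁) → ℝ} (hZ : Integrable Z Q)
    (h : ∀ᵐ ω ∂Q, 0 ≤ gain Ω₁ S H T le_rfl ω + Z ω) :
    Integrable (gain Ω₁ S H T le_rfl) Q ∧ ∫ ω, gain Ω₁ S H T le_rfl ω ∂Q = 0 := by
  induction T with
  | zero =>
    have : gain Ω₁ S H 0 le_rfl = fun _ => 0 := by funext ω; simp [gain]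
    rw [this]; simp
  | succ T ih =>
    have hprob := hQ.isProbabilityMeasure
    have hgm := aemeasurable_of_univ (measurable_gain hS hH) Q
    obtain ⟨Q₀, κ, h0, hκ, rfl, hDi, hD0⟩ := hQ
    have := h0.isProbabilityMeasure
    have hme := (snocE Ω₁ T).measurableEmbedding
    have hZ' : Integrable (fun p => Z (snocE Ω₁ T p)) (Q₀ ⊗ₘ κ) := hme.integrable_map_iff.1 hZ
    rw [ae_ext_iff] at h
    simp only [gain_snocE] at h
    have hgm' : AEStronglyMeasurable (fun p : (Fin T → Ω₁) × Ω₁ => gain Ω₁ S H T le_rfl p.1 +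
        H T p.1 ⬝ᵥ incr Ω₁ S T p.1 p.2) (Q₀ ⊗ₘ κ) := by
      have := (hgm.comp_measurable (snocE Ω₁ T).measurable).aestronglyMeasurable
      refine this.congr (Eventually.of_forall fun p => ?_)
      exact gain_snocE H p
    have hZ0 : ∀ᵐ x ∂Q₀, Integrable (fun y => Z (snocE Ω₁ T (x, y))) (κ x) :=
      ((Measure.integrable_compProd_iff hZ'.aestronglyMeasurable).1 hZ').1
    have hZint : Integrable (fun x => ∫ y, Z (snocE Ω₁ T (x, y)) ∂κ x) Q₀ :=
      Integrable.integral_compProd (κ := Kernel.const Unit Q₀) (η := Kernel.prodMkLeft Unit κ)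
        (a := ()) hZ'
    have hD1 : ∀ᵐ x ∂Q₀, ∀ i, Integrable (fun y => incr Ω₁ S T x y i) (κ x) :=
      ae_all_iff.2 fun i =>
        ((Measure.integrable_compProd_iff (hDi i).aestronglyMeasurable).1 (hDi i)).1
    have hsec : ∀ᵐ x ∂Q₀, Integrable (fun y => gain Ω₁ S H T le_rfl x + H T x ⬝ᵥ incr Ω₁ S T x y)
        (κ x) ∧ ∫ y, gain Ω₁ S H T le_rfl x + H T x ⬝ᵥ incr Ω₁ S T x y ∂κ x =
          gain Ω₁ S H T le_rfl x := by
      filter_upwards [hD1, hD0] with x hx1 hx2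
      have h3 := integrable_dotProduct hx1 (H T x)
      refine ⟨(integrable_const _).add h3, ?_⟩
      rw [integral_add (integrable_const _) h3, dotProduct_mean hx1, hx2]
      simp
    have hlow : ∀ᵐ x ∂Q₀, 0 ≤ gain Ω₁ S H T le_rfl x + ∫ y, Z (snocE Ω₁ T (x, y)) ∂κ x := by
      filter_upwards [Measure.ae_ae_of_ae_compProd h, hsec, hZ0] with x hx1 hx2 hx3
      rw [← hx2.2, ← integral_add hx2.1 hx3]
      exact integral_nonneg_of_ae hx1
    obtain ⟨i1, i2⟩ := ih (fun t ht => hS t (ht.trans T.le_succ)) h0 hZint hlow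
    have hsum : Integrable (fun p : (Fin T → Ω₁) × Ω₁ => (gain Ω₁ S H T le_rfl p.1 +
        H T p.1 ⬝ᵥ incr Ω₁ S T p.1 p.2) + Z (snocE Ω₁ T p)) (Q₀ ⊗ₘ κ) := by
      refine (Measure.integrable_compProd_iff (hgm'.add hZ'.aestronglyMeasurable)).2 ⟨?_, ?_⟩
      · filter_upwards [hsec, hZ0] with x hx1 hx2 using hx1.1.add hx2
      · refine (i1.add hZint).congr ?_
        filter_upwards [Measure.ae_ae_of_ae_compProd h, hsec, hZ0] with x hx1 hx2 hx3
        simp only [Pi.add_apply]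
        conv_lhs => rw [← hx2.2, ← integral_add hx2.1 hx3]
        refine integral_congr_ae ?_
        filter_upwards [hx1] with y hy
        exact (Real.norm_of_nonneg hy).symm
    have hX : Integrable (fun p : (Fin T → Ω₁) × Ω₁ => gain Ω₁ S H T le_rfl p.1 +
        H T p.1 ⬝ᵥ incr Ω₁ S T p.1 p.2) (Q₀ ⊗ₘ κ) := by
      refine (hsum.sub hZ').congr (Eventually.of_forall fun p => ?_)
      simp
    constructor
    · refine hme.integrable_map_iff.2 (hX.congr (Eventually.of_forall fun p => ?_))
      exact (gain_snocE H p).symm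
    · rw [ext, hme.integral_map]
      simp only [gain_snocE]
      rw [Measure.integral_compProd hX, ← i2]
      exact integral_congr_ae (hsec.mono fun x hx => hx.2)

end Mart

section MartMeas

variable {Ω₁ : Type} [MeasurableSpace Ω₁] {d : ℕ} {S : (t : ℕ) → (Fin t → Ω₁) → Fin d → ℝ}

/-- It suffices to test the martingale property on Borel events. -/
lemma isMartMeas_iff {T : ℕ} {Q : Measure (Fin T → Ω₁)} [IsProbabilityMeasure Q] :
    IsMartMeas Ω₁ S Q ↔
      (∀ (t : ℕ) (h : t ≤ T) (i : Fin d), Integrable (fun ω => S t (restr Ω₁ t h ω) i) Q) ∧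
      ∀ (t : ℕ) (h : t + 1 ≤ T) (i : Fin d) (B : Set (Fin t → Ω₁)), MeasurableSet B →
        ∫ ω in restr Ω₁ t (t.le_succ.trans h) ⁻¹' B, (S (t + 1) (restr Ω₁ (t + 1) h ω) i -
          S t (restr Ω₁ t (t.le_succ.trans h) ω) i) ∂Q = 0 := by
  refine and_congr_right fun hi => ⟨fun h t ht i B hB => ?_, fun h t ht i A hA => ?_⟩
  · rw [integral_sub (hi _ _ _).integrableOn (hi _ _ _).integrableOn,
      h t ht i _ ⟨B, le_univComp _ hB, rfl⟩, sub_self]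
  · obtain ⟨B, hB, rfl⟩ := hA
    have hr := measurable_restr (Ω₁ := Ω₁) (t.le_succ.trans ht)
    have hp : IsProbabilityMeasure (Q.map (restr Ω₁ t (t.le_succ.trans ht))) :=
      Measure.isProbabilityMeasure_map hr.aemeasurable
    obtain ⟨B', -, hB'm, hB'⟩ := (hB _ hp).exists_measurable_superset_ae_eq
    have hae : restr Ω₁ t (t.le_succ.trans ht) ⁻¹' B' =ᵐ[Q] restr Ω₁ t (t.le_succ.trans ht) ⁻¹' B :=
      (hr.quasiMeasurePreserving Q).preimage_ae_eq hB'
    have h1 := h t ht i B' hB'm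
    rw [setIntegral_congr_set hae, integral_sub (hi _ _ _).integrableOn (hi _ _ _).integrableOn,
      sub_eq_zero] at h1
    exact h1

lemma setIntegral_ext_incr {T : ℕ} {Q₀ : Measure (Fin T → Ω₁)} [IsProbabilityMeasure Q₀]
    {κ : Kernel (Fin T → Ω₁) Ω₁} [IsMarkovKernel κ] {i : Fin d}
    (hD : Integrable (fun p : (Fin T → Ω₁) × Ω₁ => incr Ω₁ S T p.1 p.2 i) (Q₀ ⊗ₘ κ))
    {B : Set (Fin T → Ω₁)} (hB : MeasurableSet B) :
    ∫ ω in restr Ω₁ T T.le_succ ⁻¹' B, (S (T + 1) ω i - S T (restr Ω₁ T T.le_succ ω) i) ∂ext Q₀ κ =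
      ∫ x in B, mean (incr Ω₁ S T x) (κ x) i ∂Q₀ := by
  rw [ext, (snocE Ω₁ T).measurableEmbedding.setIntegral_map]
  have e1 : snocE Ω₁ T ⁻¹' (restr Ω₁ T T.le_succ ⁻¹' B) = B ×ˢ univ := by
    ext p
    simp only [mem_preimage, mem_prod, mem_univ, and_true]
    rw [restr_snocE le_rfl, restr_self]
  have e2 : ∀ p : (Fin T → Ω₁) × Ω₁, S (T + 1) (snocE Ω₁ T p) i -
      S T (restr Ω₁ T T.le_succ (snocE Ω₁ T p)) i = incr Ω₁ S T p.1 p.2 i := by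
    intro p
    rw [restr_snocE le_rfl, restr_self]
    rfl
  simp only [e1, e2]
  rw [Measure.setIntegral_compProd hB MeasurableSet.univ hD.integrableOn]
  simp [mean]

lemma isMartMeas_ext_iff {T : ℕ} (hS : ∀ t ≤ T + 1, Measurable (S t))
    {Q₀ : Measure (Fin T → Ω₁)} [IsProbabilityMeasure Q₀]
    {κ : Kernel (Fin T → Ω₁) Ω₁} [IsMarkovKernel κ] :
    IsMartMeas Ω₁ S (ext Q₀ κ) ↔ IsMartMeas Ω₁ S Q₀ ∧
      (∀ i, Integrable (fun p : (Fin T → Ω₁) × Ω₁ => incr Ω₁ S T p.1 p.2 i) (Q₀ ⊗ₘ κ)) ∧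
      ∀ᵐ x ∂Q₀, mean (incr Ω₁ S T x) (κ x) = 0 := by
  have hr := measurable_restr (Ω₁ := Ω₁) T.le_succ
  have hSm : ∀ t (h : t ≤ T + 1) (i : Fin d), Measurable fun ω : Fin t → Ω₁ => S t ω i :=
    fun t h i => (measurable_pi_apply i).comp (hS t h)
  have hSr : ∀ t (h : t ≤ T) (i : Fin d), Measurable fun ω : Fin T → Ω₁ =>
      S t (restr Ω₁ t h ω) i := fun t h i => (hSm t (h.trans T.le_succ) i).comp (measurable_restr _)
  have hi : ∀ t (h : t ≤ T) (i : Fin d),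
      Integrable (fun ω => S t (restr Ω₁ t h ω) i) Q₀ ↔
      Integrable (fun ω => S t (restr Ω₁ t (h.trans T.le_succ) ω) i) (ext Q₀ κ) := by
    intro t h i
    conv_lhs => rw [← map_restr_ext (ν := Q₀) (κ := κ)]
    rw [integrable_map_measure (hSr t h i).aestronglyMeasurable hr.aemeasurable]
    rfl
  have hDi : ∀ i, Integrable (fun p : (Fin T → Ω₁) × Ω₁ => incr Ω₁ S T p.1 p.2 i) (Q₀ ⊗ₘ κ) ↔
      Integrable (fun ω => S (T + 1) ω i - S T (restr Ω₁ T T.le_succ ω) i) (ext Q₀ κ) := by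
    intro i
    rw [ext, (snocE Ω₁ T).measurableEmbedding.integrable_map_iff]
    refine integrable_congr (Eventually.of_forall fun p => ?_)
    simp only [Function.comp]
    rw [restr_snocE le_rfl, restr_self]
    rfl
  have hs : ∀ t (h : t + 1 ≤ T) (i : Fin d) (B : Set (Fin t → Ω₁)), MeasurableSet B →
      ∫ ω in restr Ω₁ t (t.le_succ.trans h) ⁻¹' B, (S (t + 1) (restr Ω₁ (t + 1) h ω) i -
          S t (restr Ω₁ t (t.le_succ.trans h) ω) i) ∂Q₀ =
      ∫ ω in restr Ω₁ t (t.le_succ.trans (h.trans T.le_succ)) ⁻¹' B,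
        (S (t + 1) (restr Ω₁ (t + 1) (h.trans T.le_succ) ω) i -
          S t (restr Ω₁ t (t.le_succ.trans (h.trans T.le_succ)) ω) i) ∂ext Q₀ κ := by
    intro t h i B hB
    conv_lhs => rw [← map_restr_ext (ν := Q₀) (κ := κ)]
    exact setIntegral_map (measurable_restr _ hB)
      ((hSr _ h i).sub (hSr _ _ i)).aestronglyMeasurable hr.aemeasurable
  rw [isMartMeas_iff, isMartMeas_iff]
  constructor
  · rintro ⟨h1, h2⟩
    have h3 : ∀ i, Integrable (fun p : (Fin T → Ω₁) × Ω₁ => incr Ω₁ S T p.1 p.2 i) (Q₀ ⊗ₘ κ) :=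
      fun i => (hDi i).2 ((h1 (T + 1) le_rfl i).sub (h1 T T.le_succ i))
    refine ⟨⟨fun t h i => (hi t h i).2 (h1 t _ i), fun t h i B hB => ?_⟩, h3, ?_⟩
    · rw [hs t h i B hB]
      exact h2 t _ i B hB
    · have h4 : ∀ i, ∀ᵐ x ∂Q₀, mean (incr Ω₁ S T x) (κ x) i = 0 := by
        intro i
        have h5 : Integrable (fun x => mean (incr Ω₁ S T x) (κ x) i) Q₀ :=
          Integrable.integral_compProd (κ := Kernel.const Unit Q₀) (η := Kernel.prodMkLeft Unit κ)
            (a := ()) (h3 i)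
        refine h5.ae_eq_zero_of_forall_setIntegral_eq_zero fun B hB _ => ?_
        rw [← setIntegral_ext_incr (h3 i) hB]
        exact h2 T le_rfl i B hB
      filter_upwards [ae_all_iff.2 h4] with x hx
      funext i
      exact hx i
  · rintro ⟨⟨h1, h2⟩, h3, h4⟩
    have h5 : ∀ i, Integrable (fun ω => S (T + 1) ω i) (ext Q₀ κ) := fun i =>
      (((hDi i).1 (h3 i)).add ((hi T le_rfl i).1 (h1 T le_rfl i))).congr
        (Eventually.of_forall fun ω => by simp)
    refine ⟨fun t h i => ?_, fun t h i B hB => ?_⟩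
    · rcases h.lt_or_eq with h' | rfl
      · exact (hi t (Nat.lt_succ_iff.1 h') i).1 (h1 t _ i)
      · exact h5 i
    · rcases h.lt_or_eq with h' | h'
      · rw [← hs t (Nat.lt_succ_iff.1 h') i B hB]
        exact h2 t _ i B hB
      · obtain rfl : t = T := by omega
        refine (setIntegral_ext_incr (h3 i) hB).trans ?_
        refine integral_eq_zero_of_ae (ae_restrict_of_ae ?_)
        filter_upwards [h4] with x hx
        rw [hx]; rfl

lemma isMartMeas_zero {Q : Measure (Fin 0 → Ω₁)} [IsProbabilityMeasure Q] :
    IsMartMeas Ω₁ S Q := by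
  refine ⟨fun t h i => ?_, fun t h => absurd h (by omega)⟩
  have : (fun ω : Fin 0 → Ω₁ => S t (restr Ω₁ t h ω) i) =
      fun _ => S t (restr Ω₁ t h Fin.elim0) i := by
    funext ω
    rw [Subsingleton.elim ω Fin.elim0]
  rw [this]
  exact integrable_const _

lemma MartK.isMartMeas {T : ℕ} (hS : ∀ t ≤ T, Measurable (S t)) {Q : Measure (Fin T → Ω₁)}
    (h : MartK S T Q) : IsMartMeas Ω₁ S Q := by
  induction T with
  | zero =>
    have := h.isProbabilityMeasure
    exact isMartMeas_zero
  | succ T ih =>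
    obtain ⟨Q₀, κ, h0, hκ, rfl, hDi, hD0⟩ := h
    have := h0.isProbabilityMeasure
    exact (isMartMeas_ext_iff hS).2 ⟨ih (fun t ht => hS t (ht.trans T.le_succ)) h0, hDi, hD0⟩

lemma IsMartMeas.martK [StandardBorelSpace Ω₁] [Nonempty Ω₁] {T : ℕ}
    (hS : ∀ t ≤ T, Measurable (S t)) {Q : Measure (Fin T → Ω₁)}
    [hp : IsProbabilityMeasure Q] (h : IsMartMeas Ω₁ S Q) : MartK S T Q := by
  induction T with
  | zero => exact hp
  | succ T ih =>
    let ρ : Measure ((Fin T → Ω₁) × Ω₁) := Q.map (snocE Ω₁ T).symm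
    have hρ : IsProbabilityMeasure ρ :=
      Measure.isProbabilityMeasure_map (snocE Ω₁ T).symm.measurable.aemeasurable
    have hQ : Q = ext ρ.fst ρ.condKernel := by
      rw [ext, ρ.disintegrate ρ.condKernel]
      exact ((snocE Ω₁ T).map_map_symm).symm
    rw [hQ, isMartMeas_ext_iff hS] at h
    exact ⟨_, _, ih (fun t ht => hS t (ht.trans T.le_succ)) h.1, inferInstance, hQ, h.2.1, h.2.2⟩

end MartMeas

/-! ### Backward induction -/

section Backward

variable {Ω₁ : Type} [MeasurableSpace Ω₁] [TopologicalSpace Ω₁] [PolishSpace Ω₁] [BorelSpace Ω₁]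
  {d : ℕ}

/-- The standing assumptions on the uncertainty sets and on the stock price up to time `T`. -/
structure Market (Pt : (t : ℕ) → (Fin t → Ω₁) → Set (ProbabilityMeasure Ω₁))
    (S : (t : ℕ) → (Fin t → Ω₁) → Fin d → ℝ) (T : ℕ) : Prop where
  ne : ∀ t < T, ∀ ω, (Pt t ω).Nonempty
  conv : ∀ t < T, ∀ ω, ConvexPM (Pt t ω)
  graph : ∀ t < T, AnalyticSet {p : (Fin t → Ω₁) × ProbabilityMeasure Ω₁ | p.2 ∈ Pt t p.1}
  meas : ∀ t ≤ T, Measurable (S t)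

/-- No arbitrage by trading in the stocks only. -/
def NAS (Pt : (t : ℕ) → (Fin t → Ω₁) → Set (ProbabilityMeasure Ω₁))
    (S : (t : ℕ) → (Fin t → Ω₁) → Fin d → ℝ) (T : ℕ) : Prop :=
  ∀ H, Pred Ω₁ d H → (∀ P ∈ MeasFam Ω₁ Pt T, ∀ᵐ ω ∂P, 0 ≤ gain Ω₁ S H T le_rfl ω) →
    ∀ P ∈ MeasFam Ω₁ Pt T, ∀ᵐ ω ∂P, gain Ω₁ S H T le_rfl ω = 0

/-- The graph of the one-step uncertainty set. -/
def stepGraph (Pt : (t : ℕ) → (Fin t → Ω₁) → Set (ProbabilityMeasure Ω₁)) (t : ℕ) :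
    Set ((Fin t → Ω₁) × ProbabilityMeasure Ω₁) := {p | p.2 ∈ Pt t p.1}

/-- A set of claims on paths of length `t + 1`, with the last coordinate split off. -/
def splitClaim {t : ℕ} (Γ : Set ((Fin (t + 1) → Ω₁) × ℝ)) : Set (((Fin t → Ω₁) × Ω₁) × ℝ) :=
  {q | (snocE Ω₁ t q.1, q.2) ∈ Γ}

/-- The stock increment as a function on the split path space. -/
def splitIncr (S : (t : ℕ) → (Fin t → Ω₁) → Fin d → ℝ) (t : ℕ)
    (p : (Fin t → Ω₁) × Ω₁) : Fin d → ℝ := incr Ω₁ S t p.1 p.2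

variable {Pt : (t : ℕ) → (Fin t → Ω₁) → Set (ProbabilityMeasure Ω₁)}
  {S : (t : ℕ) → (Fin t → Ω₁) → Fin d → ℝ} {T : ℕ}

lemma suslin_splitClaim {Γ : Set ((Fin (T + 1) → Ω₁) × ℝ)} (hΓ : Suslin Γ) :
    Suslin (splitClaim Γ) :=
  hΓ.preimage (f := fun q : ((Fin T → Ω₁) × Ω₁) × ℝ => (snocE Ω₁ T q.1, q.2))
    (((snocE Ω₁ T).measurable.comp measurable_fst).prodMk measurable_snd)

namespace Market

lemma pred (hM : Market Pt S (T + 1)) : Market Pt S T where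
  ne t ht := hM.ne t (ht.trans T.lt_succ_self)
  conv t ht := hM.conv t (ht.trans T.lt_succ_self)
  graph t ht := hM.graph t (ht.trans T.lt_succ_self)
  meas t ht := hM.meas t (ht.trans T.le_succ)

lemma suslin (hM : Market Pt S (T + 1))
    : Suslin (stepGraph Pt T) := suslin_of_analyticSet (hM.graph T T.lt_succ_self)

lemma exists_mem (hM : Market Pt S (T + 1))
    (x : Fin T → Ω₁) : ∃ P, (x, P) ∈ stepGraph Pt T := hM.ne T T.lt_succ_self x

lemma convex (hM : Market Pt S (T + 1)) (x : Fin T → Ω₁) : ConvexPM {P | (x, P) ∈ stepGraph Pt T} :=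
  hM.conv T T.lt_succ_self x

lemma measurable_splitIncr (hM : Market Pt S (T + 1)) : Measurable (splitIncr S T) :=
  measurable_incr (hM.meas T T.le_succ) (hM.meas (T + 1) le_rfl)

lemma exists_selector (hM : Market Pt S (T + 1))
    : ∃ κ : (Fin T → Ω₁) → ProbabilityMeasure Ω₁, Measurable[univComp _] κ ∧
    ∀ x, (x, κ x) ∈ stepGraph Pt T := by
  rcases isEmpty_or_nonempty (Fin T → Ω₁) with hX | ⟨⟨x₀⟩⟩
  · exact ⟨fun x => isEmptyElim x, fun s hs => by
      rw [Set.eq_empty_of_isEmpty (_ ⁻¹' s)]; exact @MeasurableSet.empty _ (univComp _),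
      fun x => isEmptyElim x⟩
  · obtain ⟨κ, hκ, hκG, -⟩ := hM.suslin.exists_selector_extending hM.exists_mem
      (κ := fun _ => (hM.exists_mem x₀).choose) (@measurable_const _ _ _ (univComp _) _)
    exact ⟨κ, hκ, hκG⟩

lemma exists_ext_mem (hM : Market Pt S (T + 1))
    {κ : (Fin T → Ω₁) → ProbabilityMeasure Ω₁} (hκ : Measurable[univComp _] κ)
    (hκG : ∀ x, (x, κ x) ∈ stepGraph Pt T) {ν : Measure (Fin T → Ω₁)}
    (hν : ν ∈ MeasFam Ω₁ Pt T) :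
    ∃ κ' : Kernel (Fin T → Ω₁) Ω₁, IsMarkovKernel κ' ∧ (∀ᵐ x ∂ν, κ' x = (κ x : Measure Ω₁)) ∧
      ext ν κ' ∈ MeasFam Ω₁ Pt (T + 1) := by
  have := isProbabilityMeasure_of_mem_measFam ν hν
  obtain ⟨κ', h1, h2⟩ := exists_kernel_ae_eq hκ ν
  exact ⟨κ', h1, h2, ext_mem_measFam hν (hM.graph T T.lt_succ_self) hκ hκG h2⟩

/-- A quasi-sure property of paths holds almost surely under every selector. -/
lemma ae_ae_of_forall (hM : Market Pt S (T + 1))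
    {κ : (Fin T → Ω₁) → ProbabilityMeasure Ω₁} (hκ : Measurable[univComp _] κ)
    (hκG : ∀ x, (x, κ x) ∈ stepGraph Pt T) {ν : Measure (Fin T → Ω₁)}
    (hν : ν ∈ MeasFam Ω₁ Pt T) {p : (Fin (T + 1) → Ω₁) → Prop}
    (hp : ∀ P ∈ MeasFam Ω₁ Pt (T + 1), ∀ᵐ ω ∂P, p ω) :
    ∀ᵐ x ∂ν, ∀ᵐ y ∂(κ x : Measure Ω₁), p (snocE Ω₁ T (x, y)) := by
  have := isProbabilityMeasure_of_mem_measFam ν hν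
  obtain ⟨κ', h1, h2, h3⟩ := hM.exists_ext_mem hκ hκG hν
  filter_upwards [ae_ae_of_ae_ext (hp _ h3), h2] with x hx1 hx2
  rwa [hx2] at hx1

lemma nas_pred (hM : Market Pt S (T + 1)) (hNA : NAS Pt S (T + 1)) : NAS Pt S T := by
  intro H hH h ν hν
  have hpr := isProbabilityMeasure_of_mem_measFam ν hν
  obtain ⟨κ, hκ, hκG⟩ := hM.exists_selector
  have h1 := hNA (Function.update H T 0) (hH.update (@measurable_const _ _ _ (univComp _) _)) ?_
  · filter_upwards [hM.ae_ae_of_forall hκ hκG hν h1] with x hx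
    obtain ⟨y, hy⟩ := hx.exists
    rwa [gain_eq_of_update_zero, restr_snocE le_rfl, restr_self] at hy
  · intro P hP
    obtain ⟨ν', hν', κ', -, -, κ'', hm, -, rfl⟩ := exists_ext_of_mem_measFam hP
    have := isProbabilityMeasure_of_mem_measFam ν' hν'
    have h2 := h ν' hν'
    rw [← map_restr_ext (ν := ν') (κ := κ'')] at h2
    filter_upwards [ae_of_ae_map (measurable_restr _).aemeasurable h2] with ω hω
    rwa [gain_eq_of_update_zero]

variable {Γ : Set ((Fin (T + 1) → Ω₁) × ℝ)}

lemma ae_naAt (hM : Market Pt S (T + 1)) (hNA : NAS Pt S (T + 1)) (hΓ : Suslin Γ)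
    (hproj : ∀ P ∈ MeasFam Ω₁ Pt (T + 1), ∀ᵐ ω ∂P, ∃ c, (ω, c) ∈ Γ)
    {ν : Measure (Fin T → Ω₁)} (hν : ν ∈ MeasFam Ω₁ Pt T) :
    ∀ᵐ x ∂ν, NAAt (stepGraph Pt T) (splitClaim Γ) (splitIncr S T) x := by
  obtain ⟨y, P', hy, hP', hP'G, hpos, hNAx⟩ := exists_test_portfolios hM.suslin hM.exists_mem
    hM.convex (suslin_splitClaim hΓ) hM.measurable_splitIncr
  have key : ∀ j, ∀ᵐ x ∂ν, ∀ᵐ z ∂(P' j x : Measure Ω₁), y j x ⬝ᵥ splitIncr S T (x, z) = 0 := by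
    intro j
    have hgain : ∀ p : (Fin T → Ω₁) × Ω₁, gain Ω₁ S (Function.update (fun _ _ => 0) T (y j)) (T + 1)
        le_rfl (snocE Ω₁ T p) = y j p.1 ⬝ᵥ splitIncr S T p := by
      intro p
      rw [gain_snocE, gain_update, gain_zero, zero_add, Function.update_self]
      rfl
    have hpred : Pred Ω₁ d (Function.update (fun _ _ => 0) T (y j)) := pred_zero.update (hy j)
    have h1 := hNA _ hpred ?_
    · filter_upwards [hM.ae_ae_of_forall (hP' j) (hP'G j) hν h1] with x hx
      filter_upwards [hx] with z hz
      rwa [hgain] at hz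
    · intro P hP
      have hPp := hproj P hP
      obtain ⟨ν', hν', κ', hκ', hκ'G, κ'', hm, hae, rfl⟩ := exists_ext_of_mem_measFam hP
      have := isProbabilityMeasure_of_mem_measFam ν' hν'
      have hms := measurable_gain hM.meas hpred
      have hset : NullMeasurableSet {ω | 0 ≤ gain Ω₁ S (Function.update (fun _ _ => 0) T (y j))
          (T + 1) le_rfl ω} (ext ν' κ'') := hms measurableSet_Ici _ inferInstance
      refine (ae_ext_iff_of_null hset).2 ?_
      filter_upwards [ae_ae_of_ae_ext hPp, hae] with x hx1 hx2
      rw [hx2] at hx1 ⊢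
      filter_upwards [hpos j x (κ' x) (hκ'G x) hx1] with z hz
      rwa [hgain]
  filter_upwards [ae_all_iff.2 key] with x hx using hNAx x hx

lemma ae_exists_prevClaim (hM : Market Pt S (T + 1)) (hNA : NAS Pt S (T + 1)) (hΓ : Suslin Γ)
    (hproj : ∀ P ∈ MeasFam Ω₁ Pt (T + 1), ∀ᵐ ω ∂P, ∃ c, (ω, c) ∈ Γ)
    {ν : Measure (Fin T → Ω₁)} (hν : ν ∈ MeasFam Ω₁ Pt T) :
    ∀ᵐ x ∂ν, ∃ c, (x, c) ∈ prevClaim (stepGraph Pt T) (splitClaim Γ) (splitIncr S T) := by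
  obtain ⟨κ, hκ, hκG⟩ := hM.exists_selector
  filter_upwards [hM.ae_naAt hNA hΓ hproj hν, hM.ae_ae_of_forall hκ hκG hν hproj] with x hx1 hx2
  exact exists_mem_prevClaim hM.convex (suslin_splitClaim hΓ) hM.measurable_splitIncr hx1 (hκG x) hx2

lemma exists_hedge_succ (hM : Market Pt S (T + 1)) (hNA : NAS Pt S (T + 1)) (hΓ : Suslin Γ)
    (hproj : ∀ P ∈ MeasFam Ω₁ Pt (T + 1), ∀ᵐ ω ∂P, ∃ c, (ω, c) ∈ Γ) {a : ℝ}
    {H : (u : ℕ) → (Fin u → Ω₁) → Fin d → ℝ} (hH : Pred Ω₁ d H)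
    (h : ∀ P ∈ MeasFam Ω₁ Pt T, ∀ᵐ x ∂P, ∀ c,
      (x, c) ∈ prevClaim (stepGraph Pt T) (splitClaim Γ) (splitIncr S T) →
        c ≤ a + gain Ω₁ S H T le_rfl x) :
    ∃ H', Pred Ω₁ d H' ∧ ∀ P ∈ MeasFam Ω₁ Pt (T + 1), ∀ᵐ ω ∂P, ∀ c, (ω, c) ∈ Γ →
      c ≤ a + gain Ω₁ S H' (T + 1) le_rfl ω := by
  have ha : Measurable[univComp _] fun x => a + gain Ω₁ S H T le_rfl x :=
    (measurable_gain hM.pred.meas hH).const_add a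
  obtain ⟨y, hy, hyh⟩ := exists_hedge_step hM.suslin hM.convex (suslin_splitClaim hΓ)
    hM.measurable_splitIncr ha
  have hpred := hH.update hy
  refine ⟨Function.update H T y, hpred, fun P hP => ?_⟩
  obtain ⟨ν, hν, κ, hκ, hκG, κ', hm, hae, rfl⟩ := exists_ext_of_mem_measFam hP
  have := isProbabilityMeasure_of_mem_measFam ν hν
  have hbad : Suslin {q : (Fin (T + 1) → Ω₁) × ℝ | ∃ c, (q.1, c) ∈ Γ ∧ a + q.2 < c} := by
    refine Suslin.exists_mem (V := ℝ) (A := {q : ((Fin (T + 1) → Ω₁) × ℝ) × ℝ |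
      (q.1.1, q.2) ∈ Γ ∧ a + q.1.2 < q.2}) ?_
    have h1 : Measurable fun q : ((Fin (T + 1) → Ω₁) × ℝ) × ℝ => (q.1.1, q.2) := by fun_prop
    have h2 : Measurable fun q : ((Fin (T + 1) → Ω₁) × ℝ) × ℝ => a + q.1.2 := by fun_prop
    have h3 : Measurable fun q : ((Fin (T + 1) → Ω₁) × ℝ) × ℝ => q.2 := by fun_prop
    exact (hΓ.preimage h1).inter (measurableSet_lt h2 h3).suslin
  have hset : NullMeasurableSet {ω | ∀ c, (ω, c) ∈ Γ → c ≤ a + gain Ω₁ S (Function.update H T y)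
      (T + 1) le_rfl ω} (ext ν κ') := by
    have h1 := measurableSet_preimage_univ
      (measurable_id_prodMk_univ (measurable_gain hM.meas hpred)) hbad.univ
    convert (h1 (ext ν κ') inferInstance).compl using 1
    ext ω
    simp [not_exists, not_and, not_lt]
  refine (ae_ext_iff_of_null hset).2 ?_
  filter_upwards [h ν hν, hM.ae_naAt hNA hΓ hproj hν, hae] with x hx1 hx2 hx3
  rw [hx3]
  filter_upwards [hyh x hx2 hx1 (κ x) (hκG x)] with z hz c hc
  rw [gain_snocE, gain_update, Function.update_self, ← add_assoc]
  exact hz c hc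

end Market

end Backward

section Valuation

variable {Ω₁ : Type} [MeasurableSpace Ω₁] {d : ℕ}

/-- Up to equivalence, `Q` is a martingale measure which integrates any given weight and prices the
claim `w` at `v` or more. -/
def Valued (S : (t : ℕ) → (Fin t → Ω₁) → Fin d → ℝ) (T : ℕ) (Q : Measure (Fin T → Ω₁))
    (w : (Fin T → Ω₁) → ℝ) (v : ℝ) : Prop :=
  ∀ c : (Fin T → Ω₁) → ℝ≥0, Measurable c → ∃ Q' : Measure (Fin T → Ω₁), Q ≪ Q' ∧ Q' ≪ Q ∧
    MartK S T Q' ∧ ∫⁻ ω, c ω ∂Q' < ⊤ ∧ Integrable w Q' ∧ v ≤ ∫ ω, w ω ∂Q'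

variable {S : (t : ℕ) → (Fin t → Ω₁) → Fin d → ℝ} {T : ℕ}

lemma Valued.ext [StandardBorelSpace Ω₁] [Nonempty Ω₁] {Q₀ : Measure (Fin T → Ω₁)}
    [IsProbabilityMeasure Q₀] {u : (Fin T → Ω₁) → ℝ} (hu : Measurable u) {v : ℝ}
    (hQ₀ : Valued S T Q₀ u v) (hD : Measurable (splitIncr S T)) (κ : Kernel (Fin T → Ω₁) Ω₁)
    [IsMarkovKernel κ] {w : (Fin T → Ω₁) × Ω₁ → ℝ} (hw : Measurable w)
    (h : ∀ᵐ x ∂Q₀, (∀ i, Integrable (fun y => splitIncr S T (x, y) i) (κ x)) ∧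
      mean (fun y => splitIncr S T (x, y)) (κ x) = 0 ∧ Integrable (fun y => w (x, y)) (κ x) ∧
      u x < ∫ y, w (x, y) ∂κ x) :
    Valued S (T + 1) (ext Q₀ κ) (fun ω => w ((snocE Ω₁ T).symm ω)) v := by
  intro c hc
  let W : (Fin T → Ω₁) × Ω₁ → ℝ≥0 := fun p =>
    c (snocE Ω₁ T p) + ∑ i, ‖splitIncr S T p i‖₊ + ‖w p‖₊
  have hDi : ∀ i, Measurable fun p => splitIncr S T p i := fun i => measurable_pi_iff.1 hD i
  have hW : Measurable W :=
    ((hc.comp (snocE Ω₁ T).measurable).add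
      (Finset.measurable_sum _ fun i _ => (hDi i).nnnorm)).add hw.nnnorm
  have hWc : ∀ p, c (snocE Ω₁ T p) ≤ W p := fun p =>
    (le_add_of_nonneg_right (zero_le)).trans (le_add_of_nonneg_right (zero_le))
  have hWD : ∀ i p, |splitIncr S T p i| ≤ W p := by
    intro i p
    rw [← Real.norm_eq_abs, ← coe_nnnorm, NNReal.coe_le_coe]
    refine (Finset.single_le_sum (f := fun i => ‖splitIncr S T p i‖₊) (fun _ _ => zero_le)
      (Finset.mem_univ i)).trans ?_
    exact (le_add_of_nonneg_left zero_le).trans (le_add_of_nonneg_right zero_le)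
  have hWw : ∀ p, |w p| ≤ W p := by
    intro p
    rw [← Real.norm_eq_abs, ← coe_nnnorm, NNReal.coe_le_coe]
    exact le_add_of_nonneg_left zero_le
  obtain ⟨κ', hκ', hκ'h⟩ := exists_equiv_mart_kernel κ hD hw hW hu h
  have hWκ : Measurable fun x => ∫⁻ y, W (x, y) ∂κ' x :=
    Measurable.lintegral_kernel_prod_right' hW.coe_nnreal_ennreal
  obtain ⟨Q', hQQ', hQ'Q, hQ'm, hQ'c, hQ'u, hQ'v⟩ :=
    hQ₀ (fun x => (∫⁻ y, W (x, y) ∂κ' x).toNNReal) hWκ.ennreal_toNNReal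
  have hpr := hQ'm.isProbabilityMeasure
  have hκ'' := hκ'h.filter_mono hQ'Q.ae_le
  have hfin : ∫⁻ p, W p ∂(Q' ⊗ₘ κ') < ⊤ := by
    rw [Measure.lintegral_compProd hW.coe_nnreal_ennreal]
    refine (lintegral_mono_ae ?_).trans_lt hQ'c
    filter_upwards [hκ''] with x hx
    rw [ENNReal.coe_toNNReal hx.2.2.1.ne]
  have hwi : Integrable w (Q' ⊗ₘ κ') :=
    integrable_of_abs_le hfin hw.aestronglyMeasurable hWw
  refine ⟨BN.ext Q' κ', ext_absolutelyContinuous hQQ' (hκ'h.mono fun x hx => hx.1),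
    ext_absolutelyContinuous hQ'Q (hκ''.mono fun x hx => hx.2.1), ⟨Q', κ', hQ'm, hκ', rfl,
      fun i => integrable_of_abs_le hfin (hDi i).aestronglyMeasurable (hWD i),
      hκ''.mono fun x hx => hx.2.2.2.2.2.1⟩, ?_, ?_, ?_⟩
  · rw [BN.ext, lintegral_map hc.coe_nnreal_ennreal (snocE Ω₁ T).measurable]
    exact (lintegral_mono fun p => ENNReal.coe_le_coe.2 (hWc p)).trans_lt hfin
  · rw [BN.ext, (snocE Ω₁ T).measurableEmbedding.integrable_map_iff]
    simpa [Function.comp_def] using hwi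
  · rw [BN.ext, (snocE Ω₁ T).measurableEmbedding.integral_map]
    simp only [MeasurableEquiv.symm_apply_apply]
    rw [Measure.integral_compProd hwi]
    refine hQ'v.trans (integral_mono_ae hQ'u ?_ (hκ''.mono fun x hx => hx.2.2.2.2.2.2.le))
    exact Integrable.integral_compProd (κ := Kernel.const Unit Q')
      (η := Kernel.prodMkLeft Unit κ') (a := ()) hwi

end Valuation

section Duality

variable {Ω₁ : Type} [MeasurableSpace Ω₁] [TopologicalSpace Ω₁] [PolishSpace Ω₁] [BorelSpace Ω₁]
  [Nonempty Ω₁] {d : ℕ} {Pt : (t : ℕ) → (Fin t → Ω₁) → Set (ProbabilityMeasure Ω₁)}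
  {S : (t : ℕ) → (Fin t → Ω₁) → Fin d → ℝ} {T : ℕ}

/-- Superhedging duality for a set `Γ` of attainable payoffs: the set `I` of prices attained by
martingale measures determines which capitals suffice to superhedge. -/
lemma exists_prices_and_hedges (hM : Market Pt S T) (hNA : NAS Pt S T)
    {Γ : Set ((Fin T → Ω₁) × ℝ)} (hΓ : Suslin Γ)
    (hdown : ∀ p c c', (p, c) ∈ Γ → c' ≤ c → (p, c') ∈ Γ)
    (hproj : ∀ P ∈ MeasFam Ω₁ Pt T, ∀ᵐ ω ∂P, ∃ c, (ω, c) ∈ Γ) :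
    ∃ I : Set ℝ,
      (∀ a, (∀ v ∈ I, v ≤ a) → ∃ H, Pred Ω₁ d H ∧ ∀ P ∈ MeasFam Ω₁ Pt T, ∀ᵐ ω ∂P, ∀ c,
        (ω, c) ∈ Γ → c ≤ a + gain Ω₁ S H T le_rfl ω) ∧
      ∀ v ∈ I, ∀ P ∈ MeasFam Ω₁ Pt T, ∃ (Q : Measure (Fin T → Ω₁)) (w : (Fin T → Ω₁) → ℝ),
        IsProbabilityMeasure Q ∧ Measurable w ∧ P ≪ Q ∧ (∃ P' ∈ MeasFam Ω₁ Pt T, Q ≪ P') ∧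
        (∀ᵐ ω ∂Q, (ω, w ω) ∈ Γ) ∧ Valued S T Q w v := by
  induction T with
  | zero =>
    refine ⟨{v | ((Fin.elim0 : Fin 0 → Ω₁), v) ∈ Γ}, fun a ha => ⟨fun _ _ => 0, pred_zero,
      fun P _ => ae_of_all _ fun ω c hc => ?_⟩, fun v hv P hP => ?_⟩
    · rw [Subsingleton.elim ω Fin.elim0] at hc
      rw [gain_zero, add_zero]
      exact ha c hc
    · have hpr := isProbabilityMeasure_of_mem_measFam P hP
      refine ⟨P, fun _ => v, hpr, measurable_const, Measure.AbsolutelyContinuous.rfl,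
        ⟨P, hP, Measure.AbsolutelyContinuous.rfl⟩, ae_of_all _ fun ω => ?_, fun c hc => ?_⟩
      · rw [Subsingleton.elim ω Fin.elim0]
        exact hv
      · refine ⟨P, Measure.AbsolutelyContinuous.rfl, Measure.AbsolutelyContinuous.rfl, hpr, ?_,
          integrable_const _, by simp⟩
        have : (fun ω => (c ω : ℝ≥0∞)) = fun _ => (c Fin.elim0 : ℝ≥0∞) := by
          funext ω
          rw [Subsingleton.elim ω Fin.elim0]
        rw [this]
        simp
  | succ T ih =>
    have hΓ' := suslin_splitClaim hΓ
    obtain ⟨I, hI, hI'⟩ := ih hM.pred (hM.nas_pred hNA)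
      (suslin_prevClaim hM.suslin hΓ' hM.measurable_splitIncr)
      (fun p c c' => prevClaim_mono) (fun P hP => hM.ae_exists_prevClaim hNA hΓ hproj hP)
    refine ⟨I, fun a ha => ?_, fun v hv P hP => ?_⟩
    · obtain ⟨H, hH, h⟩ := hI a ha
      exact hM.exists_hedge_succ hNA hΓ hproj hH h
    · obtain ⟨P₀, hP₀, κ, hκ, hκG, κ', hκ'm, hκ'ae, rfl⟩ := exists_ext_of_mem_measFam hP
      have := isProbabilityMeasure_of_mem_measFam P₀ hP₀
      obtain ⟨Q₀, u, hQ₀, hu, hPQ₀, ⟨P₀', hP₀', hQP₀'⟩, hmem, hval⟩ := hI' v hv P₀ hP₀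
      have := isProbabilityMeasure_of_mem_measFam P₀' hP₀'
      obtain ⟨Q₁, P₁, w, hQ₁, hP₁, hP₁G, hw, h⟩ := exists_mart_claim_kernel hM.suslin
        hM.exists_mem hM.convex hΓ' (fun p c c' => hdown _ c c') hM.measurable_splitIncr hκ hκG hu
        (hQP₀'.ae_le (hM.ae_naAt hNA hΓ hproj hP₀'))
        (hQP₀'.ae_le (hM.ae_ae_of_forall hκ hκG hP₀' hproj)) hmem
      obtain ⟨P₁', hP₁'m, hP₁'ae, hP₁'mem⟩ := hM.exists_ext_mem hP₁ hP₁G hP₀'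
      have hP₁'Q := hQP₀'.ae_le hP₁'ae
      refine ⟨ext Q₀ Q₁, fun ω => w ((snocE Ω₁ T).symm ω), inferInstance,
        hw.comp (snocE Ω₁ T).symm.measurable, ?_, ⟨ext P₀' P₁', hP₁'mem, ?_⟩, ?_, ?_⟩
      · refine ext_absolutelyContinuous hPQ₀ ?_
        filter_upwards [hκ'ae, hPQ₀.ae_le h] with x hx1 hx2
        rw [hx1]
        exact hx2.1
      · refine ext_absolutelyContinuous hQP₀' ?_
        filter_upwards [hP₁'Q, h] with x hx1 hx2
        rw [hx1]
        exact hx2.2.1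
      · have hA : Suslin {ω | (ω, w ((snocE Ω₁ T).symm ω)) ∈ Γ} :=
          hΓ.preimage (f := fun ω => (ω, w ((snocE Ω₁ T).symm ω)))
            (measurable_id.prodMk (hw.comp (snocE Ω₁ T).symm.measurable))
        refine (ae_ext_iff_of_null (hA.nullMeasurableSet _)).2 ?_
        filter_upwards [h] with x hx
        filter_upwards [hx.2.2.2.2.2.2] with y hy
        rw [MeasurableEquiv.symm_apply_apply]
        exact hy
      · exact hval.ext hu hM.measurable_splitIncr Q₁ hw
          (h.mono fun x hx => ⟨hx.2.2.1, hx.2.2.2.1, hx.2.2.2.2.1, hx.2.2.2.2.2.1⟩)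

end Duality

section Mixtures

variable {Y : Type*} [MeasurableSpace Y]

lemma absolutelyContinuous_half_left (R R' : Measure Y) :
    R ≪ (2⁻¹ : ℝ≥0∞) • R + (2⁻¹ : ℝ≥0∞) • R' :=
  (Measure.AbsolutelyContinuous.smul_right Measure.AbsolutelyContinuous.rfl (by simp)).add_right _

lemma absolutelyContinuous_half_right (R R' : Measure Y) :
    R' ≪ (2⁻¹ : ℝ≥0∞) • R + (2⁻¹ : ℝ≥0∞) • R' := by
  rw [add_comm]
  exact absolutelyContinuous_half_left R' R

lemma exists_measurable_average (Y : Type*) [MeasurableSpace Y] :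
    ∃ m : ProbabilityMeasure Y × ProbabilityMeasure Y → ProbabilityMeasure Y, Measurable m ∧
      ∀ q, (m q : Measure Y) = (2⁻¹ : ℝ≥0∞) • (q.1 : Measure Y) + (2⁻¹ : ℝ≥0∞) • (q.2 : Measure Y) := by
  refine ⟨fun q => ⟨(2⁻¹ : ℝ≥0∞) • (q.1 : Measure Y) + (2⁻¹ : ℝ≥0∞) • (q.2 : Measure Y),
    isProbabilityMeasure_mix ENNReal.inv_two_add_inv_two⟩, ?_, fun q => rfl⟩
  refine measurable_probabilityMeasure_iff.2 ?_
  refine Measure.measurable_of_measurable_coe _ fun s hs => ?_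
  have h1 : Measurable fun q : ProbabilityMeasure Y × ProbabilityMeasure Y =>
      (q.1 : Measure Y) s :=
    (Measure.measurable_coe hs).comp (measurable_coe_probabilityMeasure.comp measurable_fst)
  have h2 : Measurable fun q : ProbabilityMeasure Y × ProbabilityMeasure Y =>
      (q.2 : Measure Y) s :=
    (Measure.measurable_coe hs).comp (measurable_coe_probabilityMeasure.comp measurable_snd)
  exact (h1.const_mul _).add (h2.const_mul _)

lemma expec_eq_coe_integral {Q : Measure Y} {f : Y → ℝ} (hf : Integrable f Q) :
    expec Q f = ((∫ y, f y ∂Q : ℝ) : EReal) := by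
  have h1 : ∫⁻ y, ENNReal.ofReal (f y) ∂Q ≠ ⊤ := hf.lintegral_lt_top.ne
  have h2 : ∫⁻ y, ENNReal.ofReal (-f y) ∂Q ≠ ⊤ := hf.neg.lintegral_lt_top.ne
  rw [expec, integral_eq_lintegral_pos_part_sub_lintegral_neg_part hf, EReal.coe_sub,
    EReal.coe_ennreal_toReal h1, EReal.coe_ennreal_toReal h2]

lemma quasiSure_univComp_iff {PP : Set (Measure Y)} {p : Y → Prop}
    (hp : MeasurableSet[univComp Y] {ω | p ω}) :
    QuasiSure PP (univComp Y) p ↔ ∀ P ∈ PP, ∀ᵐ ω ∂P, p ω := by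
  constructor
  · rintro ⟨A, -, hA, h⟩ P hP
    exact measure_mono_null hA (h P hP)
  · intro h
    exact ⟨{ω | ¬ p ω}, @MeasurableSet.compl _ _ (univComp Y) hp, subset_rfl, fun P hP => h P hP⟩

lemma integrable_of_abs_le_weight {f φ : Y → ℝ} (hf : Measurable f) (hfφ : ∀ y, |f y| ≤ φ y)
    {Q : Measure Y} (hQ : ∫⁻ y, ENNReal.ofReal (φ y) ∂Q < ⊤) : Integrable f Q := by
  refine ⟨hf.aestronglyMeasurable, (lintegral_mono fun y => ?_).trans_lt hQ⟩
  rw [← ofReal_norm, Real.norm_eq_abs]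
  exact ENNReal.ofReal_le_ofReal (hfφ y)

lemma isMartMeas_mix {Ω₁ : Type} [MeasurableSpace Ω₁] {d T : ℕ}
    {S : (t : ℕ) → (Fin t → Ω₁) → Fin d → ℝ} {Q Q' : Measure (Fin T → Ω₁)} (hQ : IsMartMeas Ω₁ S Q) (hQ' : IsMartMeas Ω₁ S Q') {a b : ℝ} (ha : 0 ≤ a) (hb : 0 ≤ b) :
    IsMartMeas Ω₁ S (ENNReal.ofReal a • Q + ENNReal.ofReal b • Q') := by
  refine ⟨fun t h i => integrable_mix (hQ.1 t h i) (hQ'.1 t h i), fun t h i A hA => ?_⟩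
  rw [Measure.restrict_add, Measure.restrict_smul, Measure.restrict_smul,
    integral_mix (hQ.1 _ h i).integrableOn (hQ'.1 _ h i).integrableOn ha hb,
    integral_mix (hQ.1 t _ i).integrableOn (hQ'.1 t _ i).integrableOn ha hb,
    hQ.2 t h i A hA, hQ'.2 t h i A hA]

end Mixtures

section FundamentalTheorem

variable {Ω₁ : Type} [MeasurableSpace Ω₁] [TopologicalSpace Ω₁] [PolishSpace Ω₁] [BorelSpace Ω₁]
  {d : ℕ} {Pt : (t : ℕ) → (Fin t → Ω₁) → Set (ProbabilityMeasure Ω₁)}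
  {S : (t : ℕ) → (Fin t → Ω₁) → Fin d → ℝ} {T : ℕ}

lemma Market.exists_dominating (hM : Market Pt S T) {P P' : Measure (Fin T → Ω₁)}
    (hP : P ∈ MeasFam Ω₁ Pt T) (hP' : P' ∈ MeasFam Ω₁ Pt T) :
    ∃ R ∈ MeasFam Ω₁ Pt T, P ≪ R ∧ P' ≪ R := by
  induction T with
  | zero =>
    have h1 : P = Measure.dirac Fin.elim0 := hP
    have h2 : P' = Measure.dirac Fin.elim0 := hP'
    exact ⟨P, hP, Measure.AbsolutelyContinuous.rfl, by
      rw [h1, h2]⟩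
  | succ T ih =>
    obtain ⟨ν, hν, κ, hκ, hκG, κ₁, hκ₁, hae, rfl⟩ := exists_ext_of_mem_measFam hP
    obtain ⟨ν', hν', κ', hκ', hκG', κ₁', hκ₁', hae', rfl⟩ := exists_ext_of_mem_measFam hP'
    obtain ⟨R, hR, hνR, hνR'⟩ := ih hM.pred hν hν'
    have := isProbabilityMeasure_of_mem_measFam ν hν
    have := isProbabilityMeasure_of_mem_measFam ν' hν'
    have := isProbabilityMeasure_of_mem_measFam R hR
    obtain ⟨m, hm, hmeq⟩ := exists_measurable_average Ω₁
    have hsel : Measurable[univComp _] fun x => m (κ x, κ' x) :=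
      hm.comp (measurable_prodMk_univ hκ hκ')
    obtain ⟨ρ, hρ, hρae, hρmem⟩ := hM.exists_ext_mem hsel (fun x => hM.convex x _ (hκG x) _
      (hκG' x) _ _ ENNReal.inv_two_add_inv_two _ (hmeq (κ x, κ' x))) hR
    refine ⟨ext R ρ, hρmem, ext_absolutelyContinuous hνR ?_, ext_absolutelyContinuous hνR' ?_⟩
    · filter_upwards [hae, hρae.filter_mono hνR.ae_le] with x hx1 hx2
      rw [hx1, hx2, hmeq]
      exact absolutelyContinuous_half_left _ _
    · filter_upwards [hae', hρae.filter_mono hνR'.ae_le] with x hx1 hx2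
      rw [hx1, hx2, hmeq]
      exact absolutelyContinuous_half_right _ _

/-- The martingale measures for the stocks which dominate `P` and integrate `φ`. -/
def martSet (Pt : (t : ℕ) → (Fin t → Ω₁) → Set (ProbabilityMeasure Ω₁))
    (S : (t : ℕ) → (Fin t → Ω₁) → Fin d → ℝ) (T : ℕ) (φ : (Fin T → Ω₁) → ℝ)
    (P : Measure (Fin T → Ω₁)) : Set (Measure (Fin T → Ω₁)) :=
  {Q | IsProbabilityMeasure Q ∧ P ≪ Q ∧ (∃ P' ∈ MeasFam Ω₁ Pt T, Q ≪ P') ∧ IsMartMeas Ω₁ S Q ∧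
    ∫⁻ ω, ENNReal.ofReal (φ ω) ∂Q < ⊤}

variable {φ : (Fin T → Ω₁) → ℝ} {P : Measure (Fin T → Ω₁)}

lemma exists_hedge_or_mem_martSet [Nonempty Ω₁] (hM : Market Pt S T) (hNA : NAS Pt S T)
    (hφ : Measurable[univComp _] φ) (hP : P ∈ MeasFam Ω₁ Pt T) {f : (Fin T → Ω₁) → ℝ}
    (hf : Measurable f) :
    (∃ H, Pred Ω₁ d H ∧ ∀ P' ∈ MeasFam Ω₁ Pt T, ∀ᵐ ω ∂P', f ω ≤ gain Ω₁ S H T le_rfl ω) ∨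
      ∃ Q ∈ martSet Pt S T φ P, 0 < ∫ ω, f ω ∂Q := by
  have hΓ : MeasurableSet {q : (Fin T → Ω₁) × ℝ | q.2 < f q.1} := by
    have h1 : Measurable fun q : (Fin T → Ω₁) × ℝ => q.2 := measurable_snd
    have h2 : Measurable fun q : (Fin T → Ω₁) × ℝ => f q.1 := hf.comp measurable_fst
    exact measurableSet_lt h1 h2
  obtain ⟨I, hI, hI'⟩ := exists_prices_and_hedges hM hNA hΓ.suslin
    (fun p c c' hc hcc' => lt_of_le_of_lt hcc' hc)
    (fun P' _ => ae_of_all _ fun ω => ⟨f ω - 1, sub_one_lt (f ω)⟩)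
  by_cases h : ∀ v ∈ I, v ≤ 0
  · obtain ⟨H, hH, hHh⟩ := hI 0 h
    refine Or.inl ⟨H, hH, fun P' hP' => ?_⟩
    filter_upwards [hHh P' hP'] with ω hω
    refine le_of_forall_lt_imp_le_of_dense fun c hc => ?_
    simpa using hω c hc
  · push Not at h
    obtain ⟨v, hv, hv0⟩ := h
    obtain ⟨Q, w, hQ, hw, hPQ, ⟨P', hP', hQP'⟩, hmem, hval⟩ := hI' v hv P hP
    have hae := aemeasurable_of_univ hφ Q
    obtain ⟨Q', hQQ', hQ'Q, hQ'm, hQ'c, hQ'w, hQ'v⟩ :=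
      hval (fun ω => ‖hae.mk φ ω‖₊ + ‖f ω‖₊) (hae.measurable_mk.nnnorm.add hf.nnnorm)
    have hpr := hQ'm.isProbabilityMeasure
    have hfi : Integrable f Q' := by
      refine integrable_of_abs_le hQ'c hf.aestronglyMeasurable fun ω => ?_
      rw [← Real.norm_eq_abs, ← coe_nnnorm, NNReal.coe_le_coe]
      exact le_add_of_nonneg_left zero_le
    refine Or.inr ⟨Q', ⟨hpr, hPQ.trans hQQ', ⟨P', hP', hQ'Q.trans hQP'⟩, hQ'm.isMartMeas hM.meas,
      (lintegral_mono_ae ?_).trans_lt hQ'c⟩, hv0.trans_le (hQ'v.trans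
        (integral_mono_ae hQ'w hfi ?_))⟩
    · filter_upwards [hae.ae_eq_mk.filter_mono hQ'Q.ae_le] with ω hω
      rw [hω, ENNReal.ofReal]
      refine ENNReal.coe_le_coe.2 (le_add_of_le_of_nonneg ?_ zero_le)
      exact Real.toNNReal_le_iff_le_coe.2 (le_abs_self _)
    · filter_upwards [hmem.filter_mono hQ'Q.ae_le] with ω hω using le_of_lt hω

lemma mix_mem_martSet (hM : Market Pt S T) {Q Q' : Measure (Fin T → Ω₁)}
    (hQ : Q ∈ martSet Pt S T φ P) (hQ' : Q' ∈ martSet Pt S T φ P) {a b : ℝ} (ha : 0 ≤ a)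
    (hb : 0 ≤ b) (hab : a + b = 1) :
    ENNReal.ofReal a • Q + ENNReal.ofReal b • Q' ∈ martSet Pt S T φ P := by
  obtain ⟨hp, hPQ, ⟨R, hR, hQR⟩, hm, hfin⟩ := hQ
  obtain ⟨hp', hPQ', ⟨R', hR', hQR'⟩, hm', hfin'⟩ := hQ'
  obtain ⟨R'', hR'', h1, h2⟩ := hM.exists_dominating hR hR'
  refine ⟨isProbabilityMeasure_mix (by rw [← ENNReal.ofReal_add ha hb, hab, ENNReal.ofReal_one]),
    ?_, ⟨R'', hR'', ?_⟩, isMartMeas_mix hm hm' ha hb, ?_⟩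
  · rcases ha.eq_or_lt with rfl | ha'
    · have : b = 1 := by linarith
      simpa [this] using hPQ'
    · exact (hPQ.smul_right (ENNReal.ofReal_pos.2 ha').ne').add_right _
  · exact ((hQR.trans h1).smul_left _).add_left ((hQR'.trans h2).smul_left _)
  · rw [lintegral_add_measure, lintegral_smul_measure, lintegral_smul_measure]
    exact ENNReal.add_lt_top.2 ⟨ENNReal.mul_lt_top ENNReal.ofReal_lt_top hfin,
      ENNReal.mul_lt_top ENNReal.ofReal_lt_top hfin'⟩

variable {e : ℕ} {g : Fin e → (Fin T → Ω₁) → ℝ}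

lemma measurable_gain_add (hS : ∀ t ≤ T, Measurable (S t)) (hg : ∀ i, Measurable (g i))
    {H : (u : ℕ) → (Fin u → Ω₁) → Fin d → ℝ} (hH : Pred Ω₁ d H) (h : Fin e → ℝ) :
    Measurable[univComp _] fun ω => gain Ω₁ S H T le_rfl ω + ∑ i, h i * g i ω :=
  (measurable_gain hS hH).add
    (Finset.measurable_sum _ fun i _ => (hg i).const_mul (h i)).univ

/-- No arbitrage, with the quasi-sure statements expressed through each measure. -/
lemma na_iff (hS : ∀ t ≤ T, Measurable (S t)) (hg : ∀ i, Measurable (g i)) :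
    NA Ω₁ (MeasFam Ω₁ Pt T) S g ↔ ∀ H, Pred Ω₁ d H → ∀ h : Fin e → ℝ,
      (∀ P ∈ MeasFam Ω₁ Pt T, ∀ᵐ ω ∂P, 0 ≤ gain Ω₁ S H T le_rfl ω + ∑ i, h i * g i ω) →
      ∀ P ∈ MeasFam Ω₁ Pt T, ∀ᵐ ω ∂P, gain Ω₁ S H T le_rfl ω + ∑ i, h i * g i ω = 0 := by
  refine forall_congr' fun H => forall_congr' fun hH => forall_congr' fun h => ?_
  have hm := measurable_gain_add hS hg hH h
  rw [quasiSure_univComp_iff (p := fun ω => 0 ≤ gain Ω₁ S H T le_rfl ω + ∑ i, h i * g i ω)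
      (hm measurableSet_Ici),
    quasiSure_univComp_iff (p := fun ω => gain Ω₁ S H T le_rfl ω + ∑ i, h i * g i ω = 0)
      (hm (measurableSet_singleton 0))]

lemma integral_gain_add_option [Nonempty Ω₁] (hS : ∀ t ≤ T, Measurable (S t))
    {Q : Measure (Fin T → Ω₁)} [IsProbabilityMeasure Q] (hQ : IsMartMeas Ω₁ S Q)
    (hg : ∀ i, Integrable (g i) Q) {H : (u : ℕ) → (Fin u → Ω₁) → Fin d → ℝ} (hH : Pred Ω₁ d H)
    {h : Fin e → ℝ} (hpos : ∀ᵐ ω ∂Q, 0 ≤ gain Ω₁ S H T le_rfl ω + ∑ i, h i * g i ω) :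
    Integrable (fun ω => gain Ω₁ S H T le_rfl ω + ∑ i, h i * g i ω) Q ∧
      ∫ ω, (gain Ω₁ S H T le_rfl ω + ∑ i, h i * g i ω) ∂Q = ∑ i, h i * ∫ ω, g i ω ∂Q := by
  have hZ : Integrable (fun ω => ∑ i, h i * g i ω) Q :=
    integrable_finsetSum _ fun i _ => (hg i).const_mul (h i)
  obtain ⟨h1, h2⟩ := (hQ.martK hS).integrable_gain hS hH hZ hpos
  refine ⟨h1.add hZ, ?_⟩
  rw [integral_add h1 hZ, h2, zero_add, integral_finsetSum _ fun i _ => (hg i).const_mul (h i)]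
  simp only [integral_const_mul]

lemma exists_calibrated_of_noArbitrage [Nonempty Ω₁] (hM : Market Pt S T)
    (hg : ∀ i, Measurable (g i)) (hφ : Measurable[univComp _] φ) (hgφ : ∀ i ω, |g i ω| ≤ φ ω)
    (hNA : NA Ω₁ (MeasFam Ω₁ Pt T) S g) (hP : P ∈ MeasFam Ω₁ Pt T) :
    ∃ Q ∈ martSet Pt S T φ P, ∀ i, ∫ ω, g i ω ∂Q = 0 := by
  rw [na_iff hM.meas hg] at hNA
  have hNAS : NAS Pt S T := fun H hH h P' hP' => by
    simpa using hNA H hH 0 (by simpa using h) P' hP'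
  have hpr := isProbabilityMeasure_of_mem_measFam P hP
  let G : (Fin T → Ω₁) → Fin e → ℝ := fun ω i => g i ω
  have hGi : ∀ Q ∈ martSet Pt S T φ P, ∀ i, Integrable (fun ω => G ω i) Q := fun Q hQ i =>
    integrable_of_abs_le_weight (hg i) (hgφ i) hQ.2.2.2.2
  have hconv : Convex ℝ (mean G '' martSet Pt S T φ P) := by
    rintro _ ⟨Q, hQ, rfl⟩ _ ⟨Q', hQ', rfl⟩ a b ha hb hab
    exact ⟨_, mix_mem_martSet hM hQ hQ' ha hb hab, mean_mix (hGi Q hQ) (hGi Q' hQ') ha hb⟩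
  have hne : (mean G '' martSet Pt S T φ P).Nonempty := by
    rcases exists_hedge_or_mem_martSet hM hNAS hφ hP (f := fun _ => 1) measurable_const with
      ⟨H, hH, h⟩ | ⟨Q, hQ, -⟩
    · have h0 := hNAS H hH (fun P' hP' => (h P' hP').mono fun ω hω => zero_le_one.trans hω) P hP
      obtain ⟨ω, h1, h2⟩ := ((h P hP).and h0).exists
      linarith
    · exact ⟨_, Q, hQ, rfl⟩
  suffices h0 : (0 : Fin e → ℝ) ∈ mean G '' martSet Pt S T φ P by
    obtain ⟨Q, hQ, h⟩ := h0
    exact ⟨Q, hQ, fun i => congrFun h i⟩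
  by_contra h0
  obtain ⟨F, hF, _, ⟨Q₀, hQ₀, rfl⟩, hF0⟩ := exists_separating_of_zero_notMem hconv hne h0
  obtain ⟨h, hFh⟩ := linearMap_eq_dotProduct F
  have hsum : ∀ Q ∈ martSet Pt S T φ P, F (mean G Q) = ∑ i, h i * ∫ ω, g i ω ∂Q :=
    fun Q _ => hFh _
  rcases exists_hedge_or_mem_martSet hM hNAS hφ hP (f := fun ω => -∑ i, h i * g i ω)
      (Finset.measurable_sum _ fun i _ => (hg i).const_mul (h i)).neg with
    ⟨H, hH, hhedge⟩ | ⟨Q, hQ, hQpos⟩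
  · have hpos : ∀ P' ∈ MeasFam Ω₁ Pt T, ∀ᵐ ω ∂P',
        0 ≤ gain Ω₁ S H T le_rfl ω + ∑ i, h i * g i ω := fun P' hP' =>
      (hhedge P' hP').mono fun ω hω => neg_le_iff_add_nonneg.1 hω
    have hzero := hNA H hH h hpos
    obtain ⟨hprQ, -, ⟨P', hP', hQP'⟩, hmart, -⟩ := id hQ₀
    obtain ⟨-, h2⟩ := integral_gain_add_option hM.meas hmart (hGi Q₀ hQ₀) hH
      ((hpos P' hP').filter_mono hQP'.ae_le)
    rw [integral_eq_zero_of_ae ((hzero P' hP').filter_mono hQP'.ae_le)] at h2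
    rw [hsum Q₀ hQ₀, ← h2] at hF0
    exact hF0.false
  · have h1 := hF _ ⟨Q, hQ, rfl⟩
    rw [hsum Q hQ] at h1
    rw [integral_neg, integral_finsetSum _ fun i _ => (hGi Q hQ i).const_mul (h i)] at hQpos
    simp only [G, integral_const_mul] at hQpos
    linarith

lemma noArbitrage_of_exists_calibrated [Nonempty Ω₁] (hS : ∀ t ≤ T, Measurable (S t))
    (hg : ∀ i, Measurable (g i)) (hgφ : ∀ i ω, |g i ω| ≤ φ ω)
    (h : ∀ P ∈ MeasFam Ω₁ Pt T, ∃ Q ∈ QSet Ω₁ (MeasFam Ω₁ Pt T) S g,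
      (∫⁻ ω, ENNReal.ofReal (φ ω) ∂Q) < ⊤ ∧ P ≪ Q) : NA Ω₁ (MeasFam Ω₁ Pt T) S g := by
  rw [na_iff hS hg]
  intro H hH k hpos P hP
  obtain ⟨Q, ⟨hpr, ⟨P', hP', hQP'⟩, hmart, hgQ⟩, hfin, hPQ⟩ := h P hP
  have hgi := fun i => integrable_of_abs_le_weight (hg i) (hgφ i) hfin
  have hposQ := (hpos P' hP').filter_mono hQP'.ae_le
  obtain ⟨h1, h2⟩ := integral_gain_add_option hS hmart hgi hH hposQ
  have h3 : ∀ i, ∫ ω, g i ω ∂Q = 0 := fun i => by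
    have := hgQ i
    rwa [expec_eq_coe_integral (hgi i), EReal.coe_eq_zero] at this
  simp only [h3, mul_zero, Finset.sum_const_zero] at h2
  exact ((integral_eq_zero_iff_of_nonneg_ae hposQ h1).1 h2).filter_mono hPQ.ae_le

end FundamentalTheorem

end BN

open BN in
/-- **Weighted First Fundamental Theorem** (Theorem 5.1(a)). For a weight function
`φ ≥ 1` dominating the options, `NA(𝒫)` holds iff every `P ∈ 𝒫` is dominated by
some `Q ∈ 𝒬_φ = {Q ∈ 𝒬 : E_Q[φ] < ∞}`. -/
theorem weighted_first_fundamental_theorem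
    (Ω₁ : Type) [MeasurableSpace Ω₁] [TopologicalSpace Ω₁] [PolishSpace Ω₁]
    [BorelSpace Ω₁] [Nonempty Ω₁] (T d e : ℕ)
    (Pt : (t : ℕ) → (Fin t → Ω₁) → Set (ProbabilityMeasure Ω₁))
    (hPtne : ∀ t, t < T → ∀ ω, (Pt t ω).Nonempty)
    (hPtconv : ∀ t, t < T → ∀ ω, ConvexPM (Pt t ω))
    (hPtgraph : ∀ t, t < T →
      AnalyticSet {p : (Fin t → Ω₁) × ProbabilityMeasure Ω₁ | p.2 ∈ Pt t p.1})
    (S : (t : ℕ) → (Fin t → Ω₁) → Fin d → ℝ) (hS : ∀ t, t ≤ T → Measurable (S t))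
    (g : Fin e → (Fin T → Ω₁) → ℝ) (hg : ∀ i, Measurable (g i))
    (φ : (Fin T → Ω₁) → ℝ) (hφmeas : @Measurable _ _ (univComp (Fin T → Ω₁)) _ φ)
    (hφ1 : ∀ ω, 1 ≤ φ ω) (hgφ : ∀ i ω, |g i ω| ≤ φ ω) :
    NA Ω₁ (MeasFam Ω₁ Pt T) S g ↔
      ∀ P ∈ MeasFam Ω₁ Pt T,
        ∃ Q ∈ QSet Ω₁ (MeasFam Ω₁ Pt T) S g,
          (∫⁻ ω, ENNReal.ofReal (φ ω) ∂Q) < ⊤ ∧ P ≪ Q := by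
  have hM : Market Pt S T := ⟨hPtne, hPtconv, hPtgraph, hS⟩
  refine ⟨fun hNA P hP => ?_, noArbitrage_of_exists_calibrated hS hg hgφ⟩
  obtain ⟨Q, ⟨hpr, hPQ, hdom, hmart, hfin⟩, hQ⟩ :=
    exists_calibrated_of_noArbitrage hM hg hφmeas hgφ hNA hP
  refine ⟨Q, ⟨hpr, hdom, hmart, fun i => ?_⟩, hfin, hPQ⟩
  rw [expec_eq_coe_integral (integrable_of_abs_le_weight (hg i) (hgφ i) hfin), hQ i,
    EReal.coe_zero]
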